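/- Systolic groups are not simply connected at infinity. That is, if G is a group acting properly discontinuously and cocompactly by simplicial automorphisms on a systolic complex, then it is not the case that Conn_k^∞(G) holds for every k = −1, 0, 1. -/

import Mathlib

universe u

/-- An abstract simplicial complex on a vertex type `V`: a downward-closed
family of nonempty finite subsets of `V`. -/
structure SComplex (V : Type u) where
  faces : Set (Finset V)
  nonempty_of_mem : ∀ σ ∈ faces, σ.Nonempty
  down_closed : ∀ σ ∈ faces, ∀ τ : Finset V, τ ⊆ σ → τ.Nonempty → τ ∈ faces

namespace SComplex

variable {V : Type u} [DecidableEq V]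

/-- The vertex set of a simplicial complex. -/
def vertexSet (X : SComplex V) : Set V := {v | ({v} : Finset V) ∈ X.faces}

/-- The geometric realization of a simplicial complex: the set of barycentric
coordinate functions supported on a simplex, inside the product space `V → ℝ`. -/
def realization (X : SComplex V) : Set (V → ℝ) :=
  {f | (∀ v, 0 ≤ f v) ∧ ∃ σ ∈ X.faces, (∀ v, v ∉ σ → f v = 0) ∧ ∑ v ∈ σ, f v = 1}

/-- `Y` is a subcomplex of `X`. -/
def IsSubcomplexOf (Y X : SComplex V) : Prop := Y.faces ⊆ X.faces

/-- `Y` is a full subcomplex of `X`. -/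
def IsFullSubcomplexOf (Y X : SComplex V) : Prop :=
  Y.faces ⊆ X.faces ∧
    ∀ σ ∈ X.faces, (∀ v ∈ σ, ({v} : Finset V) ∈ Y.faces) → σ ∈ Y.faces

/-- The full subcomplex of `X` spanned by a set `W` of vertices. -/
def restrict (X : SComplex V) (W : Set V) : SComplex V where
  faces := {σ | σ ∈ X.faces ∧ ∀ v ∈ σ, v ∈ W}
  nonempty_of_mem := fun σ h => X.nonempty_of_mem σ h.1
  down_closed := fun σ h τ hτ hne =>
    ⟨X.down_closed σ h.1 τ hτ hne, fun v hv => h.2 v (hτ hv)⟩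

/-- The link of a simplex `σ` in `X`. -/
def link (X : SComplex V) (σ : Finset V) : SComplex V where
  faces := {τ | τ ∈ X.faces ∧ Disjoint τ σ ∧ τ ∪ σ ∈ X.faces}
  nonempty_of_mem := fun τ h => X.nonempty_of_mem τ h.1
  down_closed := by
    rintro τ ⟨hτ, hdisj, hunion⟩ ρ hρ hne
    refine ⟨X.down_closed τ hτ ρ hρ hne, ?_, ?_⟩
    · exact Finset.disjoint_left.mpr fun a ha hb => Finset.disjoint_left.mp hdisj (hρ ha) hb
    · exact X.down_closed _ hunion _ (Finset.union_subset_union hρ (subset_refl σ))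
        (hne.mono Finset.subset_union_left)

/-- A combinatorial cycle of length `m` in `X` (a subcomplex homeomorphic to a circle):
an injective enumeration of `m` vertices, consecutive ones joined by edges of `X`. -/
def IsCycle (X : SComplex V) (m : ℕ) (γ : ZMod m → V) : Prop :=
  3 ≤ m ∧ Function.Injective γ ∧ ∀ i : ZMod m, ({γ i, γ (i + 1)} : Finset V) ∈ X.faces

/-- The cycle `γ` has a diagonal: an edge of `X` joining two nonconsecutive vertices. -/
def HasDiagonal (X : SComplex V) (m : ℕ) (γ : ZMod m → V) : Prop :=
  ∃ i j : ZMod m, j ≠ i ∧ j ≠ i + 1 ∧ j ≠ i - 1 ∧ ({γ i, γ j} : Finset V) ∈ X.faces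

/-- A simplicial complex is flag if every finite set of vertices pairwise joined
by edges spans a simplex. -/
def Flag (X : SComplex V) : Prop :=
  ∀ A : Finset V, A.Nonempty → (∀ v ∈ A, ({v} : Finset V) ∈ X.faces) →
    (∀ v ∈ A, ∀ w ∈ A, v ≠ w → ({v, w} : Finset V) ∈ X.faces) → A ∈ X.faces

/-- A simplicial complex is `k`-large if it is flag and every cycle of length
`4 ≤ |γ| < k` has a diagonal. -/
def KLarge (k : ℕ) (X : SComplex V) : Prop :=
  X.Flag ∧ ∀ (m : ℕ) (γ : ZMod m → V), X.IsCycle m γ → 4 ≤ m → m < k → X.HasDiagonal m γ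

/-- A simplicial complex is locally `k`-large if all links of its (nonempty) simplices
are `k`-large. -/
def LocallyKLarge (k : ℕ) (X : SComplex V) : Prop :=
  ∀ σ ∈ X.faces, KLarge k (X.link σ)

/-- A systolic complex: connected, simply connected and locally `6`-large. -/
def Systolic (X : SComplex V) : Prop :=
  LocallyKLarge 6 X ∧ ConnectedSpace X.realization ∧ SimplyConnectedSpace X.realization

/-- A simplicial complex is locally finite if every vertex belongs to finitely
many simplices. -/
def LocallyFinite (X : SComplex V) : Prop :=
  ∀ v : V, {σ ∈ X.faces | v ∈ σ}.Finite

/-- The faces of the closed combinatorial ball of radius `i` around the simplex `σ`: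
`B_0 = σ` and `B_{i+1}` is the union of all closed simplices meeting `B_i`. -/
def ballFaces (X : SComplex V) (σ : Finset V) : ℕ → Set (Finset V)
  | 0 => {τ | τ ∈ X.faces ∧ τ ⊆ σ}
  | i + 1 => {ρ | ρ ∈ X.faces ∧ ∃ τ ∈ X.faces, ρ ⊆ τ ∧
      ∃ v ∈ τ, ({v} : Finset V) ∈ X.ballFaces σ i}

/-- The closed combinatorial ball of radius `i` around `σ`, as a subcomplex. -/
def ball (X : SComplex V) (σ : Finset V) (i : ℕ) : SComplex V where
  faces := X.ballFaces σ i
  nonempty_of_mem := by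
    cases i with
    | zero => exact fun τ h => X.nonempty_of_mem τ h.1
    | succ n => exact fun τ h => X.nonempty_of_mem τ h.1
  down_closed := by
    cases i with
    | zero => exact fun τ h ρ hsub hne =>
        ⟨X.down_closed τ h.1 ρ hsub hne, hsub.trans h.2⟩
    | succ n =>
        rintro τ ⟨hτ, μ, hμ, hsub2, v, hv, hball⟩ ρ hsub hne
        exact ⟨X.down_closed τ hτ ρ hsub hne, μ, hμ, hsub.trans hsub2, v, hv, hball⟩

/-- The faces of the combinatorial sphere of radius `i` around `σ`: the faces of the
ball `B_i` all of whose vertices are at combinatorial distance exactly `i` from `σ`. -/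
def sphereFaces (X : SComplex V) (σ : Finset V) : ℕ → Set (Finset V)
  | 0 => X.ballFaces σ 0
  | i + 1 => {τ | τ ∈ X.ballFaces σ (i + 1) ∧
      ∀ v ∈ τ, ({v} : Finset V) ∉ X.ballFaces σ i}

/-- The combinatorial sphere of radius `i` around `σ`, as a subcomplex: the subcomplex
of `B_i` spanned by the vertices at combinatorial distance `i` from `σ`. -/
def sphere (X : SComplex V) (σ : Finset V) (i : ℕ) : SComplex V where
  faces := X.sphereFaces σ i
  nonempty_of_mem := by
    cases i with
    | zero => exact fun τ h => (X.ball σ 0).nonempty_of_mem τ h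
    | succ n => exact fun τ h => (X.ball σ (n + 1)).nonempty_of_mem τ h.1
  down_closed := by
    cases i with
    | zero => exact fun τ h ρ hsub hne => (X.ball σ 0).down_closed τ h ρ hsub hne
    | succ n =>
        rintro τ ⟨hτ, hout⟩ ρ hsub hne
        exact ⟨(X.ball σ (n + 1)).down_closed τ hτ ρ hsub hne,
          fun v hv => hout v (hsub hv)⟩

/-- The condition `R(v,X)`: for every simplex `σ` of the link `X_v`, the complement
in `X_v` of the open combinatorial ball of radius `2` around `σ` (i.e. the full
subcomplex of `X_v` spanned by the vertices at combinatorial distance at least `2`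
from `σ`) is connected. -/
def CondR (X : SComplex V) (v : V) : Prop :=
  ∀ σ ∈ (X.link {v}).faces,
    ConnectedSpace
      ((X.link {v}).restrict
        {w | ({w} : Finset V) ∉ (X.link {v}).ballFaces σ 1}).realization

/-- A chamber complex of dimension `n`: every simplex is contained in a simplex with
`n+1` vertices (a chamber), there are no larger simplices, and every codimension-one
face lies in at least two chambers. -/
def IsChamberComplex (X : SComplex V) (n : ℕ) : Prop :=
  (∀ σ ∈ X.faces, σ.card ≤ n + 1) ∧
  (∀ σ ∈ X.faces, ∃ τ ∈ X.faces, σ ⊆ τ ∧ τ.card = n + 1) ∧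
  (∀ σ ∈ X.faces, σ.card = n →
    ∃ τ₁ ∈ X.faces, ∃ τ₂ ∈ X.faces, τ₁ ≠ τ₂ ∧ σ ⊆ τ₁ ∧ σ ⊆ τ₂ ∧
      τ₁.card = n + 1 ∧ τ₂.card = n + 1)

/-- Two chambers of an `n`-dimensional chamber complex are adjacent if they share a
codimension-one face. -/
def ChamberAdj (X : SComplex V) (n : ℕ) (σ τ : Finset V) : Prop :=
  σ ∈ X.faces ∧ τ ∈ X.faces ∧ σ.card = n + 1 ∧ τ.card = n + 1 ∧
    ∃ ρ ∈ X.faces, ρ.card = n ∧ ρ ⊆ σ ∧ ρ ⊆ τ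

/-- A chamber complex is gallery connected if any two chambers are joined by a gallery. -/
def GalleryConnected (X : SComplex V) (n : ℕ) : Prop :=
  ∀ σ ∈ X.faces, σ.card = n + 1 → ∀ τ ∈ X.faces, τ.card = n + 1 →
    Relation.ReflTransGen (X.ChamberAdj n) σ τ

/-- A normal chamber complex: gallery connected, with all links of dimension above `0`
gallery connected. -/
def IsNormalChamberComplex (X : SComplex V) (n : ℕ) : Prop :=
  IsChamberComplex X n ∧ GalleryConnected X n ∧
    ∀ σ ∈ X.faces, σ.card ≤ n - 1 → GalleryConnected (X.link σ) (n - σ.card)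

/-- A pseudomanifold of dimension `n`: a chamber complex in which every codimension-one
face belongs to exactly two chambers. -/
def IsPseudomanifold (X : SComplex V) (n : ℕ) : Prop :=
  IsChamberComplex X n ∧
    ∀ σ ∈ X.faces, σ.card = n →
      ({τ | τ ∈ X.faces ∧ σ ⊆ τ ∧ τ.card = n + 1} : Set (Finset V)).ncard = 2

/-- The dimension of a (finite-dimensional) simplicial complex. -/
noncomputable def dim (X : SComplex V) : ℕ := sSup {n : ℕ | ∃ σ ∈ X.faces, σ.card = n + 1}

/-- A simplicial complex is finite dimensional. -/
def IsFiniteDimensional (X : SComplex V) : Prop :=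
  ∃ N : ℕ, ∀ σ ∈ X.faces, σ.card ≤ N + 1

end SComplex
/-- The condition `Conn_n^∞(Y)`: for every compact `K ⊆ Y` there is a compact
`L ⊇ K` such that every map of the `n`-sphere into `Y ∖ L` extends to a map of the
`(n+1)`-ball into `Y ∖ K`. -/
def ConnInfty (Y : Type u) [TopologicalSpace Y] (n : ℤ) : Prop :=
  ∀ K : Set Y, IsCompact K → ∃ L : Set Y, IsCompact L ∧ K ⊆ L ∧
    ∀ f : EuclideanSpace ℝ (Fin (n + 1).toNat) → Y,
      ContinuousOn f (Metric.sphere 0 1) →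
      (∀ x ∈ Metric.sphere (0 : EuclideanSpace ℝ (Fin (n + 1).toNat)) 1, f x ∉ L) →
      ∃ g : EuclideanSpace ℝ (Fin (n + 1).toNat) → Y,
        ContinuousOn g (Metric.closedBall 0 1) ∧
        (∀ x ∈ Metric.closedBall (0 : EuclideanSpace ℝ (Fin (n + 1).toNat)) 1, g x ∉ K) ∧
        ∀ x ∈ Metric.sphere (0 : EuclideanSpace ℝ (Fin (n + 1).toNat)) 1, g x = f x

/-- A space is `n`-connected at infinity if `Conn_k^∞` holds for all `-1 ≤ k ≤ n`. -/
def ConnectedAtInftyUpTo (Y : Type u) [TopologicalSpace Y] (n : ℤ) : Prop :=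
  ∀ k : ℤ, -1 ≤ k → k ≤ n → ConnInfty Y k

/-- A CW structure on a topological space `X`: cells in each dimension with
characteristic maps defined on closed unit balls, such that the open cells partition
`X`, attaching spheres land in lower-dimensional cells, each closed cell meets only
finitely many open cells, and `X` carries the weak topology. -/
structure CWStructure (X : Type u) [TopologicalSpace X] where
  cell : ℕ → Type
  attach : (n : ℕ) → cell n → (EuclideanSpace ℝ (Fin n) → X)
  continuousOn_attach : ∀ n i, ContinuousOn (attach n i) (Metric.closedBall 0 1)
  injOn_attach : ∀ n i, Set.InjOn (attach n i) (Metric.ball 0 1)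
  pairwiseDisjoint :
    Set.univ.PairwiseDisjoint
      (fun p : Σ n, cell n => attach p.1 p.2 '' Metric.ball 0 1)
  cover : (⋃ p : Σ n, cell n, attach p.1 p.2 '' Metric.ball 0 1) = Set.univ
  attach_sphere : ∀ n i, attach n i '' Metric.sphere 0 1 ⊆
    ⋃ (p : Σ m, cell m) (_ : p.1 < n), attach p.1 p.2 '' Metric.ball 0 1
  closure_finiteness : ∀ n i,
    {p : Σ m, cell m | (attach p.1 p.2 '' Metric.ball 0 1) ∩
      (attach n i '' Metric.closedBall 0 1) ≠ ∅}.Finite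
  weak_topology : ∀ A : Set X,
    (∀ n i, IsClosed {x : EuclideanSpace ℝ (Fin n) |
      x ∈ Metric.closedBall 0 1 ∧ attach n i x ∈ A}) → IsClosed A

/-- The open cell of a CW structure. -/
def CWStructure.openCell {X : Type u} [TopologicalSpace X] (cw : CWStructure X)
    (n : ℕ) (i : cw.cell n) : Set X :=
  cw.attach n i '' Metric.ball 0 1

/-- A rigid cellular action of a group on a CW complex: the action is by
homeomorphisms permuting the open cells, and any element stabilizing a cell fixes it
pointwise. -/
def IsRigidCellularAction (G : Type) [Group G] {X : Type u} [TopologicalSpace X]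
    [MulAction G X] (cw : CWStructure X) : Prop :=
  (∀ g : G, Continuous fun x : X => g • x) ∧
  (∀ (g : G) (n : ℕ) (i : cw.cell n), ∃ j : cw.cell n,
    (fun x => g • x) '' cw.openCell n i = cw.openCell n j) ∧
  (∀ (g : G) (n : ℕ) (i : cw.cell n),
    (fun x => g • x) '' cw.openCell n i = cw.openCell n i →
      ∀ x ∈ cw.openCell n i, g • x = x)

/-- A group action on a topological space is cocompact. -/
def IsCocompactAction (G : Type) (X : Type u) [Group G] [TopologicalSpace X]
    [MulAction G X] : Prop :=
  ∃ K : Set X, IsCompact K ∧ (⋃ g : G, (fun x => g • x) '' K) = Set.univ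

/-- The condition `Conn_n^∞(G)` for a group `G`: `Conn_n^∞(X)` holds for every
contractible rigid `G`-CW complex `X` on which `G` acts properly discontinuously and
cocompactly. -/
def ConnInftyGroup (G : Type) [Group G] (n : ℤ) : Prop :=
  ∀ (X : Type) [TopologicalSpace X] [MulAction G X],
    ContractibleSpace X →
    (∃ cw : CWStructure X, IsRigidCellularAction G cw) →
    ProperlyDiscontinuousSMul G X →
    IsCocompactAction G X →
    ConnInfty X n

namespace SComplex

variable {V : Type u} [DecidableEq V]

/-- A group action on the vertices is simplicial if it maps faces to faces. -/
def IsSimplicialAction (G : Type) [Group G] [MulAction G V] (X : SComplex V) : Prop :=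
  ∀ (g : G), ∀ σ ∈ X.faces, σ.image (fun v => g • v) ∈ X.faces

/-- A simplicial action is properly discontinuous: all simplex stabilizers are finite. -/
def HasFiniteStabilizers (G : Type) [Group G] [MulAction G V] (X : SComplex V) : Prop :=
  ∀ σ ∈ X.faces, {g : G | σ.image (fun v => g • v) = σ}.Finite

/-- A simplicial action is cocompact: there are finitely many orbits of simplices. -/
def IsCocompactSAction (G : Type) [Group G] [MulAction G V] (X : SComplex V) : Prop :=
  ∃ S : Set (Finset V), S.Finite ∧
    ∀ τ ∈ X.faces, ∃ σ ∈ S, ∃ g : G, τ = σ.image (fun v => g • v)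

end SComplex

/-- A systolic group: a group admitting a properly discontinuous cocompact action by
simplicial automorphisms on a systolic complex. -/
def IsSystolicGroup (G : Type) [Group G] : Prop :=
  ∃ (V : Type) (_ : DecidableEq V) (X : SComplex V) (_ : MulAction G V),
    X.Systolic ∧ X.IsSimplicialAction G ∧ X.HasFiniteStabilizers G ∧
      X.IsCocompactSAction G

/-- The two-dimensional local data of a locally `6`-large complex: its edges and triangles,
together with the filling conditions on short cycles in links of vertices. -/
structure TriData (V : Type u) where
  Adj : V → V → Prop
  T : V → V → V → Prop
  adj_symm : ∀ {a b}, Adj a b → Adj b a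
  adj_ne : ∀ {a b}, Adj a b → a ≠ b
  swap₁₂ : ∀ {a b c}, T a b c → T b a c
  swap₂₃ : ∀ {a b c}, T a b c → T a c b
  adj_of_T : ∀ {a b c}, T a b c → Adj a b
  fill₃ : ∀ {v a b c}, T v a b → T v b c → T v a c → T a b c
  fill₄ : ∀ {v a b c d}, T v a b → T v b c → T v c d → T v d a → a ≠ c → b ≠ d →
    T v a c ∨ T v b d
  fill₅ : ∀ {v a b c d e}, T v a b → T v b c → T v c d → T v d e → T v e a →
    a ≠ c → a ≠ d → b ≠ d → b ≠ e → c ≠ e →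
    T v a c ∨ T v a d ∨ T v b d ∨ T v b e ∨ T v c e

/-- One sphere of the development of a locally `6`-large complex: its vertices `S`, their
images `p`, the horizontal edges `H`, and the images `D x` of the parents of each vertex. -/
structure SphereLayer {V : Type u} (Y : TriData V) where
  S : Type u
  p : S → V
  H : S → S → Prop
  D : S → V → Prop
  H_symm : ∀ {x y}, H x y → H y x
  H_adj : ∀ {x y}, H x y → Y.Adj (p x) (p y)
  D_adj : ∀ {x d}, D x d → Y.Adj (p x) d
  D_clique : ∀ {x d e}, D x d → D x e → d ≠ e → Y.T (p x) d e
  H_notD : ∀ {x y}, H x y → ¬ D x (p y)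
  H_inj : ∀ {x y z}, H x y → H x z → p y = p z → y = z
  H_tri : ∀ {x y z}, H x y → H x z → y ≠ z → (H y z ↔ Y.T (p x) (p y) (p z))
  D_trans : ∀ {x y d}, H x y → D x d → Y.T (p x) (p y) d → D y d
  D_tri : ∀ {x d z}, D x d → Y.T (p x) d z → D x z ∨ ∃ y, H x y ∧ p y = z
  common : ∀ {x y}, H x y → ∃ d, D x d ∧ D y d ∧ Y.T (p x) (p y) d

namespace SphereLayer

variable {V : Type u} {Y : TriData V} (L : SphereLayer Y)

/-- `z` is a neighbour of the image of `x` which is not yet realised in the development. -/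
def IsOpen (x : L.S) (z : V) : Prop :=
  Y.Adj (L.p x) z ∧ ¬ L.D x z ∧ ∀ y, L.H x y → L.p y ≠ z

variable {L}

theorem isOpen_of_H {x y : L.S} {z : V} (h : L.H x y) (t : Y.T (L.p x) (L.p y) z)
    (o : L.IsOpen x z) : L.IsOpen y z := by
  have t' := Y.swap₁₂ t
  refine ⟨Y.adj_of_T (Y.swap₂₃ t'), fun hd => ?_, fun w hw e => ?_⟩
  · exact o.2.1 (L.D_trans (L.H_symm h) hd t')
  · subst e
    have hx := (L.H_symm h)
    have hne : x ≠ w := by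
      rintro rfl
      exact Y.adj_ne (Y.adj_of_T (Y.swap₂₃ t)) rfl
    exact o.2.2 w ((L.H_tri hx hw hne).2 t') rfl

/-- Two extensions of vertices of the layer define the same vertex of the next layer. -/
def Rel (L : SphereLayer Y) (q r : {q : L.S × V // L.IsOpen q.1 q.2}) : Prop :=
  q.1.2 = r.1.2 ∧ (q.1.1 = r.1.1 ∨ L.H q.1.1 r.1.1 ∧ Y.T (L.p q.1.1) (L.p r.1.1) q.1.2)

theorem H_trans {x y w : L.S} {z : V} (hy : L.IsOpen y z)
    (hxy : L.H x y) (hyw : L.H y w) (t : Y.T (L.p x) (L.p y) z) (s : Y.T (L.p y) (L.p w) z)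
    (hne : x ≠ w) : L.H x w ∧ Y.T (L.p x) (L.p w) z := by
  have hyx := L.H_symm hxy
  have t' := Y.swap₁₂ t
  suffices h : Y.T (L.p y) (L.p x) (L.p w) from
    ⟨(L.H_tri hyx hyw hne).2 h, Y.fill₃ h s t'⟩
  have hpne : L.p x ≠ L.p w := fun e => hne (L.H_inj hyx hyw e)
  have key : ∀ d, L.D y d → Y.T (L.p y) (L.p x) d → Y.T (L.p y) (L.p w) d →
      Y.T (L.p y) (L.p x) (L.p w) := by
    intro d hd h1 h2
    have hzd : z ≠ d := by rintro rfl; exact hy.2.1 hd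
    rcases Y.fill₄ (Y.swap₂₃ t') h1 (Y.swap₂₃ h2) s hzd hpne with h | h
    · rcases L.D_tri hd (Y.swap₂₃ h) with h | ⟨u, hu, e⟩
      · exact (hy.2.1 h).elim
      · exact (hy.2.2 u hu e).elim
    · exact h
  obtain ⟨d, hdy, hdx, td⟩ := L.common hyx
  obtain ⟨e, hey, hew, te⟩ := L.common hyw
  by_cases hde : d = e
  · subst hde; exact key d hdy td te
  have hzd : z ≠ d := by rintro rfl; exact hy.2.1 hdy
  have hze : z ≠ e := by rintro rfl; exact hy.2.1 hey
  have hxe : L.p x ≠ e := by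
    rintro rfl; exact L.H_notD hyx hey
  have hdw : d ≠ L.p w := by
    rintro rfl; exact L.H_notD hyw hdy
  have notz : ∀ d, L.D y d → ¬ Y.T (L.p y) z d := fun d hd h => by
    rcases L.D_tri hd (Y.swap₂₃ h) with h | ⟨u, hu, e⟩
    · exact hy.2.1 h
    · exact hy.2.2 u hu e
  rcases Y.fill₅ (Y.swap₂₃ t') td (L.D_clique hdy hey hde) (Y.swap₂₃ te) s hzd hze hxe hpne hdw
    with h | h | h | h | h
  · exact (notz d hdy h).elim
  · exact (notz e hey h).elim
  · exact key e hey h te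
  · exact h
  · exact key d hdy td (Y.swap₂₃ h)

theorem rel_equivalence : Equivalence L.Rel where
  refl q := ⟨rfl, Or.inl rfl⟩
  symm := by
    rintro ⟨⟨x, z⟩, hx⟩ ⟨⟨y, z'⟩, hy⟩ ⟨e, h⟩
    simp only at e h
    subst e
    refine ⟨rfl, ?_⟩
    rcases h with h | ⟨h, t⟩
    · exact Or.inl h.symm
    · exact Or.inr ⟨L.H_symm h, Y.swap₁₂ t⟩
  trans := by
    rintro ⟨⟨x, z⟩, hx⟩ ⟨⟨y, z'⟩, hy⟩ ⟨⟨w, z''⟩, hw⟩ ⟨e, h⟩ ⟨e', h'⟩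
    simp only at e h e' h'
    subst e e'
    refine ⟨rfl, ?_⟩
    simp only
    rcases h with rfl | ⟨h, t⟩
    · exact h'
    rcases h' with rfl | ⟨h', t'⟩
    · exact Or.inr ⟨h, t⟩
    by_cases hne : x = w
    · exact Or.inl hne
    · exact Or.inr (H_trans hy h h' t t' hne)

/-- The setoid on extensions whose quotient is the next layer. -/
def nextSetoid (L : SphereLayer Y) : Setoid {q : L.S × V // L.IsOpen q.1 q.2} :=
  ⟨L.Rel, rel_equivalence⟩

/-- The vertices of the next layer. -/
def NextS (L : SphereLayer Y) : Type u := Quotient L.nextSetoid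

/-- The image of a vertex of the next layer. -/
def nextP (L : SphereLayer Y) : L.NextS → V :=
  Quotient.lift (fun q => q.1.2) fun _ _ h => h.1

/-- `x` is a parent of the vertex `a` of the next layer. -/
def Par (L : SphereLayer Y) (x : L.S) (a : L.NextS) : Prop :=
  ∃ h : L.IsOpen x (L.nextP a), a = Quotient.mk L.nextSetoid ⟨(x, L.nextP a), h⟩

theorem Par.isOpen {x : L.S} {a : L.NextS} (h : L.Par x a) : L.IsOpen x (L.nextP a) := h.1

theorem exists_par_of_isOpen {x : L.S} {z : V} (h : L.IsOpen x z) :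
    ∃ a, L.Par x a ∧ L.nextP a = z :=
  ⟨Quotient.mk L.nextSetoid ⟨(x, z), h⟩, ⟨h, rfl⟩, rfl⟩

theorem exists_par (a : L.NextS) : ∃ x, L.Par x a := by
  induction a using Quotient.inductionOn with
  | h q => exact ⟨q.1.1, q.2, rfl⟩

theorem Par.ext {x : L.S} {a b : L.NextS} (ha : L.Par x a) (hb : L.Par x b)
    (e : L.nextP a = L.nextP b) : a = b := by
  obtain ⟨h, ea⟩ := ha
  obtain ⟨h', eb⟩ := hb
  rw [ea, eb]
  congr 3

theorem Par.eq_or {x y : L.S} {a : L.NextS} (hx : L.Par x a) (hy : L.Par y a) :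
    x = y ∨ L.H x y ∧ Y.T (L.p x) (L.p y) (L.nextP a) := by
  obtain ⟨h, ea⟩ := hx
  obtain ⟨h', eb⟩ := hy
  exact (Quotient.exact (ea.symm.trans eb)).2

theorem Par.of_H {x y : L.S} {a : L.NextS} (hx : L.Par x a) (h : L.H x y)
    (t : Y.T (L.p x) (L.p y) (L.nextP a)) : L.Par y a := by
  obtain ⟨o, ea⟩ := hx
  refine ⟨isOpen_of_H h t o, ea.trans (Quotient.sound ?_)⟩
  exact ⟨rfl, Or.inr ⟨h, t⟩⟩

/-- Horizontal adjacency in the next layer. -/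
def NextH (L : SphereLayer Y) (a b : L.NextS) : Prop :=
  ∃ x, L.Par x a ∧ L.Par x b ∧ Y.T (L.p x) (L.nextP a) (L.nextP b)

/-- Images of parents in the next layer. -/
def NextD (L : SphereLayer Y) (a : L.NextS) (d : V) : Prop :=
  ∃ x, L.Par x a ∧ L.p x = d

theorem NextH.symm {a b : L.NextS} : L.NextH a b → L.NextH b a := fun ⟨x, ha, hb, t⟩ =>
  ⟨x, hb, ha, Y.swap₂₃ t⟩

/-- A common parent of horizontally adjacent vertices spans a triangle with them. -/
theorem NextH.T {a b : L.NextS} (h : L.NextH a b) {x : L.S} (ha : L.Par x a) (hb : L.Par x b) :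
    Y.T (L.p x) (L.nextP a) (L.nextP b) := by
  obtain ⟨w, wa, wb, t⟩ := h
  rcases wa.eq_or ha with rfl | ⟨h, s⟩
  · exact t
  rcases wb.eq_or hb with rfl | ⟨h', s'⟩
  · exact t
  exact Y.fill₃ s t s'

theorem NextH.adj {a b : L.NextS} (h : L.NextH a b) : Y.Adj (L.nextP a) (L.nextP b) := by
  obtain ⟨w, wa, wb, t⟩ := h
  exact Y.adj_of_T (Y.swap₂₃ (Y.swap₁₂ t))

/-- A parent of `a` whose image spans a triangle with `a` and an adjacent `b` is a
parent of `b`. -/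
theorem Par.of_nextH {a b : L.NextS} {x : L.S} (ha : L.Par x a) (h : L.NextH a b)
    (t : Y.T (L.nextP a) (L.nextP b) (L.p x)) : L.Par x b := by
  obtain ⟨w, wa, wb, s⟩ := h
  rcases wa.eq_or ha with rfl | ⟨h, s'⟩
  · exact wb
  · refine wb.of_H h ?_
    exact Y.fill₃ (v := L.nextP a) (Y.swap₂₃ (Y.swap₁₂ (Y.swap₂₃ s')) |> Y.swap₂₃) (Y.swap₂₃ t)
      (Y.swap₁₂ s)

/-- Three pairwise adjacent vertices have a common parent. -/
theorem exists_common_par {a b c : L.NextS} (hab : L.NextH a b) (hac : L.NextH a c)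
    (hbc : L.NextH b c) : ∃ x, L.Par x a ∧ L.Par x b ∧ L.Par x c := by
  obtain ⟨x, xa, xb, tx⟩ := id hab
  obtain ⟨y, ya, yc, ty⟩ := id hac
  obtain ⟨w, wb, wc, tw⟩ := id hbc
  rcases xa.eq_or ya with rfl | ⟨hxy, sxy⟩
  · exact ⟨x, xa, xb, yc⟩
  rcases xb.eq_or wb with rfl | ⟨hxw, sxw⟩
  · exact ⟨x, xa, xb, wc⟩
  rcases yc.eq_or wc with rfl | ⟨hyw, syw⟩
  · exact ⟨y, ya, wb, wc⟩
  have hne : y ≠ w := fun e => Y.adj_ne (L.H_adj hyw) (by rw [e])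
  have txyw := (L.H_tri hxy hxw hne).1 hyw
  have hyb : L.p y ≠ L.nextP b := fun e => xb.isOpen.2.2 y hxy e
  have haw : L.nextP a ≠ L.p w := fun e => xa.isOpen.2.2 w hxw e.symm
  rcases Y.fill₄ sxy tx (Y.swap₂₃ sxw) (Y.swap₂₃ txyw) hyb haw with h | h
  · exact ⟨y, ya, xb.of_H hxy h, yc⟩
  · exact ⟨w, xa.of_H hxw (Y.swap₂₃ h), wb, wc⟩

theorem nextH_tri {a b c : L.NextS} (hab : L.NextH a b) (hac : L.NextH a c) (_ : b ≠ c) :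
    L.NextH b c ↔ Y.T (L.nextP a) (L.nextP b) (L.nextP c) := by
  constructor
  · intro hbc
    obtain ⟨x, xa, xb, xc⟩ := exists_common_par hab hac hbc
    exact Y.fill₃ (hab.T xa xb) (hbc.T xb xc) (hac.T xa xc)
  · intro t
    obtain ⟨x, xa, xb, tx⟩ := id hab
    obtain ⟨y, ya, yc, ty⟩ := id hac
    have perm : ∀ {u v w : V}, Y.T u v w → Y.T v w u := fun h => Y.swap₂₃ (Y.swap₁₂ h)
    rcases xa.eq_or ya with rfl | ⟨hxy, sxy⟩
    · exact ⟨x, xb, yc, Y.fill₃ (Y.swap₁₂ tx) t (Y.swap₁₂ ty)⟩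
    · have h1 : L.p x ≠ L.nextP c := fun e => yc.isOpen.2.2 x (L.H_symm hxy) e
      have h2 : L.nextP b ≠ L.p y := fun e => xb.isOpen.2.2 y hxy e.symm
      rcases Y.fill₄ (Y.swap₁₂ tx) t (Y.swap₂₃ (Y.swap₁₂ ty)) (perm (perm (Y.swap₁₂ sxy))) h1 h2
        with h | h
      · have : Y.T (L.p x) (L.p y) (L.nextP c) :=
          Y.fill₃ (perm (perm sxy)) (Y.swap₁₂ ty) h
        have xc := yc.of_H (L.H_symm hxy) (Y.swap₁₂ this)
        exact ⟨x, xb, xc, Y.fill₃ (Y.swap₁₂ tx) t h⟩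
      · have : Y.T (L.p x) (L.p y) (L.nextP b) :=
          Y.fill₃ (perm (perm sxy)) (Y.swap₂₃ h) (Y.swap₁₂ tx)
        have yb := xb.of_H hxy this
        exact ⟨y, yb, yc, Y.fill₃ (Y.swap₂₃ h) t (Y.swap₁₂ ty)⟩

theorem nextH_inj {a b c : L.NextS} (hab : L.NextH a b) (hac : L.NextH a c)
    (e : L.nextP b = L.nextP c) : b = c := by
  obtain ⟨x, xa, xb, tx⟩ := id hab
  obtain ⟨y, ya, yc, ty⟩ := id hac
  rcases xa.eq_or ya with rfl | ⟨hxy, sxy⟩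
  · exact xb.ext yc e
  · rw [← e] at ty
    have : Y.T (L.p x) (L.nextP b) (L.p y) :=
      Y.fill₃ (Y.swap₁₂ tx) (Y.swap₂₃ (Y.swap₁₂ ty)) (Y.swap₁₂ (Y.swap₂₃ sxy))
    exact (xb.of_H hxy (Y.swap₂₃ this)).ext yc e

theorem Par.adj {x : L.S} {a : L.NextS} (h : L.Par x a) : Y.Adj (L.nextP a) (L.p x) :=
  Y.adj_symm h.isOpen.1

/-- The next sphere of the development. -/
def next (L : SphereLayer Y) : SphereLayer Y where
  S := L.NextS
  p := L.nextP
  H := L.NextH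
  D := L.NextD
  H_symm := NextH.symm
  H_adj := NextH.adj
  D_adj := by
    rintro a d ⟨x, hx, rfl⟩
    exact hx.adj
  D_clique := by
    rintro a d e ⟨x, hx, rfl⟩ ⟨y, hy, rfl⟩ hne
    rcases hx.eq_or hy with rfl | ⟨h, t⟩
    · exact (hne rfl).elim
    · exact Y.swap₁₂ (Y.swap₂₃ t)
  H_notD := by
    rintro a b ⟨x, xa, xb, t⟩ ⟨y, ya, e⟩
    rcases xa.eq_or ya with rfl | ⟨h, _⟩
    · exact Y.adj_ne xb.isOpen.1 e
    · exact xb.isOpen.2.2 y h e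
  H_inj := nextH_inj
  H_tri := nextH_tri
  D_trans := by
    rintro a b d h ⟨x, xa, rfl⟩ t
    exact ⟨x, xa.of_nextH h t, rfl⟩
  D_tri := by
    rintro a d z ⟨x, xa, rfl⟩ t
    have t' : Y.T (L.p x) (L.nextP a) z := Y.swap₁₂ t
    by_cases o : L.IsOpen x z
    · obtain ⟨b, xb, rfl⟩ := exists_par_of_isOpen o
      exact Or.inr ⟨b, ⟨x, xa, xb, t'⟩, rfl⟩
    · by_cases hD : L.D x z
      · rcases L.D_tri hD (Y.swap₂₃ t') with h | ⟨y, hy, e⟩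
        · exact (xa.isOpen.2.1 h).elim
        · exact (xa.isOpen.2.2 y hy e).elim
      · have : ∃ y, L.H x y ∧ L.p y = z := by
          by_contra hcon
          push Not at hcon
          exact o ⟨Y.adj_of_T (Y.swap₂₃ t'), hD, hcon⟩
        obtain ⟨y, hy, rfl⟩ := this
        exact Or.inl ⟨y, xa.of_H hy (Y.swap₂₃ t'), rfl⟩
  common := by
    rintro a b ⟨x, xa, xb, t⟩
    exact ⟨L.p x, ⟨x, xa, rfl⟩, ⟨x, xb, rfl⟩, Y.swap₂₃ (Y.swap₁₂ t)⟩

/-- The initial layer, consisting of the base vertex. -/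
def base (Y : TriData V) (v : V) : SphereLayer Y where
  S := PUnit
  p _ := v
  H _ _ := False
  D _ _ := False
  H_symm h := h
  H_adj h := h.elim
  D_adj h := h.elim
  D_clique h := h.elim
  H_notD h := h.elim
  H_inj h := h.elim
  H_tri h := h.elim
  D_trans h := h.elim
  D_tri h := h.elim
  common h := h.elim

/-- The spheres of the development. -/
def sphere (Y : TriData V) (v : V) : ℕ → SphereLayer Y
  | 0 => base Y v
  | n + 1 => (sphere Y v n).next

end SphereLayer

namespace SphereLayer

variable {V : Type u} {Y : TriData V} {v : V}

/-- The vertices of the development of `Y` at `v`. -/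
abbrev Dev (Y : TriData V) (v : V) : Type u := Σ n, (sphere Y v n).S

/-- The map from the development to the original complex. -/
def devP (Y : TriData V) (v : V) (x : Dev Y v) : V := (sphere Y v x.1).p x.2

/-- Adjacency in the development. -/
inductive DevAdj (Y : TriData V) (v : V) : Dev Y v → Dev Y v → Prop
  | horiz {n : ℕ} {x y : (sphere Y v n).S} (h : (sphere Y v n).H x y) :
      DevAdj Y v ⟨n, x⟩ ⟨n, y⟩
  | up {n : ℕ} {x : (sphere Y v n).S} {a : (sphere Y v n).NextS}
      (h : (sphere Y v n).Par x a) : DevAdj Y v ⟨n, x⟩ ⟨n + 1, a⟩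
  | down {n : ℕ} {x : (sphere Y v n).S} {a : (sphere Y v n).NextS}
      (h : (sphere Y v n).Par x a) : DevAdj Y v ⟨n + 1, a⟩ ⟨n, x⟩

theorem DevAdj.symm {x y : Dev Y v} (h : DevAdj Y v x y) : DevAdj Y v y x := by
  cases h with
  | horiz h => exact .horiz ((sphere Y v _).H_symm h)
  | up h => exact .down h
  | down h => exact .up h

theorem devAdj_comm {x y : Dev Y v} : DevAdj Y v x y ↔ DevAdj Y v y x :=
  ⟨DevAdj.symm, DevAdj.symm⟩

theorem DevAdj.map {x y : Dev Y v} (h : DevAdj Y v x y) : Y.Adj (devP Y v x) (devP Y v y) := by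
  cases h with
  | horiz h => exact (sphere Y v _).H_adj h
  | up h => exact h.isOpen.1
  | down h => exact Y.adj_symm h.isOpen.1

theorem devAdj_horiz {n : ℕ} {x y : (sphere Y v n).S} :
    DevAdj Y v ⟨n, x⟩ ⟨n, y⟩ ↔ (sphere Y v n).H x y := by
  constructor
  · intro h
    cases h with
    | horiz h => exact h
  · exact .horiz

theorem devAdj_up {n : ℕ} {x : (sphere Y v n).S} {a : (sphere Y v n).NextS} :
    DevAdj Y v ⟨n, x⟩ ⟨n + 1, a⟩ ↔ (sphere Y v n).Par x a := by
  constructor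
  · intro h
    cases h with
    | up h => exact h
  · exact .up

theorem DevAdj.level_le {x y : Dev Y v} (h : DevAdj Y v x y) : x.1 ≤ y.1 + 1 := by
  cases h <;> simp; omega

/-- The development as a graph. -/
def devGraph (Y : TriData V) (v : V) : SimpleGraph (Dev Y v) where
  Adj := DevAdj Y v
  symm := ⟨fun _ _ h => h.symm⟩
  loopless := ⟨fun _ h => Y.adj_ne h.map rfl⟩


theorem not_devAdj_up_two {n : ℕ} {x : (sphere Y v n).S} {a : (sphere Y v (n + 2)).S} :
    ¬ DevAdj Y v ⟨n, x⟩ ⟨n + 2, a⟩ := by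
  intro h
  have := h.symm.level_le
  simp only at this
  omega

theorem devAdj_lift {x : Dev Y v} {w : V} (h : Y.Adj (devP Y v x) w) :
    ∃ y, DevAdj Y v x y ∧ devP Y v y = w := by
  obtain ⟨n, x⟩ := x
  by_cases o : (sphere Y v n).IsOpen x w
  · obtain ⟨a, ha, e⟩ := exists_par_of_isOpen o
    exact ⟨⟨n + 1, a⟩, .up ha, e⟩
  by_cases hD : (sphere Y v n).D x w
  · cases n with
    | zero => exact hD.elim
    | succ n =>
      obtain ⟨y, hy, e⟩ := hD
      exact ⟨⟨n, y⟩, .down hy, e⟩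
  have : ∃ y, (sphere Y v n).H x y ∧ (sphere Y v n).p y = w := by
    by_contra hcon
    push Not at hcon
    exact o ⟨h, hD, hcon⟩
  obtain ⟨y, hy, e⟩ := this
  exact ⟨⟨n, y⟩, .horiz hy, e⟩

theorem devAdj_inj {x y z : Dev Y v} (hy : DevAdj Y v x y) (hz : DevAdj Y v x z)
    (e : devP Y v y = devP Y v z) : y = z := by
  cases hy with
  | horiz h =>
    cases hz with
    | horiz h' => rw [(sphere Y v _).H_inj h h' e]
    | up h' => exact (h'.isOpen.2.2 _ h e).elim
    | down h' => exact ((sphere Y v _).H_notD h ⟨_, h', e.symm⟩).elim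
  | up h =>
    cases hz with
    | horiz h' => exact (h.isOpen.2.2 _ h' e.symm).elim
    | up h' => rw [h.ext h' e]
    | down h' => exact (h.isOpen.2.1 ⟨_, h', e.symm⟩).elim
  | down h =>
    cases hz with
    | horiz h' => exact ((sphere Y v _).H_notD h' ⟨_, h, e⟩).elim
    | up h' => exact (h'.isOpen.2.1 ⟨_, h, e⟩).elim
    | down h' =>
      rcases h.eq_or h' with rfl | ⟨h, _⟩
      · rfl
      · exact (Y.adj_ne ((sphere Y v _).H_adj h) e).elim

theorem devAdj_tri {x y z : Dev Y v} (hy : DevAdj Y v x y) (hz : DevAdj Y v x z)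
    (hne : y ≠ z) : DevAdj Y v y z ↔ Y.T (devP Y v x) (devP Y v y) (devP Y v z) := by
  have perm : ∀ {u v w : V}, Y.T u v w → Y.T v w u := fun h => Y.swap₂₃ (Y.swap₁₂ h)
  have HU : ∀ {n : ℕ} {x y : (sphere Y v n).S} {a : (sphere Y v n).NextS},
      (sphere Y v n).H x y → (sphere Y v n).Par x a → ((sphere Y v n).Par y a ↔
        Y.T ((sphere Y v n).p x) ((sphere Y v n).p y) ((sphere Y v n).nextP a)) := by
    intro n x y a h h'
    refine ⟨fun h'' => ?_, h'.of_H h⟩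
    rcases h'.eq_or h'' with rfl | h
    · exact (Y.adj_ne ((sphere Y v _).H_adj h) rfl).elim
    · exact h.2
  have DH : ∀ {n : ℕ} {x : (sphere Y v n).S} {a b : (sphere Y v n).NextS},
      (sphere Y v n).Par x a → (sphere Y v n).NextH a b → ((sphere Y v n).Par x b ↔
        Y.T ((sphere Y v n).nextP a) ((sphere Y v n).p x) ((sphere Y v n).nextP b)) := by
    intro n x a b h h'
    exact ⟨fun h'' => Y.swap₁₂ (h'.T h h''), fun t => h.of_nextH h' (Y.swap₂₃ t)⟩
  have DU : ∀ {n : ℕ} {x : (sphere Y v n).S} {a : (sphere Y v n).NextS}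
      {c : (sphere Y v (n + 1)).NextS},
      (sphere Y v n).Par x a → (sphere Y v (n + 1)).Par a c →
        ¬ Y.T ((sphere Y v n).nextP a) ((sphere Y v n).p x) ((sphere Y v (n + 1)).nextP c) := by
    intro n x a c h h' t
    rcases (sphere Y v (n + 1)).D_tri ⟨x, h, rfl⟩ t with h'' | ⟨y, h'', e⟩
    · exact h'.isOpen.2.1 h''
    · exact h'.isOpen.2.2 y h'' e
  cases hy with
  | horiz h =>
    cases hz with
    | horiz h' =>
      exact devAdj_horiz.trans ((sphere Y v _).H_tri h h' fun e => hne (by rw [e]))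
    | up h' =>
      exact devAdj_up.trans (HU h h')
    | down h' =>
      exact devAdj_comm.trans (devAdj_up.trans ((DH h' h).trans ⟨Y.swap₂₃, Y.swap₂₃⟩))
  | up h =>
    cases hz with
    | horiz h' =>
      exact devAdj_comm.trans (devAdj_up.trans ((HU h' h).trans ⟨Y.swap₂₃, Y.swap₂₃⟩))
    | up h' =>
      exact devAdj_horiz.trans ⟨fun k => NextH.T k h h', fun t => ⟨_, h, h', t⟩⟩
    | down h' =>
      exact ⟨fun k => (not_devAdj_up_two k.symm).elim,
        fun t => (DU h' h (Y.swap₂₃ t)).elim⟩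
  | down h =>
    cases hz with
    | horiz h' =>
      exact devAdj_up.trans (DH h h')
    | up h' =>
      exact ⟨fun k => (not_devAdj_up_two k).elim, fun t => (DU h h' t).elim⟩
    | down h' =>
      rcases h.eq_or h' with rfl | ⟨k, t⟩
      · exact (hne rfl).elim
      · exact devAdj_horiz.trans ⟨fun _ => perm (perm t), fun _ => k⟩

end SphereLayer

namespace SphereLayer

variable {V : Type u} {Y : TriData V} {v : V}

/-- Every clique of the next layer has a common parent. -/
theorem exists_par_clique {L : SphereLayer Y} (τ : Finset L.NextS) (hne : τ.Nonempty)
    (h : ∀ a ∈ τ, ∀ b ∈ τ, a ≠ b → L.NextH a b) : ∃ x, ∀ a ∈ τ, L.Par x a := by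
  classical
  induction τ using Finset.strongInduction with
  | H τ ih =>
  obtain ⟨a, ha⟩ := hne
  by_cases h1 : ∃ b ∈ τ, a ≠ b
  swap
  · push Not at h1
    obtain ⟨x, hx⟩ := exists_par a
    exact ⟨x, fun b hb => h1 b hb ▸ hx⟩
  obtain ⟨b, hb, hab⟩ := h1
  by_cases h2 : ∃ c ∈ τ, a ≠ c ∧ b ≠ c
  swap
  · push Not at h2
    obtain ⟨x, hxa, hxb, -⟩ := h a ha b hb hab
    refine ⟨x, fun c hc => ?_⟩
    by_cases hac : a = c
    · exact hac ▸ hxa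
    · exact h2 c hc hac ▸ hxb
  obtain ⟨c, hc, hac, hbc⟩ := h2
  obtain ⟨x, hx⟩ := ih (τ.erase a) (Finset.erase_ssubset ha) ⟨b, by simp [hb, hab.symm]⟩
    fun u hu w hw => h u (Finset.mem_of_mem_erase hu) w (Finset.mem_of_mem_erase hw)
  obtain ⟨y, hy⟩ := ih (τ.erase b) (Finset.erase_ssubset hb) ⟨a, by simp [ha, hab]⟩
    fun u hu w hw => h u (Finset.mem_of_mem_erase hu) w (Finset.mem_of_mem_erase hw)
  have hx' : L.Par x a → ∃ x, ∀ a ∈ τ, L.Par x a := fun k => ⟨x, fun u hu => by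
    by_cases e : u = a
    · exact e ▸ k
    · exact hx u (Finset.mem_erase.2 ⟨e, hu⟩)⟩
  have hy' : L.Par y b → ∃ x, ∀ a ∈ τ, L.Par x a := fun k => ⟨y, fun u hu => by
    by_cases e : u = b
    · exact e ▸ k
    · exact hy u (Finset.mem_erase.2 ⟨e, hu⟩)⟩
  have xb := hx b (by simp [hb, hab.symm])
  have xc := hx c (by simp [hc, hac.symm])
  have ya := hy a (by simp [ha, hab])
  have yc := hy c (by simp [hc, hbc.symm])
  have perm : ∀ {u v w : V}, Y.T u v w → Y.T v w u := fun h => Y.swap₂₃ (Y.swap₁₂ h)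
  rcases xc.eq_or yc with rfl | ⟨hxy, t⟩
  · exact hx' ya
  have hca := h c hc a ha hac.symm
  have hcb := h c hc b hb hbc.symm
  have hba := h b hb a ha hab.symm
  have e1 : L.p x ≠ L.nextP a := fun e => ya.isOpen.2.2 x (L.H_symm hxy) e
  have e2 : L.nextP b ≠ L.p y := fun e => xb.isOpen.2.2 y hxy e.symm
  rcases Y.fill₄ (Y.swap₁₂ (hcb.T xc xb)) ((nextH_tri hcb hca hab.symm).1 hba)
    (perm (hca.T yc ya)) (Y.swap₂₃ (perm (perm t))) e1 e2 with k | k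
  · exact hx' (xc.of_nextH hca (Y.swap₂₃ k))
  · exact hy' (yc.of_nextH hcb k)

end SphereLayer

/-- A graph with a level function all of whose cliques project to the previous level, as for
the distance from a vertex of a systolic complex. -/
structure IsLeveled {W : Type u} (A : SimpleGraph W) (l : W → ℕ) (o : W) : Prop where
  root : ∀ x, l x = 0 ↔ x = o
  le_succ : ∀ x y, A.Adj x y → l x ≤ l y + 1
  parents : ∀ a x y, A.Adj a x → A.Adj a y → l x + 1 = l a → l y + 1 = l a → x ≠ y → A.Adj x y
  apex : ∀ (n : ℕ) (τ : Finset W), τ.Nonempty → (∀ a ∈ τ, l a = n + 1) →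
    (∀ a ∈ τ, ∀ b ∈ τ, a ≠ b → A.Adj a b) → ∃ x, l x = n ∧ ∀ a ∈ τ, A.Adj a x

namespace SphereLayer

variable {V : Type u} {Y : TriData V} {v : V}

theorem isLeveled_devGraph :
    IsLeveled (devGraph Y v) (fun x => x.1) (⟨0, PUnit.unit⟩ : Dev Y v) where
  root := by
    rintro ⟨n, x⟩
    constructor
    · intro h
      simp only at h
      subst h
      rfl
    · intro h
      rw [h]
  le_succ _ _ h := DevAdj.level_le h
  parents := by
    rintro a x y (hx : DevAdj Y v a x) (hy : DevAdj Y v a y) ex ey hne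
    cases hx with
    | horiz h => simp at ex
    | up h => simp only at ex; omega
    | down h =>
      cases hy with
      | horiz h => simp at ey
      | up h => simp only at ey; omega
      | down h' =>
        rcases h.eq_or h' with rfl | ⟨h, -⟩
        · exact (hne rfl).elim
        · exact .horiz h
  apex := by
    classical
    intro n τ hne hl hcl
    let f : (sphere Y v n).NextS → Dev Y v := fun a => ⟨n + 1, a⟩
    have hf : Function.Injective f := by
      intro a b h
      exact eq_of_heq (Sigma.mk.inj h).2
    have hτ : ∀ a ∈ τ, ∃ b, f b = a := by
      rintro ⟨m, a⟩ ha
      have := hl _ ha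
      simp only at this
      subst this
      exact ⟨a, rfl⟩
    obtain ⟨x, hx⟩ := exists_par_clique (τ.preimage f hf.injOn) (by
      obtain ⟨a, ha⟩ := hne
      obtain ⟨b, rfl⟩ := hτ a ha
      exact ⟨b, by simpa using ha⟩) (by
      intro a ha b hb hab
      have := hcl _ (Finset.mem_preimage.1 ha) _ (Finset.mem_preimage.1 hb) (hf.ne hab)
      exact devAdj_horiz.1 this)
    refine ⟨⟨n, x⟩, rfl, fun a ha => ?_⟩
    obtain ⟨b, rfl⟩ := hτ a ha
    exact .down (hx b (Finset.mem_preimage.2 ha))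

end SphereLayer

namespace SComplex

section
variable {V : Type u}

/-- Two distinct vertices are joined by an edge. -/
def EAdj [DecidableEq V] (X : SComplex V) (a b : V) : Prop :=
  a ≠ b ∧ ({a, b} : Finset V) ∈ X.faces

/-- Three distinct vertices span a triangle. -/
def Tri [DecidableEq V] (X : SComplex V) (a b c : V) : Prop :=
  a ≠ b ∧ b ≠ c ∧ a ≠ c ∧ ({a, b, c} : Finset V) ∈ X.faces

theorem pair_mem [DecidableEq V] {S : Set (Finset V)} {a b : V} (h : ({a, b} : Finset V) ∈ S) :
    ({b, a} : Finset V) ∈ S := Finset.pair_comm b a ▸ h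

/-- The clique complex of a graph. -/
def cliqueComplex (A : SimpleGraph V) : SComplex V where
  faces := {σ | σ.Nonempty ∧ A.IsClique σ}
  nonempty_of_mem _ h := h.1
  down_closed _ h _ hτ hne := ⟨hne, h.2.subset (Finset.coe_subset.2 hτ)⟩

variable [DecidableEq V] {X : SComplex V}

theorem mem_link_singleton {v : V} {τ : Finset V} (h : insert v τ ∈ X.faces) (hv : v ∉ τ)
    (hne : τ.Nonempty) : τ ∈ (X.link {v}).faces := by
  refine ⟨X.down_closed _ h _ (Finset.subset_insert _ _) hne, by simpa using hv, ?_⟩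
  rw [Finset.union_comm]
  exact h

theorem insert_mem_of_mem_link {v : V} {τ : Finset V} (h : τ ∈ (X.link {v}).faces) :
    insert v τ ∈ X.faces := by
  have := h.2.2
  rwa [Finset.union_comm] at this

theorem Tri.link {v a b : V} (h : X.Tri v a b) : ({a, b} : Finset V) ∈ (X.link {v}).faces :=
  mem_link_singleton h.2.2.2 (by simp [h.1, h.2.2.1]) ⟨a, by simp⟩

theorem Tri.link_left {v a b : V} (h : X.Tri v a b) : ({a} : Finset V) ∈ (X.link {v}).faces :=
  (X.link {v}).down_closed _ h.link _ (by simp) ⟨a, by simp⟩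

theorem Tri.link_right {v a b : V} (h : X.Tri v a b) : ({b} : Finset V) ∈ (X.link {v}).faces :=
  (X.link {v}).down_closed _ h.link _ (by simp) ⟨b, by simp⟩

theorem tri_of_link {v a b : V} (h : ({a, b} : Finset V) ∈ (X.link {v}).faces) (hne : a ≠ b) :
    X.Tri v a b := by
  have h2 := h.2.1
  simp only [Finset.disjoint_singleton_right, Finset.mem_insert, Finset.mem_singleton,
    not_or] at h2
  exact ⟨h2.1, hne, h2.2, insert_mem_of_mem_link h⟩

theorem Tri.vertex {v a b : V} (h : X.Tri v a b) : ({v} : Finset V) ∈ X.faces :=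
  X.down_closed _ h.2.2.2 _ (by simp) ⟨v, by simp⟩

/-- The local data of a locally `6`-large complex. -/
def triData (h : X.LocallyKLarge 6) : TriData V where
  Adj := X.EAdj
  T := X.Tri
  adj_symm h := ⟨h.1.symm, pair_mem h.2⟩
  adj_ne h := h.1
  swap₁₂ := fun ⟨h1, h2, h3, h4⟩ => ⟨h1.symm, h3, h2, by rwa [Finset.insert_comm]⟩
  swap₂₃ := fun ⟨h1, h2, h3, h4⟩ => ⟨h3, h2.symm, h1, by rwa [Finset.pair_comm]⟩
  adj_of_T := fun ⟨h1, h2, h3, h4⟩ => ⟨h1, X.down_closed _ h4 _ (by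
    intro x; simp; tauto) (by simp)⟩
  fill₃ := by
    intro v a b c h1 h2 h3
    have := (h {v} h1.vertex).1 {a, b, c} (by simp) (by
      simp only [Finset.mem_insert, Finset.mem_singleton, forall_eq_or_imp, forall_eq]
      exact ⟨h1.link_left, h1.link_right, h2.link_right⟩) (by
      simp only [Finset.mem_insert, Finset.mem_singleton, forall_eq_or_imp, forall_eq]
      have k1 := h1.link
      have k2 := h2.link
      have k3 := h3.link
      have k1' := pair_mem h1.link
      have k2' := pair_mem h2.link
      have k3' := pair_mem h3.link
      simp_all)
    exact ⟨h1.2.1, h2.2.1, h3.2.1, this.1⟩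
  fill₄ := by
    intro v a b c d h1 h2 h3 h4 hac hbd
    have hab := h1.2.1
    have hbc := h2.2.1
    have hcd := h3.2.1
    have hda := h4.2.1
    obtain ⟨i, j, e1, e2, e3, hf⟩ := (h {v} h1.vertex).2 4 (![a, b, c, d] : Fin 4 → V) (by
      refine ⟨by norm_num, ?_, ?_⟩
      · change Function.Injective (![a, b, c, d] : Fin 4 → V)
        intro i j e
        fin_cases i <;> fin_cases j <;> simp_all
      · intro (i : Fin 4)
        fin_cases i
        · exact h1.link
        · exact h2.link
        · exact h3.link
        · exact h4.link) le_rfl (by norm_num)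
    have hf' := pair_mem hf
    change Fin 4 at i
    change Fin 4 at j
    fin_cases i <;> fin_cases j <;>
      first
      | exact (e1 rfl).elim
      | exact (e2 rfl).elim
      | exact (e3 rfl).elim
      | exact Or.inl (tri_of_link hf hac)
      | exact Or.inl (tri_of_link hf' hac)
      | exact Or.inr (tri_of_link hf hbd)
      | exact Or.inr (tri_of_link hf' hbd)
  fill₅ := by
    intro v a b c d e h1 h2 h3 h4 h5 hac had hbd hbe hce
    have hab := h1.2.1
    have hbc := h2.2.1
    have hcd := h3.2.1
    have hde := h4.2.1
    have hea := h5.2.1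
    obtain ⟨i, j, e1, e2, e3, hf⟩ := (h {v} h1.vertex).2 5 (![a, b, c, d, e] : Fin 5 → V) (by
      refine ⟨by norm_num, ?_, ?_⟩
      · change Function.Injective (![a, b, c, d, e] : Fin 5 → V)
        intro i j e
        fin_cases i <;> fin_cases j <;> simp_all
      · intro (i : Fin 5)
        fin_cases i
        · exact h1.link
        · exact h2.link
        · exact h3.link
        · exact h4.link
        · exact h5.link) (by norm_num) (by norm_num)
    have hf' := pair_mem hf
    change Fin 5 at i
    change Fin 5 at j
    fin_cases i <;> fin_cases j <;>
      first
      | exact (e1 rfl).elim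
      | exact (e2 rfl).elim
      | exact (e3 rfl).elim
      | exact Or.inl (tri_of_link hf hac)
      | exact Or.inl (tri_of_link hf' hac)
      | exact Or.inr (Or.inl (tri_of_link hf had))
      | exact Or.inr (Or.inl (tri_of_link hf' had))
      | exact Or.inr (Or.inr (Or.inl (tri_of_link hf hbd)))
      | exact Or.inr (Or.inr (Or.inl (tri_of_link hf' hbd)))
      | exact Or.inr (Or.inr (Or.inr (Or.inl (tri_of_link hf hbe))))
      | exact Or.inr (Or.inr (Or.inr (Or.inl (tri_of_link hf' hbe))))
      | exact Or.inr (Or.inr (Or.inr (Or.inr (tri_of_link hf hce))))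
      | exact Or.inr (Or.inr (Or.inr (Or.inr (tri_of_link hf' hce))))

end

end SComplex

/-- A covering map from the clique complex of the graph `A` to the complex `Y`. -/
structure IsCover {V W : Type u} [DecidableEq V] (Y : SComplex V) (A : SimpleGraph W)
    (p : W → V) : Prop where
  adj_map : ∀ {x y}, A.Adj x y → p x ≠ p y
  inj : ∀ {x y z}, A.Adj x y → A.Adj x z → p y = p z → y = z
  face_map : ∀ {σ : Finset W}, σ.Nonempty → A.IsClique σ → σ.image p ∈ Y.faces
  face_lift : ∀ {x : W} {σ : Finset V}, σ ∈ Y.faces → p x ∈ σ →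
    ∃ τ : Finset W, A.IsClique τ ∧ x ∈ τ ∧ τ.image p = σ

namespace SphereLayer

variable {V : Type u} [DecidableEq V] {X : SComplex V}

theorem isCover_devGraph (h : X.LocallyKLarge 6) {v : V} (hv : ({v} : Finset V) ∈ X.faces) :
    IsCover X (devGraph (X.triData h) v) (devP (X.triData h) v) where
  adj_map hxy := (DevAdj.map hxy).1
  inj hy hz e := devAdj_inj hy hz e
  face_map := by
    classical
    intro σ hne hσ
    obtain ⟨x, hx⟩ := hne
    have hxf : ({devP (X.triData h) v x} : Finset V) ∈ X.faces := by
      have aux : ∀ (n : ℕ) (a : (sphere (X.triData h) v n).S),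
          ({devP (X.triData h) v ⟨n, a⟩} : Finset V) ∈ X.faces := by
        intro n a
        cases n with
        | zero => exact hv
        | succ n =>
          obtain ⟨y, hy⟩ := exists_par a
          have := (DevAdj.down hy).map.2
          exact X.down_closed _ this _ (by simp) (by simp)
      exact aux x.1 x.2
    by_cases he : (σ.erase x).Nonempty
    swap
    · rw [Finset.not_nonempty_iff_eq_empty, Finset.erase_eq_empty_iff] at he
      rcases he with rfl | rfl
      · simp at hx
      · simpa using hxf
    rw [← Finset.insert_erase hx, Finset.image_insert]
    refine SComplex.insert_mem_of_mem_link ((h _ hxf).1 _ (he.image _) ?_ ?_)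
    · intro w hw
      obtain ⟨y, hy, rfl⟩ := Finset.mem_image.1 hw
      have hxy := DevAdj.map (hσ hx (Finset.mem_of_mem_erase hy) (Finset.ne_of_mem_erase hy).symm)
      exact SComplex.mem_link_singleton hxy.2 (by simpa using hxy.1) (by simp)
    · intro w hw z hz hwz
      obtain ⟨y, hy, rfl⟩ := Finset.mem_image.1 hw
      obtain ⟨u, hu, rfl⟩ := Finset.mem_image.1 hz
      have hyu : y ≠ u := fun e => hwz (by rw [e])
      rw [Finset.mem_erase] at hy hu
      exact ((devAdj_tri (hσ hx hy.2 hy.1.symm) (hσ hx hu.2 hu.1.symm) hyu).1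
        (hσ hy.2 hu.2 hyu)).link
  face_lift := by
    classical
    intro x σ hσ hx
    have hex : ∀ w ∈ σ, w ≠ devP (X.triData h) v x →
        ∃ y, DevAdj (X.triData h) v x y ∧ devP (X.triData h) v y = w := by
      intro w hw hne
      refine devAdj_lift ⟨hne.symm, X.down_closed _ hσ _ ?_ (by simp)⟩
      intro u
      simp only [Finset.mem_insert, Finset.mem_singleton]
      rintro (rfl | rfl) <;> assumption
    have : Nonempty (Dev (X.triData h) v) := ⟨x⟩
    choose! f hf hpf using hex
    set s := σ.erase (devP (X.triData h) v x) with hs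
    have hs' : ∀ w ∈ s, w ∈ σ ∧ w ≠ devP (X.triData h) v x := fun w hw =>
      ⟨Finset.mem_of_mem_erase hw, Finset.ne_of_mem_erase hw⟩
    refine ⟨insert x (s.image f), ?_, by simp, ?_⟩
    · rw [Finset.coe_insert, SimpleGraph.isClique_insert]
      constructor
      · intro y hy z hz hne
        simp only [Finset.coe_image, Set.mem_image, Finset.mem_coe] at hy hz
        obtain ⟨a, ha, rfl⟩ := hy
        obtain ⟨b, hb, rfl⟩ := hz
        obtain ⟨ha1, ha2⟩ := hs' a ha
        obtain ⟨hb1, hb2⟩ := hs' b hb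
        refine (devAdj_tri (hf a ha1 ha2) (hf b hb1 hb2) hne).2 ?_
        rw [hpf a ha1 ha2, hpf b hb1 hb2]
        refine ⟨ha2.symm, fun e => hne (by rw [e]), hb2.symm, X.down_closed _ hσ _ ?_ (by simp)⟩
        intro u
        simp only [Finset.mem_insert, Finset.mem_singleton]
        rintro (rfl | rfl | rfl) <;> assumption
      · intro y hy _
        simp only [Finset.coe_image, Set.mem_image, Finset.mem_coe] at hy
        obtain ⟨a, ha, rfl⟩ := hy
        exact hf a (hs' a ha).1 (hs' a ha).2
    · rw [Finset.image_insert, Finset.image_image]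
      have : s.image (devP (X.triData h) v ∘ f) = s := by
        conv_rhs => rw [← Finset.image_id (s := s)]
        exact Finset.image_congr fun w hw => hpf w (hs' w hw).1 (hs' w hw).2
      rw [this, hs, Finset.insert_erase hx]

end SphereLayer

namespace SComplex

variable {V : Type u} [DecidableEq V] {X : SComplex V}

/-- A locally `6`-large complex is covered by the clique complex of a levelled graph. -/
theorem exists_isCover (h : X.LocallyKLarge 6) {v : V} (hv : ({v} : Finset V) ∈ X.faces) :
    ∃ (W : Type u) (A : SimpleGraph W) (l : W → ℕ) (o : W) (p : W → V),
      IsLeveled A l o ∧ IsCover X A p ∧ p o = v :=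
  ⟨_, _, _, _, _, SphereLayer.isLeveled_devGraph, SphereLayer.isCover_devGraph h hv, rfl⟩

theorem KLarge.restrict {k : ℕ} (h : X.KLarge k) (U : Set V) : (X.restrict U).KLarge k := by
  refine ⟨fun A hA h1 h2 => ⟨h.1 A hA (fun v hv => (h1 v hv).1)
    fun v hv w hw hne => (h2 v hv w hw hne).1, fun v hv => (h1 v hv).2 v (by simp)⟩, ?_⟩
  intro m γ hγ h4 hk
  obtain ⟨i, j, h1, h2, h3, h⟩ := h.2 m γ ⟨hγ.1, hγ.2.1, fun i => (hγ.2.2 i).1⟩ h4 hk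
  refine ⟨i, j, h1, h2, h3, h, ?_⟩
  have := fun i => (hγ.2.2 i).2 (γ i) (by simp)
  simp only [Finset.mem_insert, Finset.mem_singleton, forall_eq_or_imp, forall_eq]
  exact ⟨this i, this j⟩

theorem LocallyKLarge.restrict {k : ℕ} (h : X.LocallyKLarge k) (U : Set V) :
    (X.restrict U).LocallyKLarge k := by
  intro σ hσ
  have : (X.restrict U).link σ = (X.link σ).restrict U := by
    have hf : ((X.restrict U).link σ).faces = ((X.link σ).restrict U).faces := by
      ext τ
      constructor
      · rintro ⟨h1, h2, h3⟩
        exact ⟨⟨h1.1, h2, h3.1⟩, h1.2⟩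
      · rintro ⟨⟨h1, h2, h3⟩, h4⟩
        refine ⟨⟨h1, h4⟩, h2, h3, fun v hv => ?_⟩
        rcases Finset.mem_union.1 hv with hv | hv
        exacts [h4 v hv, hσ.2 v hv]
    generalize (X.restrict U).link σ = P at hf
    generalize (X.link σ).restrict U = Q at hf
    cases P
    cases Q
    simp only at hf
    subst hf
    rfl
  rw [this]
  exact (h σ hσ.1).restrict U

end SComplex

/-- The augmented simplicial coboundary with coefficients in the field with two elements, on
ungraded cochains. -/
def coboundary {W : Type u} [DecidableEq W] (b : Finset W → ZMod 2) (σ : Finset W) : ZMod 2 :=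
  ∑ x ∈ σ, b (σ.erase x)

theorem coboundary_coboundary {W : Type u} [DecidableEq W] (b : Finset W → ZMod 2)
    (σ : Finset W) : coboundary (coboundary b) σ = 0 := by
  unfold coboundary
  rw [Finset.sum_sigma']
  refine Finset.sum_involution (fun q _ => ⟨q.2, q.1⟩) ?_ ?_ ?_ ?_
  · rintro ⟨x, y⟩ -
    simp only
    rw [Finset.erase_right_comm]
    exact CharTwo.add_self_eq_zero _
  · rintro ⟨x, y⟩ h - e
    simp only [Finset.mem_sigma, Finset.mem_erase] at h
    exact h.2.1 (by simpa using congrArg Sigma.fst e)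
  · rintro ⟨x, y⟩ h
    simp only [Finset.mem_sigma, Finset.mem_erase] at h ⊢
    exact ⟨h.2.2, Ne.symm h.2.1, h.1⟩
  · rintro ⟨x, y⟩ h
    rfl

theorem coboundary_add {W : Type u} [DecidableEq W] (b c : Finset W → ZMod 2) (σ : Finset W) :
    coboundary (fun τ => b τ + c τ) σ = coboundary b σ + coboundary c σ :=
  Finset.sum_add_distrib

theorem coboundary_insert {W : Type u} [DecidableEq W] (b : Finset W → ZMod 2) {σ : Finset W}
    {x : W} (hx : x ∉ σ) :
    coboundary b (insert x σ) = b σ + ∑ w ∈ σ, b ((insert x σ).erase w) := by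
  rw [coboundary, Finset.sum_insert hx, Finset.erase_insert hx]

namespace IsLeveled

variable {W : Type u} [DecidableEq W]

/-- The vertices of maximal level, if that level is positive. -/
def top (l : W → ℕ) (σ : Finset W) : Finset W := {w ∈ σ | l w = σ.sup l ∧ l w ≠ 0}

/-- The rank of a simplex: its level and the number of its vertices of that level. -/
def rank (l : W → ℕ) (σ : Finset W) : ℕ ×ₗ ℕ := toLex (σ.sup l, (top l σ).card)

open Classical in
/-- The primitive of a cochain obtained by coning over common parents. -/
noncomputable def primitive (l : W → ℕ) (x : Finset W → W) (b : Finset W → ZMod 2)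
    (σ : Finset W) : ZMod 2 :=
  if x (top l σ) ∈ σ then 0 else
    b (insert (x (top l σ)) σ) + ∑ w ∈ top l σ,
      if _h : rank l ((insert (x (top l σ)) σ).erase w) < rank l σ then
        primitive l x b ((insert (x (top l σ)) σ).erase w) else 0
  termination_by rank l σ
  decreasing_by exact _h

variable {A : SimpleGraph W} {l : W → ℕ} {o : W}

theorem exists_apex (h : IsLeveled A l o) : ∃ x : Finset W → W, ∀ σ : Finset W,
    A.IsClique σ → A.IsClique (insert (x (top l σ)) σ : Finset W) ∧
      (l (x (top l σ)) < σ.sup l ∨ σ.sup l = 0 ∧ l (x (top l σ)) = 0) := by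
  have key : ∀ τ : Finset W, ∃ y : W, ∀ σ : Finset W, A.IsClique σ → top l σ = τ →
      A.IsClique (insert y σ : Finset W) ∧ (l y < σ.sup l ∨ σ.sup l = 0 ∧ l y = 0) := by
    intro τ
    by_cases hτ : τ.Nonempty ∧ ∃ σ : Finset W, A.IsClique σ ∧ top l σ = τ
    · obtain ⟨hne, σ₀, hσ₀, rfl⟩ := hτ
      obtain ⟨t, ht⟩ := id hne
      have ht' := (Finset.mem_filter.1 ht).2
      obtain ⟨n, hn⟩ := Nat.exists_eq_succ_of_ne_zero ht'.2
      obtain ⟨y, hy, hya⟩ := h.apex n (top l σ₀) hne (fun a ha => by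
        rw [(Finset.mem_filter.1 ha).2.1, ← ht'.1, hn]) fun a ha b hb hab =>
          hσ₀ (Finset.mem_filter.1 ha).1 (Finset.mem_filter.1 hb).1 hab
      refine ⟨y, fun σ hσ e => ?_⟩
      have htσ := ht
      rw [← e, top, Finset.mem_filter] at htσ
      refine ⟨?_, Or.inl (by omega)⟩
      rw [Finset.coe_insert, SimpleGraph.isClique_insert]
      refine ⟨hσ, fun z hz hne => ?_⟩
      have hzl : l z ≤ σ.sup l := Finset.le_sup (Finset.mem_coe.1 hz)
      by_cases hz' : l z = σ.sup l
      · refine (hya z ?_).symm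
        rw [← e]
        exact Finset.mem_filter.2 ⟨hz, hz', by omega⟩
      · have htz : A.Adj t z := hσ htσ.1 hz (by rintro rfl; exact hz' htσ.2.1)
        have := h.le_succ t z htz
        exact h.parents t y z (hya t ht) htz (by omega) (by omega) hne
    · refine ⟨o, fun σ hσ e => ?_⟩
      have hτ' : τ = ∅ := by
        by_contra hne
        exact hτ ⟨Finset.nonempty_iff_ne_empty.2 hne, σ, hσ, e⟩
      subst hτ'
      have ho := (h.root o).2 rfl
      have hall : ∀ z ∈ σ, z = o := by
        by_contra hcon
        push Not at hcon
        obtain ⟨z, hz, hzo⟩ := hcon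
        obtain ⟨m, hm, hm'⟩ := Finset.exists_mem_eq_sup σ ⟨z, hz⟩ l
        have h1 : l z ≠ 0 := fun e => hzo ((h.root z).1 e)
        have h2 : l z ≤ σ.sup l := Finset.le_sup hz
        have : m ∈ top l σ := Finset.mem_filter.2 ⟨hm, hm'.symm, by omega⟩
        simp [e] at this
      refine ⟨?_, Or.inr ⟨?_, ho⟩⟩
      swap
      · rw [← Nat.le_zero]
        exact Finset.sup_le fun z hz => by rw [hall z hz, ho]
      rw [Finset.coe_insert, SimpleGraph.isClique_insert]
      exact ⟨hσ, fun z hz hne => (hne (hall z hz).symm).elim⟩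
  choose x hx using key
  exact ⟨x, fun σ hσ => hx _ σ hσ rfl⟩

theorem top_eq {σ σ' : Finset W} {y : W} (hl : l y < σ.sup l ∨ σ.sup l = 0 ∧ l y = 0)
    (h : top l σ ⊆ σ') (h' : σ' ⊆ insert y σ) : top l σ' = top l σ := by
  have hle : ∀ z ∈ σ', l z ≤ σ.sup l := fun z hz => by
    rcases Finset.mem_insert.1 (h' hz) with rfl | hz
    · omega
    · exact Finset.le_sup hz
  have hsup : σ'.sup l ≤ σ.sup l := Finset.sup_le hle
  rcases (top l σ).eq_empty_or_nonempty with he | ⟨t, ht⟩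
  · have h0 : σ.sup l = 0 := by
      by_contra hne
      rcases σ.eq_empty_or_nonempty with rfl | hn
      · simp at hne
      obtain ⟨m, hm, hm'⟩ := Finset.exists_mem_eq_sup σ hn l
      have : m ∈ top l σ := Finset.mem_filter.2 ⟨hm, hm'.symm, by omega⟩
      simp [he] at this
    rw [he]
    refine Finset.filter_eq_empty_iff.2 fun z hz => ?_
    have := hle z hz
    omega
  · have ht' := Finset.mem_filter.1 ht
    have h2 : l t ≤ σ'.sup l := Finset.le_sup (h ht)
    have e : σ'.sup l = σ.sup l := by omega
    ext z
    constructor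
    · intro hz
      rw [top, Finset.mem_filter, e] at hz
      rcases Finset.mem_insert.1 (h' hz.1) with rfl | hz'
      · omega
      · exact Finset.mem_filter.2 ⟨hz', hz.2⟩
    · intro hz
      have hz' := Finset.mem_filter.1 hz
      exact Finset.mem_filter.2 ⟨h hz, by rw [e]; exact hz'.2⟩

theorem rank_erase_lt {σ : Finset W} {y w : W} (hl : l y < σ.sup l ∨ σ.sup l = 0 ∧ l y = 0)
    (hw : w ∈ top l σ) : rank l ((insert y σ).erase w) < rank l σ := by
  have hle : ∀ z ∈ (insert y σ).erase w, l z ≤ σ.sup l := fun z hz => by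
    rcases Finset.mem_insert.1 (Finset.mem_of_mem_erase hz) with rfl | hz
    · omega
    · exact Finset.le_sup hz
  have hw' := Finset.mem_filter.1 hw
  rw [rank, rank, Prod.Lex.toLex_lt_toLex]
  rcases (Finset.sup_le hle).lt_or_eq with h | h
  · exact Or.inl h
  · refine Or.inr ⟨h, Finset.card_lt_card ?_⟩
    refine (Finset.ssubset_of_subset_of_ssubset ?_ (Finset.erase_ssubset hw))
    intro z hz
    simp only [top, Finset.mem_filter, h, Finset.mem_erase, Finset.mem_insert] at hz ⊢
    obtain ⟨⟨h1, h2⟩, h3⟩ := hz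
    refine ⟨h1, ?_, h3⟩
    rcases h2 with rfl | h2
    · omega
    · exact h2

/-- The clique complex of a levelled graph is acyclic. -/
theorem exists_primitive (h : IsLeveled A l o) (b : Finset W → ZMod 2)
    (hb : ∀ σ : Finset W, A.IsClique σ → coboundary b σ = 0) :
    ∃ a : Finset W → ZMod 2, ∀ σ : Finset W, A.IsClique σ → b σ = coboundary a σ := by
  obtain ⟨x, hx⟩ := h.exists_apex
  refine ⟨primitive l x b, ?_⟩
  have P0 : ∀ σ, x (top l σ) ∈ σ → primitive l x b σ = 0 := fun σ h => by
    rw [primitive, if_pos h]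
  have hsub : ∀ σ w, w ∈ σ → w ∉ top l σ → top l σ ⊆ (insert (x (top l σ)) σ).erase w :=
    fun σ w _ hw z hz => Finset.mem_erase.2
      ⟨fun e => hw (e ▸ hz), Finset.mem_insert_of_mem (Finset.filter_subset _ _ hz)⟩
  have htop : ∀ σ : Finset W, A.IsClique σ → ∀ w ∈ σ, w ∉ top l σ →
      top l ((insert (x (top l σ)) σ).erase w) = top l σ := fun σ hσ w hw hw' =>
    top_eq (hx σ hσ).2 (hsub σ w hw hw') (Finset.erase_subset _ _)
  have htop' : ∀ σ : Finset W, A.IsClique σ → ∀ w ∈ σ, w ∉ top l σ → x (top l σ) ∉ σ →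
      x (top l σ) ∈ (insert (x (top l σ)) σ).erase w := fun σ hσ w hw hw' hxσ =>
    Finset.mem_erase.2 ⟨fun e => hxσ (e ▸ hw), Finset.mem_insert_self _ _⟩
  have case1 : ∀ ρ : Finset W, A.IsClique ρ → x (top l ρ) ∈ ρ →
      b ρ = coboundary (primitive l x b) ρ := by
    intro ρ hρ hxρ
    set y := x (top l ρ) with hy
    have hyt : y ∉ top l ρ := by
      have := (hx ρ hρ).2
      rw [← hy] at this
      intro hm
      have := Finset.mem_filter.1 hm
      omega
    set σ := ρ.erase y with hσ
    have hins : insert y σ = ρ := Finset.insert_erase hxρ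
    have hyσ : y ∉ σ := Finset.notMem_erase _ _
    have hσc : A.IsClique σ := hρ.subset (by simp [hσ])
    have ht : top l σ = top l ρ := by
      refine top_eq (y := y) (hx ρ hρ).2 (fun z hz => ?_) ?_
      · exact Finset.mem_erase.2 ⟨fun e => hyt (e ▸ hz), Finset.filter_subset _ _ hz⟩
      · exact (Finset.erase_subset _ _).trans (Finset.subset_insert _ _)
    have hxσ : x (top l σ) = y := by rw [ht]
    have e : primitive l x b σ = b ρ + ∑ w ∈ top l σ, primitive l x b (ρ.erase w) := by
      rw [primitive, hxσ, if_neg hyσ, hins]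
      congr 1
      refine Finset.sum_congr rfl fun w hw => dif_pos ?_
      have := rank_erase_lt (y := y) (hxσ ▸ (hx σ hσc).2) hw
      rwa [hins] at this
    have hr : ∑ w ∈ σ, primitive l x b (ρ.erase w) =
        ∑ w ∈ top l σ, primitive l x b (ρ.erase w) := by
      symm
      refine Finset.sum_subset (Finset.filter_subset _ _) fun w hw hwt => P0 _ ?_
      have h1 := htop σ hσc w hw hwt
      have h2 := htop' σ hσc w hw hwt (hxσ ▸ hyσ)
      rw [hxσ, hins] at h1 h2
      rw [h1, hxσ]
      exact h2
    rw [← hins, coboundary_insert _ hyσ, hins, e, hr, add_assoc, CharTwo.add_self_eq_zero,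
      add_zero]
  intro σ
  induction hn : rank l σ using WellFoundedLT.induction generalizing σ with
  | ind n ih =>
  intro hσ
  by_cases hxσ : x (top l σ) ∈ σ
  · exact case1 σ hσ hxσ
  have hc := coboundary_add b (coboundary (primitive l x b)) (insert (x (top l σ)) σ)
  rw [hb _ (hx σ hσ).1, coboundary_coboundary, add_zero, coboundary_insert _ hxσ] at hc
  rw [Finset.sum_eq_zero, add_zero, CharTwo.add_eq_zero] at hc
  · exact hc
  · intro w hw
    have hcl : A.IsClique ((insert (x (top l σ)) σ).erase w : Finset W) :=
      (hx σ hσ).1.subset (Finset.coe_subset.2 (Finset.erase_subset _ _))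
    rw [CharTwo.add_eq_zero]
    by_cases hwt : w ∈ top l σ
    · exact ih _ (hn ▸ rank_erase_lt (hx σ hσ).2 hwt) _ rfl hcl
    · refine case1 _ hcl ?_
      rw [htop σ hσ w hw hwt]
      exact htop' σ hσ w hw hwt hxσ

end IsLeveled

namespace SComplex

section
variable {V : Type u} {X : SComplex V}

theorem exists_support {f : V → ℝ} (hf : f ∈ X.realization) :
    ∃ σ ∈ X.faces, (∀ v, v ∈ σ ↔ f v ≠ 0) ∧ ∑ v ∈ σ, f v = 1 := by
  classical
  obtain ⟨-, σ, hσ, hs, h1⟩ := hf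
  have h1' : ∑ v ∈ σ with f v ≠ 0, f v = 1 := by rw [Finset.sum_filter_ne_zero, h1]
  refine ⟨{v ∈ σ | f v ≠ 0}, X.down_closed σ hσ _ (Finset.filter_subset _ _) ?_, ?_, h1'⟩
  · rw [Finset.nonempty_iff_ne_empty]
    intro h
    rw [h] at h1'
    simp at h1'
  · intro v
    rw [Finset.mem_filter, and_iff_right_iff_imp]
    exact fun h => by_contra fun h' => h (hs v h')

theorem exists_pos {f : V → ℝ} (hf : f ∈ X.realization) : ∃ v, 0 < f v := by
  obtain ⟨σ, hσ, h, -⟩ := exists_support hf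
  obtain ⟨v, hv⟩ := X.nonempty_of_mem σ hσ
  exact ⟨v, lt_of_le_of_ne (hf.1 v) ((h v).1 hv).symm⟩

theorem isOpen_pos (v : V) : IsOpen {f : X.realization | 0 < f.1 v} :=
  isOpen_lt continuous_const ((continuous_apply v).comp continuous_subtype_val)

theorem mem_realization_of_support {f : V → ℝ} (h0 : ∀ v, 0 ≤ f v) {σ : Finset V}
    (hσ : ∀ v, f v ≠ 0 → v ∈ σ) (h1 : ∑ v ∈ σ, f v = 1)
    (hf : ∀ τ : Finset V, (∀ v, v ∈ τ ↔ f v ≠ 0) → τ.Nonempty → τ ∈ X.faces) :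
    f ∈ X.realization := by
  classical
  have h1' : ∑ v ∈ σ with f v ≠ 0, f v = 1 := by rw [Finset.sum_filter_ne_zero, h1]
  refine ⟨h0, {v ∈ σ | f v ≠ 0}, hf _ (fun v => ?_) ?_, fun v hv => ?_, h1'⟩
  · rw [Finset.mem_filter, and_iff_right_iff_imp]
    exact hσ v
  · rw [Finset.nonempty_iff_ne_empty]
    intro h
    rw [h] at h1'
    simp at h1'
  · by_contra h
    exact hv (Finset.mem_filter.2 ⟨hσ v h, h⟩)

end

end SComplex

namespace IsCover

variable {V W : Type u} [DecidableEq V] {Y : SComplex V} {A : SimpleGraph W} {p : W → V}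

open Classical in
/-- Pushforward of barycentric coordinates along a map of vertices which is injective on
simplices. -/
noncomputable def push (p : W → V) (f : W → ℝ) (v : V) : ℝ :=
  if h : ∃ x, p x = v ∧ f x ≠ 0 then f h.choose else 0

theorem push_eq_zero {f : W → ℝ} {v : V} (h : ∀ x, p x = v → f x = 0) : push p f v = 0 :=
  dif_neg fun ⟨x, hx, hf⟩ => hf (h x hx)

theorem adj_of_pos {f : W → ℝ} (hf : f ∈ (SComplex.cliqueComplex A).realization) {x y : W}
    (hx : f x ≠ 0) (hy : f y ≠ 0) (hne : x ≠ y) : A.Adj x y := by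
  obtain ⟨σ, hσ, h, -⟩ := SComplex.exists_support hf
  exact hσ.2 ((h x).2 hx) ((h y).2 hy) hne

theorem eq_of_map_eq (hp : IsCover Y A p) {x y z : W} (hy : x = y ∨ A.Adj x y)
    (hz : x = z ∨ A.Adj x z) (e : p y = p z) : y = z := by
  rcases hy with rfl | hy
  · rcases hz with rfl | hz
    · rfl
    · exact (hp.adj_map hz e).elim
  · rcases hz with rfl | hz
    · exact (hp.adj_map hy e.symm).elim
    · exact hp.inj hy hz e

theorem push_eq (hp : IsCover Y A p) {f : W → ℝ}
    (hf : f ∈ (SComplex.cliqueComplex A).realization) {x y : W} (hx : f x ≠ 0)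
    (hy : x = y ∨ A.Adj x y) : push p f (p y) = f y := by
  have key : ∀ z, p z = p y → f z ≠ 0 → z = y := by
    intro z hz hfz
    refine hp.eq_of_map_eq (x := x) ?_ hy hz
    by_cases hxz : x = z
    · exact Or.inl hxz
    · exact Or.inr (adj_of_pos hf hx hfz hxz)
  by_cases h : ∃ z, p z = p y ∧ f z ≠ 0
  · rw [push, dif_pos h]
    obtain ⟨h1, h2⟩ := h.choose_spec
    rw [key _ h1 h2]
  · rw [push, dif_neg h]
    by_contra h'
    exact h ⟨y, rfl, fun e => h' e.symm⟩

theorem push_mem (hp : IsCover Y A p) {f : W → ℝ}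
    (hf : f ∈ (SComplex.cliqueComplex A).realization) : push p f ∈ Y.realization := by
  obtain ⟨σ, hσ, h, h1⟩ := SComplex.exists_support hf
  obtain ⟨x, hx⟩ := hσ.1
  have hx' := (h x).1 hx
  have hst : ∀ y ∈ σ, x = y ∨ A.Adj x y := fun y hy => or_iff_not_imp_left.2 (hσ.2 hx hy)
  have he : ∀ y ∈ σ, push p f (p y) = f y := fun y hy => hp.push_eq hf hx' (hst y hy)
  refine ⟨fun v => ?_, σ.image p, hp.face_map hσ.1 hσ.2, fun v hv => ?_, ?_⟩
  · unfold push
    split_ifs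
    · exact hf.1 _
    · exact le_rfl
  · refine push_eq_zero fun y hy => ?_
    by_contra h'
    exact hv (hy ▸ Finset.mem_image_of_mem p ((h y).2 h'))
  · rw [Finset.sum_image fun y hy z hz e => hp.eq_of_map_eq (hst y hy) (hst z hz) e, ← h1]
    exact Finset.sum_congr rfl he

/-- The map of realizations induced by a covering. -/
noncomputable def map (hp : IsCover Y A p) (f : (SComplex.cliqueComplex A).realization) :
    Y.realization := ⟨push p f.1, hp.push_mem f.2⟩

theorem continuous_map (hp : IsCover Y A p) : Continuous hp.map := by
  refine Continuous.subtype_mk (continuous_pi fun v => ?_) _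
  rw [continuous_iff_continuousAt]
  intro f
  obtain ⟨x, hx⟩ := SComplex.exists_pos f.2
  have hU := (SComplex.isOpen_pos x).mem_nhds hx
  by_cases h : ∃ y, (x = y ∨ A.Adj x y) ∧ p y = v
  · obtain ⟨y, hy, rfl⟩ := h
    refine ContinuousAt.congr (f := fun g : (SComplex.cliqueComplex A).realization => g.1 y)
      ((continuous_apply y).comp continuous_subtype_val).continuousAt ?_
    filter_upwards [hU] with g hg
    exact (hp.push_eq g.2 (ne_of_gt hg) hy).symm
  · refine ContinuousAt.congr (f := fun _ => 0) continuousAt_const ?_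
    filter_upwards [hU] with g hg
    refine (push_eq_zero fun y hy => ?_).symm
    by_contra h'
    refine h ⟨y, ?_, hy⟩
    by_cases hxy : x = y
    · exact Or.inl hxy
    · exact Or.inr (adj_of_pos g.2 (ne_of_gt hg) h' hxy)

open Classical in
/-- The local inverse of a covering, on the open star of a vertex. -/
noncomputable def lift (A : SimpleGraph W) (p : W → V) (x : W) (g : V → ℝ) (y : W) : ℝ :=
  if x = y ∨ A.Adj x y then g (p y) else 0

theorem lift_of_star {x y : W} {g : V → ℝ} (h : x = y ∨ A.Adj x y) :
    lift A p x g y = g (p y) := if_pos h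

theorem lift_mem (hp : IsCover Y A p) {x : W} {g : V → ℝ} (hg : g ∈ Y.realization)
    (hx : 0 < g (p x)) : lift A p x g ∈ (SComplex.cliqueComplex A).realization := by
  obtain ⟨σ, hσ, h, h1⟩ := SComplex.exists_support hg
  obtain ⟨τ, hτ, hxτ, rfl⟩ := hp.face_lift (x := x) hσ ((h _).2 hx.ne')
  have hst : ∀ y ∈ τ, x = y ∨ A.Adj x y := fun y hy => or_iff_not_imp_left.2 (hτ hxτ hy)
  refine ⟨fun y => ?_, τ, ⟨⟨x, hxτ⟩, hτ⟩, fun y hy => ?_, ?_⟩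
  · unfold lift
    split_ifs
    · exact hg.1 _
    · exact le_rfl
  · by_cases hxy : x = y ∨ A.Adj x y
    · rw [lift_of_star hxy]
      by_contra hne
      obtain ⟨z, hz, e⟩ := Finset.mem_image.1 ((h _).2 hne)
      exact hy (hp.eq_of_map_eq (hst z hz) hxy e ▸ hz)
    · exact if_neg hxy
  · rw [← h1, Finset.sum_image fun y hy z hz e => hp.eq_of_map_eq (hst y hy) (hst z hz) e]
    exact Finset.sum_congr rfl fun y hy => lift_of_star (hst y hy)

theorem push_lift (hp : IsCover Y A p) {x : W} {g : V → ℝ} (hg : g ∈ Y.realization)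
    (hx : 0 < g (p x)) : push p (lift A p x g) = g := by
  obtain ⟨σ, hσ, h, h1⟩ := SComplex.exists_support hg
  obtain ⟨τ, hτ, hxτ, rfl⟩ := hp.face_lift (x := x) hσ ((h _).2 hx.ne')
  have hst : ∀ y ∈ τ, x = y ∨ A.Adj x y := fun y hy => or_iff_not_imp_left.2 (hτ hxτ hy)
  have hlx : lift A p x g x ≠ 0 := by
    rw [lift_of_star (Or.inl rfl)]
    exact hx.ne'
  funext v
  by_cases hv : g v = 0
  · rw [hv]
    refine push_eq_zero fun y hy => ?_
    unfold lift
    split_ifs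
    · rw [hy, hv]
    · rfl
  · obtain ⟨y, hy, rfl⟩ := Finset.mem_image.1 ((h v).2 hv)
    rw [hp.push_eq (hp.lift_mem hg hx) hlx (hst y hy), lift_of_star (hst y hy)]

theorem lift_push (hp : IsCover Y A p) {x : W} {f : W → ℝ}
    (hf : f ∈ (SComplex.cliqueComplex A).realization) (hx : f x ≠ 0) :
    lift A p x (push p f) = f := by
  funext y
  by_cases hxy : x = y ∨ A.Adj x y
  · rw [lift_of_star hxy, hp.push_eq hf hx hxy]
  · rw [lift, if_neg hxy]
    push Not at hxy
    by_contra h'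
    exact hxy.2 (adj_of_pos hf hx (fun e => h' e.symm) hxy.1)

theorem exists_of_push_pos {f : W → ℝ} {v : V} (h : 0 < push p f v) :
    ∃ x, p x = v ∧ 0 < f x := by
  by_cases h' : ∃ x, p x = v ∧ f x ≠ 0
  · rw [push, dif_pos h'] at h
    exact ⟨_, h'.choose_spec.1, h⟩
  · rw [push, dif_neg h'] at h
    exact (lt_irrefl _ h).elim

theorem isCoveringMap (hp : IsCover Y A p) : IsCoveringMap hp.map := by
  classical
  intro g
  obtain ⟨v, hv⟩ := SComplex.exists_pos g.2
  let I := {x // p x = v}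
  let : TopologicalSpace I := ⊥
  have : DiscreteTopology I := ⟨rfl⟩
  refine IsEvenlyCovered.to_isEvenlyCovered_preimage (I := I) ?_
  refine ⟨inferInstance, {f | 0 < f.1 v}, hv, SComplex.isOpen_pos v,
    (SComplex.isOpen_pos v).preimage hp.continuous_map, ?_⟩
  set U : Set Y.realization := {f | 0 < f.1 v} with hU
  have hex : ∀ f : hp.map ⁻¹' U, ∃ x : I, 0 < f.1.1 x.1 := fun f => by
    obtain ⟨x, hx, h⟩ := exists_of_push_pos f.2
    exact ⟨⟨x, hx⟩, h⟩
  have huniq : ∀ (f : hp.map ⁻¹' U) (x y : I), 0 < f.1.1 x.1 → 0 < f.1.1 y.1 → x = y := by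
    intro f x y hx hy
    apply Subtype.ext
    by_contra hne
    exact hp.adj_map (adj_of_pos f.1.2 hx.ne' hy.ne' hne) (x.2.trans y.2.symm)
  choose s hs using hex
  have hlift : ∀ q : U × I, 0 < q.1.1.1 (p q.2.1) := fun q => by
    rw [q.2.2]
    exact q.1.2
  refine ⟨⟨⟨fun f => (⟨hp.map f.1, f.2⟩, s f), fun q => ⟨⟨lift A p q.2.1 q.1.1.1,
    hp.lift_mem q.1.1.2 (hlift q)⟩, ?_⟩, ?_, ?_⟩, ?_, ?_⟩, fun f => rfl⟩
  · change 0 < push p (lift A p q.2.1 q.1.1.1) v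
    rw [hp.push_lift q.1.1.2 (hlift q)]
    exact q.1.2
  · intro f
    apply Subtype.ext
    apply Subtype.ext
    exact hp.lift_push f.1.2 (hs f).ne'
  · rintro ⟨g, x⟩
    have e : push p (lift A p x.1 g.1.1) = g.1.1 := hp.push_lift g.1.2 (hlift (g, x))
    refine Prod.ext (Subtype.ext (Subtype.ext e)) ?_
    refine huniq _ _ _ (hs _) ?_
    change 0 < lift A p x.1 g.1.1 x.1
    rw [lift_of_star (Or.inl rfl)]
    exact hlift (g, x)
  · refine Continuous.prodMk ?_ ?_
    · exact Continuous.subtype_mk (hp.continuous_map.comp continuous_subtype_val) _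
    · rw [continuous_discrete_rng]
      intro x
      have : s ⁻¹' {x} = {f | 0 < f.1.1 x.1} := by
        ext f
        constructor
        · rintro rfl
          exact hs f
        · exact fun h => huniq f _ _ (hs f) h
      rw [this]
      exact (SComplex.isOpen_pos x.1).preimage continuous_subtype_val
  · refine Continuous.subtype_mk (Continuous.subtype_mk (continuous_pi fun y => ?_) _) _
    rw [continuous_prod_of_discrete_right]
    intro x
    by_cases hxy : x.1 = y ∨ A.Adj x.1 y
    · simp only [lift_of_star hxy]
      exact (continuous_apply (p y)).comp (continuous_subtype_val.comp continuous_subtype_val)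
    · simp only [lift, if_neg hxy]
      exact continuous_const

end IsCover

namespace IsLeveled

variable {W : Type u} {A : SimpleGraph W} {l : W → ℕ} {o : W}

/-- Nonzero nonnegative functions supported on a clique of levels at most `n`. -/
structure InCone (A : SimpleGraph W) (l : W → ℕ) (n : ℕ) (f : W → ℝ) : Prop where
  nonneg : ∀ w, 0 ≤ f w
  exists_ne : ∃ w, f w ≠ 0
  adj : ∀ x y, f x ≠ 0 → f y ≠ 0 → x ≠ y → A.Adj x y
  level : ∀ w, n < l w → f w = 0

open Classical in
/-- The maximum of a function on a finite set, with value `0` on the empty set. -/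
noncomputable def maxOn (S : Finset W) (f : W → ℝ) : ℝ :=
  if h : S.Nonempty then S.sup' h f else 0

theorem continuous_maxOn (S : Finset W) : Continuous (maxOn S) := by
  unfold maxOn
  by_cases h : S.Nonempty
  · simp only [dif_pos h]
    exact Continuous.finset_sup'_apply h fun i _ => continuous_apply i
  · simp only [dif_neg h]
    exact continuous_const

theorem le_maxOn {S : Finset W} {f : W → ℝ} {w : W} (hw : w ∈ S) : f w ≤ maxOn S f := by
  rw [maxOn, dif_pos ⟨w, hw⟩]
  exact Finset.le_sup' f hw

theorem maxOn_nonneg {S : Finset W} {f : W → ℝ} (h : ∀ w, 0 ≤ f w) : 0 ≤ maxOn S f := by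
  by_cases hS : S.Nonempty
  · obtain ⟨w, hw⟩ := hS
    exact (h w).trans (le_maxOn hw)
  · rw [maxOn, dif_neg hS]

theorem maxOn_eq_zero {S : Finset W} {f : W → ℝ} (h : ∀ w ∈ S, f w = 0) : maxOn S f = 0 := by
  by_cases hS : S.Nonempty
  · obtain ⟨w, hw, e⟩ := Finset.exists_mem_eq_sup' hS f
    rw [maxOn, dif_pos hS, e, h w hw]
  · rw [maxOn, dif_neg hS]

theorem exists_eq_maxOn {S : Finset W} {f : W → ℝ} (h : 0 < maxOn S f) :
    ∃ w ∈ S, f w = maxOn S f := by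
  by_cases hS : S.Nonempty
  · obtain ⟨w, hw, e⟩ := Finset.exists_mem_eq_sup' hS f
    exact ⟨w, hw, by rw [maxOn, dif_pos hS, e]⟩
  · rw [maxOn, dif_neg hS] at h
    exact (lt_irrefl _ h).elim

open Classical in
/-- The total mass of the elements of `S` not adjacent to `x`. -/
noncomputable def massOff (A : SimpleGraph W) (S : Finset W) (f : W → ℝ) (x : W) : ℝ :=
  ∑ w ∈ S with ¬ A.Adj w x, f w

theorem le_massOff {S : Finset W} {f : W → ℝ} (h : ∀ w, 0 ≤ f w) {x w : W} (hw : w ∈ S)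
    (hx : ¬ A.Adj w x) : f w ≤ massOff A S f x := by
  classical
  unfold massOff
  exact Finset.single_le_sum (fun i _ => h i) (Finset.mem_filter.2 ⟨hw, hx⟩)

open Classical in
/-- Pushing the mass of level `n + 1` down to level `n`, at time `s`. -/
noncomputable def shift (A : SimpleGraph W) (Lv : ℕ → Finset W) (n : ℕ) (s : ℝ) (f : W → ℝ)
    (w : W) : ℝ :=
  if w ∈ Lv (n + 1) then max (f w - s * maxOn (Lv (n + 1)) f) 0
  else if w ∈ Lv n then
    f w + max (s * maxOn (Lv (n + 1)) f - massOff A (Lv (n + 1)) f w) 0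
  else f w

theorem continuous_shift (A : SimpleGraph W) (Lv : ℕ → Finset W) (n : ℕ) :
    Continuous fun q : ℝ × (W → ℝ) => shift A Lv n q.1 q.2 := by
  classical
  have hM : Continuous fun q : ℝ × (W → ℝ) => maxOn (Lv (n + 1)) q.2 :=
    (continuous_maxOn _).comp continuous_snd
  refine continuous_pi fun w => ?_
  unfold shift massOff
  split_ifs <;> fun_prop

variable {Lv : ℕ → Finset W} {n : ℕ} {f : W → ℝ} {s : ℝ}

theorem shift_of_cut_eq_zero (hf : ∀ w, 0 ≤ f w) (h : s * maxOn (Lv (n + 1)) f = 0) :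
    shift A Lv n s f = f := by
  classical
  funext w
  have : 0 ≤ massOff A (Lv (n + 1)) f w := Finset.sum_nonneg fun i _ => hf i
  unfold shift
  split_ifs
  · rw [h, sub_zero, max_eq_left (hf w)]
  · rw [h, zero_sub, max_eq_right (by linarith), add_zero]
  · rfl

theorem shift_zero (hf : ∀ w, 0 ≤ f w) : shift A Lv n 0 f = f :=
  shift_of_cut_eq_zero hf (zero_mul _)

theorem shift_of_level (hLv : ∀ n w, w ∈ Lv n ↔ l w = n) (hf : ∀ w, 0 ≤ f w)
    (h : ∀ w, n < l w → f w = 0) : shift A Lv n s f = f := by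
  refine shift_of_cut_eq_zero hf ?_
  rw [maxOn_eq_zero fun w hw => h w (by rw [(hLv _ _).1 hw]; omega), mul_zero]

theorem shift_nonneg (hf : ∀ w, 0 ≤ f w) (w : W) : 0 ≤ shift A Lv n s f w := by
  unfold shift
  split_ifs
  · exact le_max_right _ _
  · exact add_nonneg (hf w) (le_max_right _ _)
  · exact hf w

theorem shift_one (hLv : ∀ n w, w ∈ Lv n ↔ l w = n)
    (h : ∀ w, n + 1 < l w → f w = 0) (w : W) (hw : n < l w) : shift A Lv n 1 f w = 0 := by
  unfold shift
  split_ifs with h1 h2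
  · rw [one_mul, max_eq_right]
    linarith [le_maxOn (f := f) h1]
  · rw [hLv] at h2
    omega
  · refine h w ?_
    rw [hLv] at h1
    omega

theorem shift_inCone (h : IsLeveled A l o) (hLv : ∀ n w, w ∈ Lv n ↔ l w = n)
    (hf : InCone A l (n + 1) f) (h0 : 0 ≤ s) (h1 : s ≤ 1) :
    InCone A l (n + 1) (shift A Lv n s f) := by
  classical
  by_cases hc : s * maxOn (Lv (n + 1)) f = 0
  · rwa [shift_of_cut_eq_zero hf.nonneg hc]
  set M := maxOn (Lv (n + 1)) f with hM
  have hM0 : 0 ≤ M := maxOn_nonneg hf.nonneg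
  have hMpos : 0 < M := lt_of_le_of_ne hM0 fun e => hc (by rw [← e, mul_zero])
  have hcpos : 0 < s * M := lt_of_le_of_ne (mul_nonneg h0 hM0) (Ne.symm hc)
  have hcM : s * M ≤ M := by nlinarith
  obtain ⟨w', hw', hfw'⟩ := exists_eq_maxOn hMpos
  rw [← hM] at hfw'
  have hw'0 : f w' ≠ 0 := by rw [hfw']; exact hMpos.ne'
  have hlw' := (hLv _ _).1 hw'
  have hlow : ∀ x, f x ≠ 0 → l x = n ∨ l x = n + 1 := by
    intro x hx
    have h2 : l x ≤ n + 1 := by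
      by_contra h'
      exact hx (hf.level x (by omega))
    by_cases e : w' = x
    · right
      rw [← e, hlw']
    · have := h.le_succ _ _ (hf.adj _ _ hw'0 hx e)
      omega
  have hpar : ∀ x, l x = n → shift A Lv n s f x ≠ 0 → A.Adj w' x := by
    intro x hx hne
    by_cases hfx : f x = 0
    · have hx1 : x ∉ Lv (n + 1) := by rw [hLv]; omega
      rw [shift, if_neg hx1, if_pos ((hLv _ _).2 hx), hfx, zero_add] at hne
      by_contra hadj
      have := le_massOff (A := A) hf.nonneg hw' hadj
      exact hne (max_eq_right (by linarith))
    · refine hf.adj _ _ hw'0 hfx fun e => ?_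
      rw [e] at hlw'
      omega
  have hsurv : ∀ x, l x = n + 1 → shift A Lv n s f x ≠ 0 → s * M < f x := by
    intro x hx hne
    rw [shift, if_pos ((hLv _ _).2 hx)] at hne
    by_contra hadj
    exact hne (max_eq_right (by linarith))
  have hcross : ∀ w x, l w = n + 1 → l x = n → shift A Lv n s f w ≠ 0 →
      shift A Lv n s f x ≠ 0 → A.Adj w x := by
    intro w x hw hx hw0 hx0
    have hfw := hsurv w hw hw0
    by_cases hfx : f x = 0
    · have hx1 : x ∉ Lv (n + 1) := by rw [hLv]; omega
      rw [shift, if_neg hx1, if_pos ((hLv _ _).2 hx), hfx, zero_add] at hx0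
      by_contra hadj
      have := le_massOff (A := A) hf.nonneg ((hLv _ _).2 hw) hadj
      exact hx0 (max_eq_right (by linarith))
    · refine hf.adj _ _ (by linarith) hfx fun e => ?_
      rw [e] at hw
      omega
  have hlow' : ∀ x, shift A Lv n s f x ≠ 0 → l x = n ∨ l x = n + 1 := by
    intro x hx
    by_cases h2 : l x = n ∨ l x = n + 1
    · exact h2
    · rw [shift, if_neg (by rw [hLv]; omega), if_neg (by rw [hLv]; omega)] at hx
      exact hlow x hx
  refine ⟨shift_nonneg hf.nonneg, ?_, ?_, ?_⟩
  · obtain ⟨x, hx, hxa⟩ := h.apex n {w ∈ Lv (n + 1) | f w ≠ 0}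
      ⟨w', Finset.mem_filter.2 ⟨hw', hw'0⟩⟩
      (fun a ha => (hLv _ _).1 (Finset.mem_filter.1 ha).1)
      (fun a ha b hb hab => hf.adj _ _ (Finset.mem_filter.1 ha).2 (Finset.mem_filter.1 hb).2 hab)
    refine ⟨x, ?_⟩
    have hx1 : x ∉ Lv (n + 1) := by rw [hLv]; omega
    have hm : massOff A (Lv (n + 1)) f x = 0 := by
      refine Finset.sum_eq_zero fun w hw => ?_
      by_contra hne
      rw [Finset.mem_filter] at hw
      exact hw.2 (hxa w (Finset.mem_filter.2 ⟨hw.1, hne⟩))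
    rw [shift, if_neg hx1, if_pos ((hLv _ _).2 hx), hm, sub_zero, ← hM, max_eq_left hcpos.le]
    have := hf.nonneg x
    linarith
  · intro x y hx hy hxy
    rcases hlow' x hx with h2 | h2 <;> rcases hlow' y hy with h3 | h3
    · exact h.parents w' x y (hpar x h2 hx) (hpar y h3 hy) (by omega) (by omega) hxy
    · exact (hcross y x h3 h2 hy hx).symm
    · exact hcross x y h2 h3 hx hy
    · exact hf.adj x y (by linarith [hsurv x h2 hx]) (by linarith [hsurv y h3 hy]) hxy
  · intro w hw
    by_contra hne
    have := hlow' w hne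
    omega

/-- Pushing down the levels `n, n - 1, …, 1` successively, at times `s (n - 1), …, s 0`. -/
noncomputable def collapse (A : SimpleGraph W) (Lv : ℕ → Finset W) :
    ℕ → (ℕ → ℝ) → (W → ℝ) → W → ℝ
  | 0, _, f => f
  | n + 1, s, f => collapse A Lv n s (shift A Lv n (s n) f)

theorem continuous_collapse (A : SimpleGraph W) (Lv : ℕ → Finset W) (n : ℕ) :
    Continuous fun q : (ℕ → ℝ) × (W → ℝ) => collapse A Lv n q.1 q.2 := by
  induction n with
  | zero => exact continuous_snd
  | succ n ih =>
    have h1 : Continuous fun q : (ℕ → ℝ) × (W → ℝ) => (q.1 n, q.2) :=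
      ((continuous_apply n).comp continuous_fst).prodMk continuous_snd
    have h2 := (continuous_shift A Lv n).comp h1
    exact ih.comp (continuous_fst.prodMk h2)

variable {t : ℕ → ℝ}

theorem collapse_of_zero (hf : ∀ w, 0 ≤ f w) (ht : ∀ m < n, t m = 0) :
    collapse A Lv n t f = f := by
  induction n with
  | zero => rfl
  | succ n ih =>
    rw [collapse, ht n (by omega), shift_zero hf, ih fun m hm => ht m (by omega)]

theorem collapse_of_level (hLv : ∀ n w, w ∈ Lv n ↔ l w = n) (hf : ∀ w, 0 ≤ f w)
    (h : ∀ w, n < l w → f w = 0) {m : ℕ} (hm : n ≤ m) :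
    collapse A Lv m t f = collapse A Lv n t f := by
  induction m, hm using Nat.le_induction with
  | base => rfl
  | succ m hm ih =>
    rw [collapse, shift_of_level hLv hf fun w hw => h w (by omega), ih]

theorem collapse_inCone (h : IsLeveled A l o) (hLv : ∀ n w, w ∈ Lv n ↔ l w = n)
    (h0 : ∀ m, 0 ≤ t m) (h1 : ∀ m, t m ≤ 1) (ht : ∀ m n, m < n → t n = 1 ∨ t m = 0)
    (hf : InCone A l n f) : InCone A l n (collapse A Lv n t f) := by
  induction n generalizing f with
  | zero => exact hf
  | succ n ih =>
    have hc := shift_inCone h hLv hf (h0 n) (h1 n)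
    rw [collapse]
    by_cases hn : t n = 1
    · have h2 : InCone A l n (shift A Lv n (t n) f) :=
        ⟨hc.1, hc.2, hc.3, fun w hw => by rw [hn]; exact shift_one hLv hf.level w hw⟩
      have h3 := ih h2
      exact ⟨h3.1, h3.2, h3.3, fun w hw => h3.4 w (by omega)⟩
    · rwa [collapse_of_zero hc.nonneg fun m hm => (ht m n hm).resolve_left hn]

theorem collapse_of_one (h : IsLeveled A l o) (hLv : ∀ n w, w ∈ Lv n ↔ l w = n)
    (ht : ∀ m, t m = 1) (hf : InCone A l n f) (w : W) (hw : 0 < l w) :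
    collapse A Lv n t f w = 0 := by
  induction n generalizing f with
  | zero => exact hf.level w hw
  | succ n ih =>
    have hc := shift_inCone h hLv hf (s := t n) (by rw [ht]; norm_num) (ht n).le
    rw [collapse]
    exact ih ⟨hc.1, hc.2, hc.3, fun w hw => by rw [ht]; exact shift_one hLv hf.level w hw⟩

theorem InCone.support_finite (hLv : ∀ n w, w ∈ Lv n ↔ l w = n) (hf : InCone A l n f) :
    ∃ σ : Finset W, ∀ w, w ∈ σ ↔ f w ≠ 0 := by
  classical
  refine ⟨{w ∈ (Finset.range (n + 1)).biUnion Lv | f w ≠ 0}, fun w => ?_⟩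
  rw [Finset.mem_filter, and_iff_right_iff_imp]
  intro hw
  rw [Finset.mem_biUnion]
  refine ⟨l w, Finset.mem_range.2 ?_, (hLv _ _).2 rfl⟩
  by_contra h'
  exact hw (hf.level w (by omega))

/-- The total mass in levels at most `n`. -/
noncomputable def mass (Lv : ℕ → Finset W) (n : ℕ) (f : W → ℝ) : ℝ :=
  ∑ k ∈ Finset.range (n + 1), ∑ w ∈ Lv k, f w

theorem mass_eq (hLv : ∀ n w, w ∈ Lv n ↔ l w = n) (hf : ∀ w, n < l w → f w = 0)
    {σ : Finset W} (hσ : ∀ w, f w ≠ 0 → w ∈ σ) : mass Lv n f = ∑ w ∈ σ, f w := by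
  classical
  have hd : Set.PairwiseDisjoint (Finset.range (n + 1) : Set ℕ) Lv := by
    intro i _ j _ hij
    refine Finset.disjoint_left.2 fun w hw hw' => hij ?_
    rw [← (hLv _ _).1 hw, ← (hLv _ _).1 hw']
  rw [mass, ← Finset.sum_biUnion hd, ← Finset.sum_filter_ne_zero,
    ← Finset.sum_filter_ne_zero (s := σ)]
  refine Finset.sum_congr ?_ fun _ _ => rfl
  ext w
  rw [Finset.mem_filter, Finset.mem_filter, Finset.mem_biUnion]
  refine ⟨fun h => ⟨hσ w h.2, h.2⟩, fun h => ⟨⟨l w, Finset.mem_range.2 ?_, (hLv _ _).2 rfl⟩, h.2⟩⟩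
  by_contra h'
  exact h.2 (hf w (by omega))

theorem InCone.mass_pos (hLv : ∀ n w, w ∈ Lv n ↔ l w = n) (hf : InCone A l n f) :
    0 < mass Lv n f := by
  obtain ⟨σ, hσ⟩ := hf.support_finite hLv
  rw [mass_eq hLv hf.level fun w hw => (hσ w).2 hw]
  obtain ⟨w, hw⟩ := hf.exists_ne
  exact Finset.sum_pos' (fun i _ => hf.nonneg i)
    ⟨w, (hσ w).2 hw, lt_of_le_of_ne (hf.nonneg w) (Ne.symm hw)⟩

theorem InCone.normalize_mem (hLv : ∀ n w, w ∈ Lv n ↔ l w = n) (hf : InCone A l n f) :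
    (fun w => f w / mass Lv n f) ∈ (SComplex.cliqueComplex A).realization := by
  obtain ⟨σ, hσ⟩ := hf.support_finite hLv
  have hp := hf.mass_pos hLv
  refine ⟨fun w => div_nonneg (hf.nonneg w) hp.le, σ, ⟨?_, ?_⟩, ?_, ?_⟩
  · exact hf.exists_ne.imp fun w hw => (hσ w).2 hw
  · exact fun x hx y hy => hf.adj x y ((hσ x).1 hx) ((hσ y).1 hy)
  · intro v hv
    rw [hσ, not_not] at hv
    exact (congrArg (· / _) hv).trans (zero_div _)
  · rw [← Finset.sum_div, ← mass_eq hLv hf.level fun w hw => (hσ w).2 hw, div_self hp.ne']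

theorem inCone_of_mem (hf : f ∈ (SComplex.cliqueComplex A).realization)
    (hn : ∀ w, n < l w → f w = 0) : InCone A l n f := by
  obtain ⟨w, hw⟩ := SComplex.exists_pos hf
  exact ⟨hf.1, ⟨w, hw.ne'⟩, fun x y hx hy => IsCover.adj_of_pos hf hx hy, hn⟩

theorem exists_level (h : IsLeveled A l o) (f : (SComplex.cliqueComplex A).realization) :
    ∃ n, ∀ᶠ g in nhds f, ∀ w, n < l w → g.1 w = 0 := by
  obtain ⟨x, hx⟩ := SComplex.exists_pos f.2
  refine ⟨l x + 1, ?_⟩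
  filter_upwards [(SComplex.isOpen_pos x).mem_nhds hx] with g hg w hw
  by_contra hne
  by_cases e : w = x
  · rw [e] at hw
    omega
  · have := h.le_succ _ _ (IsCover.adj_of_pos g.2 hne hg.ne' e)
    omega

/-- The times at which the levels are pushed down during a homotopy. -/
noncomputable def sched (τ : ℝ) (n : ℕ) : ℝ :=
  max 0 (min 1 ((n + 1 : ℝ) * ((n + 2) * τ - 1)))

theorem continuous_sched : Continuous sched := by
  refine continuous_pi fun n => ?_
  unfold sched
  fun_prop

theorem sched_cases (τ : ℝ) (m n : ℕ) (h : m < n) : sched τ n = 1 ∨ sched τ m = 0 := by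
  by_cases hτ : (n + 1 : ℝ) * τ ≥ 1
  · left
    have : (1 : ℝ) ≤ (n + 1 : ℝ) * ((n + 2) * τ - 1) := by nlinarith
    rw [sched, min_eq_left this, max_eq_right zero_le_one]
  · right
    push Not at hτ
    have hmn : (m : ℝ) + 1 ≤ n := by exact_mod_cast h
    have hm0 : (0 : ℝ) ≤ m := Nat.cast_nonneg m
    have h2 : ((m : ℝ) + 2) * τ - 1 ≤ 0 := by
      by_cases h0 : 0 ≤ τ
      · nlinarith
      · nlinarith
    have : (m + 1 : ℝ) * ((m + 2) * τ - 1) ≤ 0 := by nlinarith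
    rw [sched, max_eq_left]
    exact (min_le_right _ _).trans this

theorem sched_zero (n : ℕ) : sched 0 n = 0 := by
  rw [sched, max_eq_left]
  refine (min_le_right _ _).trans ?_
  have : (0 : ℝ) ≤ n := Nat.cast_nonneg n
  nlinarith

theorem sched_one (n : ℕ) : sched 1 n = 1 := by
  have : (0 : ℝ) ≤ n := Nat.cast_nonneg n
  rw [sched, min_eq_left (by nlinarith), max_eq_right zero_le_one]

theorem sched_nonneg (τ : ℝ) (n : ℕ) : 0 ≤ sched τ n := le_max_left _ _

theorem sched_le_one (τ : ℝ) (n : ℕ) : sched τ n ≤ 1 :=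
  max_le zero_le_one (min_le_left _ _)

theorem contractibleSpace (h : IsLeveled A l o) (hLv : ∀ n w, w ∈ Lv n ↔ l w = n) :
    ContractibleSpace (SComplex.cliqueComplex A).realization := by
  classical
  rw [contractible_iff_id_nullhomotopic]
  have hN : ∀ f : (SComplex.cliqueComplex A).realization, ∃ n, ∀ w, n < l w → f.1 w = 0 :=
    fun f => (exists_level h f).imp fun n hn => hn.self_of_nhds
  choose N hN using hN
  have hcone : ∀ (τ : ℝ) (f : (SComplex.cliqueComplex A).realization) (n : ℕ),
      (∀ w, n < l w → f.1 w = 0) → InCone A l n (collapse A Lv n (sched τ) f.1) :=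
    fun τ f n hn => collapse_inCone h hLv (sched_nonneg τ) (sched_le_one τ) (sched_cases τ)
      (inCone_of_mem f.2 hn)
  let F : ℕ → ℝ → (W → ℝ) → W → ℝ := fun n τ f w =>
    collapse A Lv n (sched τ) f w / mass Lv n (collapse A Lv n (sched τ) f)
  have hmass : ∀ n, Continuous (mass Lv n) := fun n => by
    unfold mass
    fun_prop
  have hF : ∀ (τ : ℝ) (f : (SComplex.cliqueComplex A).realization) (n : ℕ),
      (∀ w, n < l w → f.1 w = 0) → F n τ f.1 = F (N f) τ f.1 := by
    intro τ f n hn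
    have key : ∀ a b : ℕ, a ≤ b → (∀ w, a < l w → f.1 w = 0) → F b τ f.1 = F a τ f.1 := by
      intro a b hab ha
      have e : collapse A Lv b (sched τ) f.1 = collapse A Lv a (sched τ) f.1 :=
        collapse_of_level hLv f.2.1 ha hab
      have hc := hcone τ f a ha
      obtain ⟨σ, hσ⟩ := hc.support_finite hLv
      have hm : mass Lv b (collapse A Lv b (sched τ) f.1) =
          mass Lv a (collapse A Lv a (sched τ) f.1) := by
        rw [e, mass_eq hLv hc.level fun w hw => (hσ w).2 hw,
          mass_eq hLv (fun w hw => hc.level w (by omega)) fun w hw => (hσ w).2 hw]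
      funext w
      simp only [F]
      rw [hm, e]
    rcases le_total n (N f) with h1 | h1
    · exact (key _ _ h1 hn).symm
    · exact key _ _ h1 (hN f)
  let H : unitInterval × (SComplex.cliqueComplex A).realization →
      (SComplex.cliqueComplex A).realization := fun q =>
    ⟨F (N q.2) q.1 q.2.1, (hcone q.1 q.2 _ (hN q.2)).normalize_mem hLv⟩
  have hH : Continuous H := by
    refine Continuous.subtype_mk ?_ _
    rw [continuous_iff_continuousAt]
    rintro ⟨τ, f⟩
    obtain ⟨n, hn⟩ := exists_level h f
    have hcol : Continuous fun q : unitInterval × (SComplex.cliqueComplex A).realization =>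
        collapse A Lv n (sched q.1) q.2.1 :=
      (continuous_collapse A Lv n).comp
        ((continuous_sched.comp (continuous_subtype_val.comp continuous_fst)).prodMk
          (continuous_subtype_val.comp continuous_snd))
    refine ContinuousAt.congr (f := fun q : unitInterval × _ => F n q.1 q.2.1) ?_ ?_
    · refine continuousAt_pi.2 fun w => ?_
      refine ContinuousAt.div ?_ ?_ ?_
      · exact ((continuous_apply w).comp hcol).continuousAt
      · exact ((hmass n).comp hcol).continuousAt
      · exact ((hcone τ f n hn.self_of_nhds).mass_pos hLv).ne'
    · have h2 : ∀ᶠ q : unitInterval × (SComplex.cliqueComplex A).realization in nhds (τ, f),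
          ∀ w, n < l w → q.2.1 w = 0 := by
        rw [nhds_prod_eq]
        exact hn.prod_inr _
      filter_upwards [h2] with q hq
      exact hF _ _ _ hq
  refine ⟨⟨Pi.single o 1, fun w => ?_, {o}, ⟨⟨o, by simp⟩, by simp⟩, ?_, by simp⟩,
    ⟨⟨⟨H, hH⟩, ?_, ?_⟩⟩⟩
  · by_cases e : w = o
    · simp [e]
    · simp [Pi.single_eq_of_ne e]
  · intro v hv
    rw [Finset.mem_singleton] at hv
    exact Pi.single_eq_of_ne hv _
  · intro f
    apply Subtype.ext
    have e : collapse A Lv (N f) (sched 0) f.1 = f.1 :=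
      collapse_of_zero f.2.1 fun m _ => sched_zero m
    obtain ⟨σ, -, hσ, h1⟩ := SComplex.exists_support f.2
    funext w
    change F (N f) 0 f.1 w = f.1 w
    simp only [F]
    rw [e, mass_eq hLv (hN f) fun w hw => (hσ w).2 hw, h1, div_one]
  · intro f
    apply Subtype.ext
    have hc := hcone 1 f _ (hN f)
    have hz : ∀ w, w ≠ o → collapse A Lv (N f) (sched 1) f.1 w = 0 := fun w hw =>
      collapse_of_one h hLv sched_one (inCone_of_mem f.2 (hN f)) w
        (Nat.pos_of_ne_zero fun e => hw ((h.root w).1 e))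
    have hm : mass Lv (N f) (collapse A Lv (N f) (sched 1) f.1) =
        collapse A Lv (N f) (sched 1) f.1 o := by
      rw [mass_eq hLv hc.level (σ := {o}), Finset.sum_singleton]
      intro w hw
      by_contra h'
      exact hw (hz w (by simpa using h'))
    have hpos := hc.mass_pos hLv
    funext w
    change F (N f) 1 f.1 w = (Pi.single o 1 : W → ℝ) w
    simp only [F]
    by_cases e : w = o
    · rw [hm] at hpos
      rw [hm, e, Pi.single_eq_same, div_self hpos.ne']
    · rw [hz w e, zero_div, Pi.single_eq_of_ne e]

end IsLeveled

theorem IsCoveringMap.bijective_of_simplyConnectedSpace {E B : Type*} [TopologicalSpace E]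
    [TopologicalSpace B] {q : E → B} (cov : IsCoveringMap q) [PathConnectedSpace E]
    [SimplyConnectedSpace B] : Function.Bijective q := by
  constructor
  · intro x y hxy
    obtain ⟨Γ⟩ := PathConnectedSpace.joined x y
    let γ : Path (q x) (q x) := (Γ.map cov.continuous).cast rfl hxy
    have h := SimplyConnectedSpace.paths_homotopic γ (Path.refl (q x))
    have h2 := cov.liftPath_apply_one_eq_of_homotopicRel h x γ.source (Path.refl (q x)).source
    have e1 : Γ.toContinuousMap = cov.liftPath γ.toContinuousMap x γ.source :=
      (cov.eq_liftPath_iff' γ.source).2 ⟨rfl, Γ.source⟩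
    have e2 : cov.liftPath (Path.refl (q x)).toContinuousMap x (Path.refl (q x)).source =
        .const _ x :=
      cov.liftPath_const rfl
    rw [e2, ← e1] at h2
    have h3 : Γ 1 = x := h2
    rw [← h3, Γ.target]
  · intro b
    obtain ⟨e⟩ : Nonempty E := inferInstance
    obtain ⟨γ⟩ := PathConnectedSpace.joined (q e) b
    refine ⟨cov.liftPath γ e γ.source 1, ?_⟩
    exact (congrFun (cov.liftPath_lifts γ e γ.source) 1).trans γ.target

namespace SComplex

variable {V : Type u}

open Classical in
/-- The barycentric coordinates of a vertex. -/
noncomputable def vtx (v : V) (x : V) : ℝ := if x = v then 1 else 0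

theorem vtx_self (v : V) : vtx v v = 1 := if_pos rfl

theorem vtx_of_ne {v x : V} (h : x ≠ v) : vtx v x = 0 := if_neg h

theorem vtx_mem {X : SComplex V} {v : V} (hv : ({v} : Finset V) ∈ X.faces) :
    vtx v ∈ X.realization := by
  refine ⟨fun x => ?_, {v}, hv, fun x hx => vtx_of_ne (by simpa using hx), ?_⟩
  · unfold vtx
    split_ifs
    · exact zero_le_one
    · exact le_rfl
  · rw [Finset.sum_singleton, vtx_self]

theorem vertex_mem {X : SComplex V} {σ : Finset V} (hσ : σ ∈ X.faces) {v : V} (hv : v ∈ σ) :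
    ({v} : Finset V) ∈ X.faces :=
  X.down_closed σ hσ _ (Finset.singleton_subset_iff.2 hv) ⟨v, Finset.mem_singleton_self v⟩

end SComplex

namespace IsCover

variable {V W : Type u} [DecidableEq V] {Y : SComplex V} {A : SimpleGraph W} {p : W → V}
  {l : W → ℕ} {o : W}

theorem push_vtx (hp : IsCover Y A p) (w : W) : push p (SComplex.vtx w) = SComplex.vtx (p w) := by
  classical
  funext v
  have hw : SComplex.vtx w ∈ (SComplex.cliqueComplex A).realization :=
    SComplex.vtx_mem ⟨⟨w, by simp⟩, by simp⟩
  by_cases hv : v = p w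
  · rw [hv, hp.push_eq hw (x := w) (by rw [SComplex.vtx_self]; exact one_ne_zero) (Or.inl rfl),
      SComplex.vtx_self, SComplex.vtx_self]
  · rw [SComplex.vtx_of_ne hv]
    refine push_eq_zero fun x hx => SComplex.vtx_of_ne fun e => hv ?_
    rw [← hx, e]

theorem eq_vtx_of_push (hp : IsCover Y A p) {f : W → ℝ} {v : V}
    (hf : f ∈ (SComplex.cliqueComplex A).realization) (h : push p f = SComplex.vtx v) :
    ∃ w, p w = v ∧ f = SComplex.vtx w := by
  obtain ⟨w, hw, hfw⟩ := exists_of_push_pos (p := p) (f := f) (v := v)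
    (by rw [h, SComplex.vtx_self]; exact one_pos)
  refine ⟨w, hw, ?_⟩
  rw [← hp.lift_push hf hfw.ne', h]
  funext y
  by_cases hy : w = y
  · rw [lift_of_star (Or.inl hy), ← hy, hw, SComplex.vtx_self, SComplex.vtx_self]
  · rw [SComplex.vtx_of_ne (Ne.symm hy), lift]
    split_ifs with h'
    · refine SComplex.vtx_of_ne fun e => hp.adj_map (h'.resolve_left hy) ?_
      rw [hw, e]
    · rfl

/-- The levels of a covering of a locally finite complex are finite. -/
theorem exists_levels (h : IsLeveled A l o) (hp : IsCover Y A p)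
    (hfin : ∀ v, {u | ({v, u} : Finset V) ∈ Y.faces}.Finite) :
    ∃ Lv : ℕ → Finset W, ∀ n w, w ∈ Lv n ↔ l w = n := by
  classical
  have hn : ∀ x, {y | A.Adj x y}.Finite := by
    intro x
    refine Set.Finite.of_finite_image (f := p) ((hfin (p x)).subset ?_) ?_
    · rintro _ ⟨y, hy, rfl⟩
      have : ({x, y} : Finset W).image p ∈ Y.faces := by
        refine hp.face_map ⟨x, by simp⟩ ?_
        simp only [Finset.coe_insert, Finset.coe_singleton]
        rw [SimpleGraph.isClique_pair]
        exact fun _ => hy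
      rwa [Finset.image_insert, Finset.image_singleton] at this
    · exact fun y hy z hz e => hp.inj hy hz e
  have hl : ∀ n, {w | l w = n}.Finite := by
    intro n
    induction n with
    | zero =>
      refine (Set.finite_singleton o).subset fun w hw => ?_
      exact (h.root w).1 hw
    | succ n ih =>
      refine (ih.biUnion fun x _ => hn x).subset fun w hw => ?_
      obtain ⟨x, hx, hxw⟩ := h.apex n {w} ⟨w, by simp⟩ (by simpa using hw) (by simp)
      exact Set.mem_biUnion hx (hxw w (by simp)).symm
  exact ⟨fun n => (hl n).toFinset, fun n w => by simp⟩

theorem contractibleSpace_and_bijective (h : IsLeveled A l o) (hp : IsCover Y A p)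
    (hfin : ∀ v, {u | ({v, u} : Finset V) ∈ Y.faces}.Finite)
    [SimplyConnectedSpace Y.realization] :
    ContractibleSpace Y.realization ∧ Function.Bijective hp.map := by
  obtain ⟨Lv, hLv⟩ := exists_levels h hp hfin
  have := h.contractibleSpace hLv
  have hb := hp.isCoveringMap.bijective_of_simplyConnectedSpace
  exact ⟨(hp.isCoveringMap.isLocalHomeomorph.toHomeomorphOfBijective hb).symm.contractibleSpace,
    hb⟩

/-- A partial section of a covering defined on the vertices of `Z` transports primitives of
cocycles. -/
theorem exists_primitive_of_section (h : IsLeveled A l o) (hp : IsCover Y A p)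
    (s : V → W) (Z : SComplex V)
    (hs : ∀ σ ∈ Z.faces, (∀ v ∈ σ, p (s v) = v) ∧ ∀ v ∈ σ, ∀ w ∈ σ, v ≠ w → A.Adj (s v) (s w))
    (b : Finset V → ZMod 2) (hb : ∀ σ ∈ Y.faces, coboundary b σ = 0) :
    b ∅ = 0 ∧ ∃ a, ∀ σ ∈ Z.faces, b σ = coboundary a σ := by
  classical
  obtain ⟨a, ha⟩ := h.exists_primitive (fun τ => b (τ.image p)) fun τ hτ => by
    rcases τ.eq_empty_or_nonempty with rfl | hne
    · simp [coboundary]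
    have hinj : ∀ x ∈ τ, ∀ y ∈ τ, p x = p y → x = y := by
      intro x hx y hy e
      by_contra hxy
      exact hp.adj_map (hτ hx hy hxy) e
    rw [← hb _ (hp.face_map hne hτ), coboundary, coboundary, Finset.sum_image hinj]
    refine Finset.sum_congr rfl fun x hx => ?_
    congr 1
    ext v
    simp only [Finset.mem_image, Finset.mem_erase]
    constructor
    · rintro ⟨y, ⟨hyx, hy⟩, rfl⟩
      exact ⟨fun e => hyx (hinj _ hy _ hx e), y, hy, rfl⟩
    · rintro ⟨hv, y, hy, rfl⟩
      exact ⟨y, ⟨fun e => hv (by rw [e]), hy⟩, rfl⟩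
  refine ⟨?_, fun σ => a (σ.image s), fun σ hσ => ?_⟩
  · have := ha ∅ (by simp)
    simpa [coboundary] using this
  obtain ⟨h1, h2⟩ := hs σ hσ
  have hinj : ∀ x ∈ σ, ∀ y ∈ σ, s x = s y → x = y := fun x hx y hy e => by
    rw [← h1 x hx, ← h1 y hy, e]
  have e1 : (σ.image s).image p = σ := by
    rw [Finset.image_image]
    conv_rhs => rw [← Finset.image_id (s := σ)]
    exact Finset.image_congr fun v hv => h1 v hv
  have := ha (σ.image s) (by
    intro x hx y hy hxy
    rw [Finset.mem_coe, Finset.mem_image] at hx hy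
    obtain ⟨v, hv, rfl⟩ := hx
    obtain ⟨w, hw, rfl⟩ := hy
    exact h2 v hv w hw fun e => hxy (by rw [e]))
  simp only [e1] at this
  rw [this, coboundary, coboundary, Finset.sum_image hinj]
  refine Finset.sum_congr rfl fun x hx => ?_
  congr 1
  ext v
  simp only [Finset.mem_image, Finset.mem_erase]
  constructor
  · rintro ⟨hv, y, hy, rfl⟩
    exact ⟨y, ⟨fun e => hv (by rw [e]), hy⟩, rfl⟩
  · rintro ⟨y, ⟨hyx, hy⟩, rfl⟩
    exact ⟨fun e => hyx (hinj _ hy _ hx e), y, hy, rfl⟩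

/-- The cocycles of a locally finite systolic complex are coboundaries. -/
theorem exists_primitive (h : IsLeveled A l o) (hp : IsCover Y A p)
    (hb : Function.Bijective hp.map) (b : Finset V → ZMod 2)
    (hc : ∀ σ ∈ Y.faces, coboundary b σ = 0) : ∃ a, ∀ σ ∈ Y.faces, b σ = coboundary a σ := by
  classical
  have hex : ∀ v, ∃ w, ({v} : Finset V) ∈ Y.faces → p w = v := by
    intro v
    by_cases hv : ({v} : Finset V) ∈ Y.faces
    · obtain ⟨f, hf⟩ := hb.2 ⟨_, SComplex.vtx_mem hv⟩
      obtain ⟨w, hw, -⟩ := hp.eq_vtx_of_push f.2 (congrArg Subtype.val hf)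
      exact ⟨w, fun _ => hw⟩
    · exact ⟨o, fun h' => (hv h').elim⟩
  choose s hs using hex
  have hinj : ∀ x y, p x = p y → x = y := by
    intro x y e
    have hm : ∀ w, SComplex.vtx w ∈ (SComplex.cliqueComplex A).realization := fun w =>
      SComplex.vtx_mem ⟨⟨w, by simp⟩, by simp⟩
    have h1 : hp.map ⟨_, hm x⟩ = hp.map ⟨_, hm y⟩ := by
      apply Subtype.ext
      change push p (SComplex.vtx x) = push p (SComplex.vtx y)
      rw [hp.push_vtx, hp.push_vtx, e]
    have h2 := congrFun (congrArg Subtype.val (hb.1 h1)) x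
    by_contra hne
    have h3 : SComplex.vtx x x = SComplex.vtx y x := h2
    rw [SComplex.vtx_self, SComplex.vtx_of_ne hne] at h3
    exact one_ne_zero h3
  refine (hp.exists_primitive_of_section h s Y (fun σ hσ => ?_) b hc).2
  have h1 : ∀ v ∈ σ, p (s v) = v := fun v hv => hs v (SComplex.vertex_mem hσ hv)
  refine ⟨h1, fun v hv w hw hvw => ?_⟩
  obtain ⟨τ, hτ, -, rfl⟩ := hp.face_lift (x := s v) hσ (by rwa [h1 v hv])
  obtain ⟨x, hx, rfl⟩ := Finset.mem_image.1 hv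
  obtain ⟨y, hy, rfl⟩ := Finset.mem_image.1 hw
  rw [hinj _ _ (h1 _ hv), hinj _ _ (h1 _ hw)]
  exact hτ hx hy fun e => hvw (by rw [e])

end IsCover

namespace ConnInfty

theorem joinedIn {X : Type u} [TopologicalSpace X] (h : ConnInfty X 0) {K : Set X}
    (hK : IsCompact K) :
    ∃ L : Set X, IsCompact L ∧ K ⊆ L ∧ ∀ x ∉ L, ∀ y ∉ L, JoinedIn Kᶜ x y := by
  classical
  obtain ⟨L, hL, hKL, H⟩ := h K hK
  refine ⟨L, hL, hKL, fun x hx y hy => ?_⟩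
  change ∀ f : EuclideanSpace ℝ (Fin 1) → X, ContinuousOn f (Metric.sphere 0 1) →
    (∀ x ∈ Metric.sphere (0 : EuclideanSpace ℝ (Fin 1)) 1, f x ∉ L) →
    ∃ g : EuclideanSpace ℝ (Fin 1) → X, ContinuousOn g (Metric.closedBall 0 1) ∧
      (∀ x ∈ Metric.closedBall (0 : EuclideanSpace ℝ (Fin 1)) 1, g x ∉ K) ∧
      ∀ x ∈ Metric.sphere (0 : EuclideanSpace ℝ (Fin 1)) 1, g x = f x at H
  let e : EuclideanSpace ℝ (Fin 1) := EuclideanSpace.single 0 1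
  have he : e ∈ Metric.sphere (0 : EuclideanSpace ℝ (Fin 1)) 1 := by simp [e]
  have hne : -e ∈ Metric.sphere (0 : EuclideanSpace ℝ (Fin 1)) 1 := by simp [e]
  have hee : -e ≠ e := by
    intro h'
    have := congrArg (fun v : EuclideanSpace ℝ (Fin 1) => v 0) h'
    simp [e] at this
    norm_num at this
  have hfin : (Metric.sphere (0 : EuclideanSpace ℝ (Fin 1)) 1).Finite := by
    refine (Set.toFinite {e, -e}).subset fun v hv => ?_
    have h1 : ‖v‖ = 1 := by simpa using hv
    rw [EuclideanSpace.norm_eq] at h1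
    have h2 : |v 0| = 1 := by simpa [Real.sqrt_sq_eq_abs] using h1
    rcases (abs_eq zero_le_one).1 h2 with h3 | h3
    · left
      ext i
      rw [Subsingleton.elim i 0]
      simp [e, h3]
    · right
      ext i
      rw [Subsingleton.elim i 0]
      simp [e, h3]
  obtain ⟨g, hg, hgK, hgf⟩ := H (fun v => if v = e then x else y) (hfin.continuousOn _)
    fun v _ => by
      split_ifs
      · exact hx
      · exact hy
  have h1 : g e = x := by rw [hgf e he, if_pos rfl]
  have h2 : g (-e) = y := by rw [hgf _ hne, if_neg hee]
  have hj : JoinedIn (Metric.closedBall (0 : EuclideanSpace ℝ (Fin 1)) 1) e (-e) :=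
    ((convex_closedBall _ _).isPathConnected ⟨0, by simp⟩).joinedIn _
      (Metric.sphere_subset_closedBall he) _ (Metric.sphere_subset_closedBall hne)
  obtain ⟨γ, hγ⟩ := hj
  rw [← h1, ← h2]
  refine ⟨⟨⟨fun t => g (γ t), hg.comp_continuous γ.continuous hγ⟩, by simp, by simp⟩,
    fun t => hgK _ (hγ t)⟩

theorem circle_loop {X : Type u} [TopologicalSpace X] {x : X} (γ : Path x x) :
    ∃ F : Circle → X, Continuous F ∧
      ∀ t : unitInterval, F (Circle.exp (2 * Real.pi * (t : ℝ))) = γ t := by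
  have hc : Continuous (AddCircle.liftIco (1 : ℝ) 0 γ.extend) :=
    AddCircle.liftIco_zero_continuous (by simp) γ.extend.continuous.continuousOn
  refine ⟨AddCircle.liftIco (1 : ℝ) 0 γ.extend ∘ (AddCircle.homeomorphCircle one_ne_zero).symm,
    hc.comp (Homeomorph.continuous _), fun t => ?_⟩
  have h1 : Circle.exp (2 * Real.pi * (t : ℝ)) =
      AddCircle.homeomorphCircle (one_ne_zero (α := ℝ)) ((t : ℝ) : AddCircle (1 : ℝ)) := by
    rw [AddCircle.homeomorphCircle_apply, AddCircle.toCircle_apply_mk, div_one]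
  rw [h1, Function.comp_apply, Homeomorph.symm_apply_apply]
  rcases t.2.2.lt_or_eq with ht | ht
  · rw [AddCircle.liftIco_zero_coe_apply ⟨t.2.1, ht⟩, γ.extend_apply t.2]
  · rw [ht, AddCircle.coe_period, ← AddCircle.coe_zero,
      AddCircle.liftIco_zero_coe_apply ⟨le_rfl, one_pos⟩]
    have : t = 1 := Subtype.ext ht
    rw [this]
    simp

theorem loop_homotopic {X : Type u} [TopologicalSpace X] (h : ConnInfty X 1) {K : Set X}
    (hK : IsCompact K) :
    ∃ L : Set X, IsCompact L ∧ K ⊆ L ∧ ∀ (hKL : Lᶜ ⊆ Kᶜ) (x : (Lᶜ : Set X)) (γ : Path x x),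
      (γ.map (continuous_inclusion hKL)).Homotopic (Path.refl (Set.inclusion hKL x)) := by
  classical
  obtain ⟨L, hL, hKL, H⟩ := h K hK
  refine ⟨L, hL, hKL, fun hKL x γ => ?_⟩
  change ∀ f : EuclideanSpace ℝ (Fin 2) → X, ContinuousOn f (Metric.sphere 0 1) →
    (∀ x ∈ Metric.sphere (0 : EuclideanSpace ℝ (Fin 2)) 1, f x ∉ L) →
    ∃ g : EuclideanSpace ℝ (Fin 2) → X, ContinuousOn g (Metric.closedBall 0 1) ∧
      (∀ x ∈ Metric.closedBall (0 : EuclideanSpace ℝ (Fin 2)) 1, g x ∉ K) ∧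
      ∀ x ∈ Metric.sphere (0 : EuclideanSpace ℝ (Fin 2)) 1, g x = f x at H
  obtain ⟨F, hF, hFγ⟩ := circle_loop γ
  let E : ℂ ≃ₗᵢ[ℝ] EuclideanSpace ℝ (Fin 2) := Complex.orthonormalBasisOneI.repr
  let u (v : EuclideanSpace ℝ (Fin 2)) : Circle :=
    if hv : v ∈ Metric.sphere (0 : EuclideanSpace ℝ (Fin 2)) 1 then
      ⟨E.symm v, by
        rw [mem_sphere_zero_iff_norm] at hv
        rw [Submonoid.unitSphere]
        simpa using hv⟩ else 1
  have hu : ContinuousOn u (Metric.sphere 0 1) := by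
    rw [continuousOn_iff_continuous_domRestrict]
    refine continuous_induced_rng.2
      ((E.symm.continuous.comp continuous_subtype_val).congr fun v => ?_)
    have h1 : u v = ⟨E.symm v, _⟩ := dif_pos v.2
    exact (congrArg Subtype.val h1).symm
  have hE : ∀ z : Circle, E z ∈ Metric.sphere (0 : EuclideanSpace ℝ (Fin 2)) 1 := by
    intro z
    rw [mem_sphere_zero_iff_norm, E.norm_map, z.norm_coe]
  have huE : ∀ z : Circle, u (E z) = z := by
    intro z
    have h1 : u (E z) = ⟨E.symm (E z), _⟩ := dif_pos (hE z)
    rw [h1]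
    exact Subtype.ext (E.symm_apply_apply _)
  obtain ⟨g, hg, hgK, hgf⟩ := H (fun v => F (u v))
    (continuous_subtype_val.comp_continuousOn (hF.comp_continuousOn hu)) fun v _ => (F (u v)).2
  let D := Metric.closedBall (0 : EuclideanSpace ℝ (Fin 2)) 1
  have : ContractibleSpace D := (convex_closedBall _ _).contractibleSpace ⟨0, by simp⟩
  let g' : C(D, (Kᶜ : Set X)) := ⟨fun v => ⟨g v, hgK v v.2⟩,
    (continuousOn_iff_continuous_domRestrict.1 hg).subtype_mk _⟩
  let m (t : unitInterval) : D := ⟨E (Circle.exp (2 * Real.pi * (t : ℝ))),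
    Metric.sphere_subset_closedBall (hE _)⟩
  have hm : Continuous m := by
    refine Continuous.subtype_mk ?_ _
    fun_prop
  have hm01 : m 1 = m 0 := by
    apply Subtype.ext
    simp [m]
  let μ : Path (m 0) (m 0) := ⟨⟨m, hm⟩, rfl, hm01⟩
  have hgm : ∀ t, g' (m t) = Set.inclusion hKL (γ t) := by
    intro t
    apply Subtype.ext
    change g (E (Circle.exp (2 * Real.pi * (t : ℝ)))) = (γ t : X)
    rw [hgf _ (hE _), huE, hFγ]
  have h0 : Set.inclusion hKL x = g' (m 0) := by rw [hgm, γ.source]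
  have h1 : γ.map (continuous_inclusion hKL) = (μ.map g'.continuous).cast h0 h0 := by
    ext t
    exact congrArg Subtype.val (hgm t).symm
  have h2 : Path.refl (Set.inclusion hKL x) = ((Path.refl (m 0)).map g'.continuous).cast h0 h0 := by
    ext t
    exact congrArg Subtype.val h0
  rw [h1, h2]
  exact ((SimplyConnectedSpace.paths_homotopic μ (Path.refl (m 0))).map g').pathCast h0 h0

end ConnInfty

theorem Path.homotopic_map_of_loop {Z B : Type*} [TopologicalSpace Z] [TopologicalSpace B]
    (i : C(Z, B)) (h : ∀ (z : Z) (γ : Path z z), (γ.map i.continuous).Homotopic (Path.refl (i z)))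
    {z z' : Z} (α β : Path z z') : (α.map i.continuous).Homotopic (β.map i.continuous) := by
  have h1 := h z (α.trans β.symm)
  rw [Path.map_trans] at h1
  change ((α.map i.continuous).trans (β.map i.continuous).symm).Homotopic _ at h1
  have h2 := Path.Homotopic.hcomp h1 (Path.Homotopic.refl (β.map i.continuous))
  rw [← Path.Homotopic.Quotient.eq] at h2 ⊢
  simpa only [Path.Homotopic.Quotient.mk_trans,
    Path.Homotopic.Quotient.mk_refl, Path.Homotopic.Quotient.refl_trans,
    Path.Homotopic.Quotient.symm_trans, Path.Homotopic.Quotient.trans_refl,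
        Path.Homotopic.Quotient.mk_symm,
    Path.Homotopic.Quotient.trans_assoc] using h2

namespace IsCoveringMap

variable {E B Z : Type*} [TopologicalSpace E] [TopologicalSpace B] [TopologicalSpace Z] {q : E → B}

theorem exists_path_lift (cov : IsCoveringMap q) {b c : B} (γ : Path b c) {e : E} (he : q e = b) :
    ∃ (e' : E) (Γ : Path e e'), ∀ t, q (Γ t) = γ t := by
  have h0 : γ.toContinuousMap 0 = q e := γ.source.trans he.symm
  exact ⟨_, ⟨cov.liftPath γ.toContinuousMap e h0, cov.liftPath_zero _ _ _, rfl⟩,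
    fun t => congrFun (cov.liftPath_lifts γ.toContinuousMap e h0) t⟩

theorem eq_of_homotopic (cov : IsCoveringMap q) {b c : B} {γ γ' : Path b c} (h : γ.Homotopic γ')
    {e x x' : E} (Γ : Path e x) (Γ' : Path e x') (hΓ : ∀ t, q (Γ t) = γ t)
    (hΓ' : ∀ t, q (Γ' t) = γ' t) : x = x' := by
  have h0 : γ.toContinuousMap 0 = q e := by
    rw [← Γ.source, hΓ]; rfl
  have h0' : γ'.toContinuousMap 0 = q e := by
    rw [← Γ'.source, hΓ']; rfl
  have e1 : Γ.toContinuousMap = cov.liftPath γ.toContinuousMap e h0 :=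
    (cov.eq_liftPath_iff' h0).2 ⟨funext hΓ, Γ.source⟩
  have e2 : Γ'.toContinuousMap = cov.liftPath γ'.toContinuousMap e h0' :=
    (cov.eq_liftPath_iff' h0').2 ⟨funext hΓ', Γ'.source⟩
  have h3 := cov.liftPath_apply_one_eq_of_homotopicRel h e h0 h0'
  rw [← e1, ← e2] at h3
  exact Γ.target.symm.trans (h3.trans Γ'.target)

/-- A covering admits a section over a subspace all of whose loops are null-homotopic, compatible
with the lifting of paths. -/
theorem exists_section (cov : IsCoveringMap q) (i : C(Z, B)) (e₀ : E)
    (h0 : ∀ z, Joined (q e₀) (i z))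
    (h1 : ∀ (z : Z) (γ : Path z z), (γ.map i.continuous).Homotopic (Path.refl (i z))) :
    ∃ s : Z → E, (∀ z, q (s z) = i z) ∧
      ∀ (z z' : Z) (α : Path z z') (x : E) (Γ : Path (s z) x), (∀ t, q (Γ t) = i (α t)) →
        s z' = x := by
  have hr : ∃ r : Z → Z, (∀ z, Joined (r z) z) ∧ ∀ z z', Joined z z' → r z = r z' := by
    refine ⟨fun z => (Quotient.mk (pathSetoid Z) z).out, fun z => Quotient.mk_out
        (s := pathSetoid Z) z,
      fun z z' h => ?_⟩
    have : Quotient.mk (pathSetoid Z) z = Quotient.mk (pathSetoid Z) z' := Quotient.sound h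
    simp only [this]
  obtain ⟨r, hr, hrr⟩ := hr
  have hs1 : ∀ z, ∃ e, q e = i z := by
    intro z
    obtain ⟨γ⟩ := h0 z
    obtain ⟨e', Γ, hΓ⟩ := cov.exists_path_lift γ rfl
    exact ⟨e', by rw [← Γ.target, hΓ, γ.target]⟩
  choose k hk using hs1
  have hs2 : ∀ z, ∃ (e : E) (α : Path (r z) z) (Γ : Path (k (r z)) e), ∀ t, q (Γ t) = i (α t) := by
    intro z
    obtain ⟨α⟩ := hr z
    obtain ⟨e', Γ, hΓ⟩ := cov.exists_path_lift (α.map i.continuous) (hk (r z))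
    exact ⟨e', α, Γ, hΓ⟩
  choose s ρ R hR using hs2
  refine ⟨s, fun z => by rw [← (R z).target, hR, (ρ z).target], fun z z' α x Γ hΓ => ?_⟩
  have hz := hrr z z' ⟨α⟩
  refine cov.eq_of_homotopic (Path.homotopic_map_of_loop i h1
    ((ρ z').cast hz rfl) ((ρ z).trans α)) ((R z').cast (congrArg k hz) rfl) ((R z).trans Γ)
    (fun t => hR z' t) fun t => ?_
  change q ((R z).trans Γ t) = i ((ρ z).trans α t)
  rw [Path.trans_apply, Path.trans_apply]
  split_ifs
  · exact hR z _
  · exact hΓ _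

end IsCoveringMap

namespace SComplex

variable {V : Type u} {X : SComplex V}

theorem realization_mono {Y X : SComplex V} (h : Y.faces ⊆ X.faces) :
    Y.realization ⊆ X.realization :=
  fun _ hf => ⟨hf.1, hf.2.imp fun _ hσ => ⟨h hσ.1, hσ.2⟩⟩

theorem exists_finite_support [DecidableEq V]
    (hfin : ∀ v, {u | ({v, u} : Finset V) ∈ X.faces}.Finite)
    {L : Set X.realization} (hL : IsCompact L) :
    ∃ T : Finset V, ∀ f ∈ L, ∀ v, f.1 v ≠ 0 → v ∈ T := by
  obtain ⟨t, ht⟩ := hL.elim_finite_subcover (fun v : V => {f : X.realization | 0 < f.1 v})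
    isOpen_pos fun f _ => by
      obtain ⟨v, hv⟩ := exists_pos f.2
      exact Set.mem_iUnion.2 ⟨v, hv⟩
  refine ⟨t.biUnion fun v => (hfin v).toFinset, fun f hf u hu => ?_⟩
  obtain ⟨v, hv, hfv⟩ := Set.mem_iUnion₂.1 (ht hf)
  rw [Finset.mem_biUnion]
  refine ⟨v, hv, (Set.Finite.mem_toFinset _).2 ?_⟩
  obtain ⟨σ, hσ, h, -⟩ := exists_support f.2
  refine X.down_closed σ hσ _ ?_ (Finset.insert_nonempty _ _)
  rw [Finset.insert_subset_iff, Finset.singleton_subset_iff]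
  exact ⟨(h v).2 (ne_of_gt hfv), (h u).2 hu⟩

theorem isCompact_supported (S : Finset V) :
    IsCompact {f : X.realization | ∀ v, f.1 v ≠ 0 → v ∈ S} := by
  classical
  rw [Subtype.isCompact_iff]
  have key : (Subtype.val '' {f : X.realization | ∀ v, f.1 v ≠ 0 → v ∈ S}) =
      ⋃ σ ∈ {σ ∈ S.powerset | σ ∈ X.faces}, Set.univ.pi (fun _ => Set.Icc (0 : ℝ) 1) ∩
        ({f : V → ℝ | ∀ v, v ∉ σ → f v = 0} ∩ {f : V → ℝ | ∑ v ∈ σ, f v = 1}) := by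
    ext f
    simp only [Set.mem_image, Set.mem_iUnion, Finset.mem_filter, Finset.mem_powerset]
    constructor
    · rintro ⟨f, hf, rfl⟩
      obtain ⟨σ, hσ, h, h1⟩ := exists_support f.2
      have h0 : ∀ v, v ∉ σ → f.1 v = 0 := fun v hv => by
        by_contra h'
        exact hv ((h v).2 h')
      refine ⟨σ, ⟨fun v hv => hf v ((h v).1 hv), hσ⟩, fun v _ => ⟨f.2.1 v, ?_⟩, h0, h1⟩
      by_cases hv : v ∈ σ
      · rw [← h1]
        exact Finset.single_le_sum (f := f.1) (fun i _ => f.2.1 i) hv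
      · rw [h0 v hv]
        exact zero_le_one
    · rintro ⟨σ, ⟨hS, hσ⟩, hf, h0, h1⟩
      refine ⟨⟨f, fun v => (hf v trivial).1, σ, hσ, h0, h1⟩, fun v hv => hS ?_, rfl⟩
      by_contra h'
      exact hv (h0 v h')
  rw [key]
  refine Finset.isCompact_biUnion _ fun σ _ => ?_
  refine (isCompact_univ_pi fun _ => isCompact_Icc).inter_right (IsClosed.inter ?_ ?_)
  · simp only [Set.ofPred_forall]
    exact isClosed_iInter fun v => isClosed_iInter fun _ =>
      isClosed_eq (continuous_apply v) continuous_const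
  · exact isClosed_eq (continuous_finsetSum _ fun v _ => continuous_apply v) continuous_const

/-- Barycentric coordinates renormalized after removing the vertices of `S`. -/
noncomputable def removeVertices [DecidableEq V] (S : Finset V) (f : V → ℝ) (v : V) : ℝ :=
  if v ∈ S then 0 else f v / (1 - ∑ u ∈ S, f u)

theorem sum_lt_one {f : V → ℝ} (hf : f ∈ X.realization) {S : Finset V}
    (h : ¬ ∀ v, f v ≠ 0 → v ∈ S) : ∑ v ∈ S, f v < 1 := by
  classical
  push Not at h
  obtain ⟨x, hx, hxS⟩ := h
  obtain ⟨σ, hσ, hs, h1⟩ := exists_support hf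
  have h2 : ∑ v ∈ S, f v = ∑ v ∈ S ∩ σ, f v := by
    refine (Finset.sum_subset Finset.inter_subset_left fun v hv hv' => ?_).symm
    by_contra h'
    exact hv' (Finset.mem_inter.2 ⟨hv, (hs v).2 h'⟩)
  rw [h2, ← h1]
  refine Finset.sum_lt_sum_of_subset Finset.inter_subset_right ((hs x).2 hx)
    (fun h' => hxS (Finset.mem_inter.1 h').1) (lt_of_le_of_ne (hf.1 x) hx.symm) fun v _ _ => hf.1 v

theorem removeVertices_mem [DecidableEq V] {f : V → ℝ} (hf : f ∈ X.realization) {S : Finset V}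
    (h : ¬ ∀ v, f v ≠ 0 → v ∈ S) :
    removeVertices S f ∈ (X.restrict (↑S)ᶜ).realization := by
  have hlt := sub_pos.2 (sum_lt_one hf h)
  obtain ⟨σ, hσ, hs, h1⟩ := exists_support hf
  have hne : ∀ v, removeVertices S f v ≠ 0 → v ∈ σ ∧ v ∉ S := by
    intro v hv
    unfold removeVertices at hv
    split_ifs at hv with hvS
    · exact (hv rfl).elim
    · exact ⟨(hs v).2 (div_ne_zero_iff.1 hv).1, hvS⟩
  refine mem_realization_of_support (σ := σ) (fun v => ?_) (fun v hv => (hne v hv).1) ?_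
    fun τ hτ hτne => ⟨X.down_closed σ hσ τ (fun v hv => (hne v ((hτ v).1 hv)).1) hτne,
      fun v hv => (hne v ((hτ v).1 hv)).2⟩
  · unfold removeVertices
    split_ifs
    · exact le_rfl
    · exact div_nonneg (hf.1 v) hlt.le
  · have h3 : ∀ v ∈ σ, removeVertices S f v = (if v ∈ S then 0 else f v) / (1 - ∑ u ∈ S, f u) := by
      intro v _
      unfold removeVertices
      split_ifs <;> simp
    rw [Finset.sum_congr rfl h3, ← Finset.sum_div, div_eq_one_iff_eq hlt.ne', ← h1,
      eq_sub_iff_add_eq]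
    have h4 : ∑ u ∈ S, f u = ∑ v ∈ σ, if v ∈ S then f v else 0 := by
      rw [← Finset.sum_filter]
      refine (Finset.sum_subset (fun v hv => (Finset.mem_filter.1 hv).2) fun v hv hv' => ?_).symm
      by_contra h'
      exact hv' (Finset.mem_filter.2 ⟨(hs v).2 h', hv⟩)
    rw [h4, ← Finset.sum_add_distrib]
    refine Finset.sum_congr rfl fun v _ => ?_
    split_ifs <;> simp

theorem removeVertices_of_notMem [DecidableEq V] {f : V → ℝ} {S : Finset V}
    (h : ∀ v ∈ S, f v = 0) : removeVertices S f = f := by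
  funext v
  unfold removeVertices
  split_ifs with hv
  · exact (h v hv).symm
  · rw [Finset.sum_eq_zero h, sub_zero, div_one]

theorem continuous_removeVertices [DecidableEq V] (S : Finset V) {A : Type*} [TopologicalSpace A]
    {F : A → V → ℝ} (hF : Continuous F) (h : ∀ a, ∑ v ∈ S, F a v ≠ 1) :
    Continuous fun a => removeVertices S (F a) := by
  refine continuous_pi fun v => ?_
  unfold removeVertices
  split_ifs
  · exact continuous_const
  · have h1 : ∀ v, Continuous fun a => F a v := fun v => (continuous_apply v).comp hF
    exact (h1 v).div (continuous_const.sub (continuous_finsetSum _ fun u _ => h1 u))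
      fun a => sub_ne_zero.2 (h a).symm

theorem segment_mem [DecidableEq V] {v w : V} (hne : v ≠ w) (h : ({v, w} : Finset V) ∈ X.faces)
    (t : unitInterval) : (fun x => (1 - (t : ℝ)) * vtx v x + t * vtx w x) ∈ X.realization := by
  refine ⟨fun x => ?_, {v, w}, h, fun x hx => ?_, ?_⟩
  · have h1 : ∀ y : V, 0 ≤ vtx y x := fun y => by
      unfold vtx
      split_ifs
      · exact zero_le_one
      · exact le_rfl
    exact add_nonneg (mul_nonneg (sub_nonneg.2 t.2.2) (h1 v)) (mul_nonneg t.2.1 (h1 w))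
  · rw [Finset.mem_insert, Finset.mem_singleton, not_or] at hx
    simp only [vtx_of_ne hx.1, vtx_of_ne hx.2, mul_zero, add_zero]
  · rw [Finset.sum_pair hne, vtx_self, vtx_self, vtx_of_ne hne, vtx_of_ne hne.symm]
    ring

/-- The path along an edge. -/
noncomputable def edgePath [DecidableEq V] {v w : V} (hne : v ≠ w)
    (h : ({v, w} : Finset V) ∈ X.faces) (hv : vtx v ∈ X.realization) (hw : vtx w ∈ X.realization) :
    Path (⟨vtx v, hv⟩ : X.realization) ⟨vtx w, hw⟩ where
  toFun t := ⟨_, segment_mem hne h t⟩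
  continuous_toFun := by
    refine Continuous.subtype_mk (continuous_pi fun x => ?_) _
    fun_prop
  source' := Subtype.ext (funext fun x => by simp)
  target' := Subtype.ext (funext fun x => by simp)

end SComplex

theorem IsCover.push_segment {V W : Type u} [DecidableEq V] {Y : SComplex V} {A : SimpleGraph W}
    {p : W → V} (hp : IsCover Y A p) {x y : W} (hxy : A.Adj x y) (t : unitInterval) :
    push p (fun z => (1 - (t : ℝ)) * SComplex.vtx x z + t * SComplex.vtx y z) =
      fun v => (1 - (t : ℝ)) * SComplex.vtx (p x) v + t * SComplex.vtx (p y) v := by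
  classical
  have hm : (fun z => (1 - (t : ℝ)) * SComplex.vtx x z + t * SComplex.vtx y z) ∈
      (SComplex.cliqueComplex A).realization :=
    SComplex.segment_mem (X := SComplex.cliqueComplex A) hxy.ne ⟨⟨x, by simp⟩, by
      simp only [Finset.coe_insert, Finset.coe_singleton]
      rw [SimpleGraph.isClique_pair]
      exact fun _ => hxy⟩ t
  have hpne := hp.adj_map hxy
  have hex : ∃ z, (z = x ∨ z = y) ∧
      (1 - (t : ℝ)) * SComplex.vtx x z + t * SComplex.vtx y z ≠ 0 := by
    by_cases ht : (t : ℝ) = 0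
    · refine ⟨x, Or.inl rfl, ?_⟩
      rw [SComplex.vtx_self, ht]
      simp
    · refine ⟨y, Or.inr rfl, ?_⟩
      rw [SComplex.vtx_self, SComplex.vtx_of_ne hxy.ne.symm]
      simpa using ht
  obtain ⟨z, hz, hz0⟩ := hex
  have hzx : z = x ∨ A.Adj z x := hz.imp_right fun e : z = y => e ▸ hxy.symm
  have hzy : z = y ∨ A.Adj z y := hz.symm.imp_right fun e : z = x => e ▸ hxy
  funext v
  by_cases h1 : v = p x
  · rw [h1, hp.push_eq hm hz0 hzx, SComplex.vtx_self, SComplex.vtx_self,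
      SComplex.vtx_of_ne hxy.ne, SComplex.vtx_of_ne hpne]
  by_cases h2 : v = p y
  · rw [h2, hp.push_eq hm hz0 hzy, SComplex.vtx_self, SComplex.vtx_self,
      SComplex.vtx_of_ne hxy.ne.symm, SComplex.vtx_of_ne hpne.symm]
  rw [SComplex.vtx_of_ne h1, SComplex.vtx_of_ne h2, mul_zero, mul_zero, add_zero]
  refine push_eq_zero fun u hu => ?_
  rw [SComplex.vtx_of_ne, SComplex.vtx_of_ne, mul_zero, mul_zero, add_zero]
  · rintro rfl
    exact h2 hu.symm
  · rintro rfl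
    exact h1 hu.symm

namespace SComplex

variable {V : Type u} [DecidableEq V] {X : SComplex V}

theorem exists_cover_with_section (hX : X.LocallyKLarge 6)
    (hfin : ∀ v, {u | ({v, u} : Finset V) ∈ X.faces}.Finite)
    (hinf : {v | ({v} : Finset V) ∈ X.faces}.Infinite)
    (h0 : ConnInfty X.realization 0) (h1 : ConnInfty X.realization 1) (S : Finset V) :
    ∃ (T : Finset V) (W : Type u) (A : SimpleGraph W) (l : W → ℕ) (o : W) (p : W → V) (s : V → W),
      IsLeveled A l o ∧ IsCover (X.restrict (↑S)ᶜ) A p ∧ S ⊆ T ∧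
      ∀ σ ∈ (X.restrict (↑T)ᶜ).faces, (∀ v ∈ σ, p (s v) = v) ∧
        ∀ v ∈ σ, ∀ w ∈ σ, v ≠ w → A.Adj (s v) (s w) := by
  classical
  set K : Set X.realization := {f | ∀ v, f.1 v ≠ 0 → v ∈ S}
  obtain ⟨L₀, hL₀, -, H₀⟩ := h0.joinedIn (isCompact_supported (X := X) S)
  obtain ⟨L₁, hL₁, hKL₁, H₁⟩ := h1.loop_homotopic (isCompact_supported (X := X) S)
  obtain ⟨T₀, hT₀⟩ := exists_finite_support hfin hL₀
  obtain ⟨T₁, hT₁⟩ := exists_finite_support hfin hL₁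
  let T := S ∪ (T₀ ∪ T₁)
  have hST : S ⊆ T := Finset.subset_union_left
  obtain ⟨y₀, hy₀, hy₀T⟩ := hinf.exists_notMem_finset T
  have hy₀S : ({y₀} : Finset V) ∈ (X.restrict (↑S)ᶜ).faces :=
    ⟨hy₀, fun v hv hvS => hy₀T (hST ((Finset.mem_singleton.1 hv) ▸ hvS))⟩
  obtain ⟨W, A, l, o, p, hA, hp, hpo⟩ := exists_isCover (hX.restrict (↑S)ᶜ) hy₀S
  let Y := X.restrict (↑S : Set V)ᶜ
  let Z := X.restrict (↑T : Set V)ᶜ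
  have hZY : Z.faces ⊆ Y.faces := fun σ hσ => ⟨hσ.1, fun v hv hvS => hσ.2 v hv (hST hvS)⟩
  have hZX : Z.faces ⊆ X.faces := fun σ hσ => hσ.1
  -- points of `Z` avoid sets supported in `T`
  have hZT : ∀ (z : Z.realization), ∃ v, z.1 v ≠ 0 ∧ v ∉ T := by
    intro z
    obtain ⟨v, hv⟩ := exists_pos z.2
    obtain ⟨σ, hσ, h, -⟩ := exists_support z.2
    exact ⟨v, hv.ne', hσ.2 v ((h v).2 hv.ne')⟩
  have hZS : ∀ (z : Z.realization), ∀ v ∈ S, z.1 v = 0 := by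
    intro z v hv
    by_contra h'
    obtain ⟨σ, hσ, h, -⟩ := exists_support z.2
    exact hσ.2 v ((h v).2 h') (hST hv)
  let ι (z : Z.realization) : X.realization := ⟨z.1, realization_mono hZX z.2⟩
  have hι : Continuous ι := continuous_subtype_val.subtype_mk _
  have hι₀ : ∀ z, ι z ∉ L₀ := by
    intro z hz
    obtain ⟨v, hv, hvT⟩ := hZT z
    exact hvT (Finset.mem_union_right _ (Finset.mem_union_left _ (hT₀ _ hz v hv)))
  have hι₁ : ∀ z, ι z ∉ L₁ := by
    intro z hz
    obtain ⟨v, hv, hvT⟩ := hZT z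
    exact hvT (Finset.mem_union_right _ (Finset.mem_union_right _ (hT₁ _ hz v hv)))
  let j : C(Z.realization, (L₁ᶜ : Set X.realization)) := ⟨fun z => ⟨ι z, hι₁ z⟩, hι.subtype_mk _⟩
  let i : C(Z.realization, Y.realization) :=
    ⟨fun z => ⟨z.1, realization_mono hZY z.2⟩, continuous_subtype_val.subtype_mk _⟩
  let ρ : C((Kᶜ : Set X.realization), Y.realization) :=
    ⟨fun f => ⟨removeVertices S f.1.1, removeVertices_mem f.1.2 f.2⟩,
      (continuous_removeVertices S (continuous_subtype_val.comp continuous_subtype_val)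
        fun f => (sum_lt_one f.1.2 f.2).ne).subtype_mk _⟩
  have hρ : ∀ (f : (Kᶜ : Set X.realization)) (z : Z.realization), f.1.1 = z.1 → ρ f = i z := by
    intro f z e
    apply Subtype.ext
    change removeVertices S f.1.1 = z.1
    rw [e, removeVertices_of_notMem (hZS z)]
  have hoT : ({y₀} : Finset V) ∈ Z.faces :=
    ⟨hy₀, fun v hv hvS => hy₀T ((Finset.mem_singleton.1 hv) ▸ hvS)⟩
  have hvW : ∀ w, vtx w ∈ (cliqueComplex A).realization := fun w =>
    vtx_mem ⟨⟨w, by simp⟩, by simp⟩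
  let e₀ : (cliqueComplex A).realization := ⟨vtx o, hvW o⟩
  have he₀ : hp.map e₀ = i ⟨vtx y₀, vtx_mem hoT⟩ := by
    apply Subtype.ext
    change IsCover.push p (vtx o) = vtx y₀
    rw [hp.push_vtx, hpo]
  obtain ⟨s', hs', hs''⟩ := hp.isCoveringMap.exists_section i e₀ (fun z => by
    rw [he₀]
    obtain ⟨γ, hγ⟩ := H₀ _ (hι₀ ⟨vtx y₀, vtx_mem hoT⟩) _ (hι₀ z)
    refine ⟨⟨⟨fun t => ρ ⟨γ t, hγ t⟩, ρ.continuous.comp (γ.continuous.subtype_mk _)⟩, ?_, ?_⟩⟩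
    · exact hρ _ _ (congrArg Subtype.val γ.source)
    · exact hρ _ _ (congrArg Subtype.val γ.target)) fun z γ => by
    have hsub : L₁ᶜ ⊆ Kᶜ := Set.compl_subset_compl.2 hKL₁
    have h2 := (H₁ hsub (j z) (γ.map j.continuous)).map ρ
    have e1 : i z = ρ (Set.inclusion hsub (j z)) := (hρ _ _ rfl).symm
    have e2 : γ.map i.continuous =
        (((γ.map j.continuous).map (continuous_inclusion hsub)).map ρ.continuous).cast e1 e1 := by
      refine Path.ext (funext fun t => ?_)
      exact (hρ (Set.inclusion hsub (j (γ t))) (γ t) rfl).symm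
    have e3 : Path.refl (i z) =
        ((Path.refl (Set.inclusion hsub (j z))).map ρ.continuous).cast e1 e1 := by
      exact Path.ext (funext fun _ => e1)
    rw [e2, e3]
    exact h2.pathCast e1 e1
  have hex : ∀ v, ∃ w, ∀ hv : ({v} : Finset V) ∈ Z.faces,
      p w = v ∧ (s' ⟨vtx v, vtx_mem hv⟩) = ⟨vtx w, hvW w⟩ := by
    intro v
    by_cases hv : ({v} : Finset V) ∈ Z.faces
    · obtain ⟨w, hw, hw'⟩ := hp.eq_vtx_of_push (s' ⟨vtx v, vtx_mem hv⟩).2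
        (congrArg Subtype.val (hs' ⟨vtx v, vtx_mem hv⟩))
      exact ⟨w, fun _ => ⟨hw, Subtype.ext hw'⟩⟩
    · exact ⟨o, fun h' => (hv h').elim⟩
  choose s hs using hex
  refine ⟨T, W, A, l, o, p, s, hA, hp, hST, fun σ hσ => ⟨fun v hv => (hs v (vertex_mem hσ hv)).1,
    fun v hv w hw hvw => ?_⟩⟩
  have hvZ := vertex_mem hσ hv
  have hwZ := vertex_mem hσ hw
  obtain ⟨hv1, hv2⟩ := hs v hvZ
  obtain ⟨hw1, hw2⟩ := hs w hwZ
  have hvwZ : ({v, w} : Finset V) ∈ Z.faces := Z.down_closed σ hσ _ (by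
    rw [Finset.insert_subset_iff, Finset.singleton_subset_iff]
    exact ⟨hv, hw⟩) (Finset.insert_nonempty _ _)
  obtain ⟨τ, hτ, hsτ, hτp⟩ := hp.face_lift (x := s v) (hZY hvwZ) (by simp [hv1])
  obtain ⟨x, hx, hxw⟩ : ∃ x ∈ τ, p x = w := Finset.mem_image.1 (by rw [hτp]; simp)
  have hadj : A.Adj (s v) x := hτ hsτ hx fun e => hvw (by rw [← hv1, e, hxw])
  have hedge : ({s v, x} : Finset W) ∈ (cliqueComplex A).faces := ⟨Finset.insert_nonempty _ _, by
    simp only [Finset.coe_insert, Finset.coe_singleton]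
    rw [SimpleGraph.isClique_pair]
    exact fun _ => hadj⟩
  have h5 := hs'' ⟨vtx v, vtx_mem hvZ⟩ ⟨vtx w, vtx_mem hwZ⟩ (edgePath hvw hvwZ _ _)
    ⟨vtx x, hvW x⟩ ((edgePath hadj.ne hedge (hvW _) (hvW _)).cast hv2 rfl) fun t => by
      apply Subtype.ext
      refine (hp.push_segment hadj t).trans ?_
      rw [hv1, hxw]
      rfl
  rw [hw2] at h5
  have h6 := congrFun (congrArg Subtype.val h5) x
  change vtx (s w) x = vtx x x at h6
  have h7 : x = s w := by
    by_contra hne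
    rw [vtx_self, vtx_of_ne hne] at h6
    exact zero_ne_one h6
  rw [← h7]
  exact hadj

/-- In a systolic complex which is simply connected at infinity, cocycles with compact support are
coboundaries of cochains with compact support. -/
theorem exists_primitive_supported [SimplyConnectedSpace X.realization] (hX : X.LocallyKLarge 6)
    (hfin : ∀ v, {u | ({v, u} : Finset V) ∈ X.faces}.Finite)
    (hinf : {v | ({v} : Finset V) ∈ X.faces}.Infinite)
    (h0 : ConnInfty X.realization 0) (h1 : ConnInfty X.realization 1) (S : Finset V) :
    ∃ T : Finset V, ∀ c : Finset V → ZMod 2, (∀ σ ∈ X.faces, coboundary c σ = 0) →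
      (∀ σ ∈ X.faces, Disjoint σ S → c σ = 0) →
      ∃ b : Finset V → ZMod 2, b ∅ = 0 ∧ (∀ σ ∈ X.faces, coboundary b σ = c σ) ∧
        ∀ σ ∈ X.faces, Disjoint σ T → b σ = 0 := by
  classical
  obtain ⟨T, W, A, l, o, p, s, hA, hp, hST, hs⟩ := exists_cover_with_section hX hfin hinf h0 h1 S
  obtain ⟨v, hv⟩ := hinf.nonempty
  obtain ⟨W', A', l', o', p', hA', hp', -⟩ := exists_isCover hX hv
  refine ⟨T, fun c hc hcS => ?_⟩
  obtain ⟨b, hb⟩ := hp'.exists_primitive hA' (hp'.contractibleSpace_and_bijective hA' hfin).2 c hc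
  have hcb : ∀ σ ∈ (X.restrict (↑S)ᶜ).faces, coboundary b σ = 0 := by
    rintro σ ⟨hσ, hσS⟩
    rw [← hb σ hσ]
    exact hcS σ hσ (Finset.disjoint_left.2 hσS)
  obtain ⟨hb0, a, ha⟩ := hp.exists_primitive_of_section hA s _ hs b hcb
  let a' (τ : Finset V) : ZMod 2 := if Disjoint τ T then a τ else 0
  refine ⟨fun σ => b σ + coboundary a' σ, ?_, fun σ hσ => ?_, fun σ hσ hσT => ?_⟩
  · simp [hb0, coboundary]
  · rw [coboundary_add, coboundary_coboundary, add_zero, hb σ hσ]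
  · have h2 : coboundary a' σ = coboundary a σ :=
      Finset.sum_congr rfl fun x _ => if_pos (hσT.mono_left (Finset.erase_subset x σ))
    change b σ + coboundary a' σ = 0
    rw [h2, ha σ ⟨hσ, fun v hv => Finset.disjoint_left.1 hσT hv⟩]
    exact CharTwo.add_self_eq_zero _

end SComplex

namespace SComplex

open Pointwise

section
variable {V : Type u} [DecidableEq V] {X : SComplex V} {G : Type} [Group G] [MulAction G V]

theorem IsSimplicialAction.smul_mem (h : X.IsSimplicialAction G) (g : G) {σ : Finset V}
    (hσ : σ ∈ X.faces) : g • σ ∈ X.faces := h g σ hσ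

theorem IsSimplicialAction.smul_mem_iff (h : X.IsSimplicialAction G) (g : G) {σ : Finset V} :
    g • σ ∈ X.faces ↔ σ ∈ X.faces :=
  ⟨fun hσ => by simpa using h.smul_mem g⁻¹ hσ, h.smul_mem g⟩

theorem coboundary_smul (b : Finset V → ZMod 2) (g : G) (σ : Finset V) :
    coboundary b (g • σ) = coboundary (fun τ => b (g • τ)) σ := by
  unfold coboundary
  rw [Finset.smul_finset_def, Finset.sum_image fun x _ y _ e => MulAction.injective g e]
  refine Finset.sum_congr rfl fun x _ => ?_
  congr 1
  rw [Finset.smul_finset_def, Finset.image_erase (MulAction.injective g)]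

theorem HasFiniteStabilizers.finite_transporter (hs : X.HasFiniteStabilizers G) {σ : Finset V}
    (hσ : σ ∈ X.faces) (τ : Finset V) : {g : G | g • σ = τ}.Finite := by
  by_cases h : ∃ k : G, k • σ = τ
  · obtain ⟨k, rfl⟩ := h
    refine ((hs σ hσ).image (k * ·)).subset fun g hg => ⟨k⁻¹ * g, ?_, by simp⟩
    change (k⁻¹ * g) • σ = σ
    rw [mul_smul, (hg : g • σ = k • σ), inv_smul_smul]
  · exact (Set.finite_empty).subset fun g hg => h ⟨g, hg⟩

theorem HasFiniteStabilizers.finite_smul_eq (hs : X.HasFiniteStabilizers G) {v : V}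
    (hv : ({v} : Finset V) ∈ X.faces) (u : V) : {g : G | g • v = u}.Finite := by
  refine (hs.finite_transporter hv {u}).subset fun g hg => ?_
  change g • ({v} : Finset V) = {u}
  rw [Finset.smul_finset_singleton, (hg : g • v = u)]

theorem finite_cofaces (ha : X.IsSimplicialAction G) (hs : X.HasFiniteStabilizers G)
    (hc : X.IsCocompactSAction G) (v : V) : {σ ∈ X.faces | v ∈ σ}.Finite := by
  obtain ⟨S, hS, h⟩ := hc
  have hfin : (⋃ σ ∈ {σ ∈ S | σ ∈ X.faces}, ⋃ w ∈ (σ : Set V), {g : G | g • w = v}).Finite := by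
    refine (hS.subset fun σ hσ => hσ.1).biUnion fun σ hσ => ?_
    exact σ.finite_toSet.biUnion fun w hw => hs.finite_smul_eq (vertex_mem hσ.2 hw) v
  refine ((hS.prod hfin).image fun q : Finset V × G => q.2 • q.1).subset ?_
  rintro _ ⟨hτ, hv⟩
  obtain ⟨σ, hσ, g, rfl⟩ := h _ hτ
  obtain ⟨w, hw, rfl⟩ := Finset.mem_image.1 hv
  refine ⟨(σ, g), ⟨hσ, ?_⟩, rfl⟩
  simp only [Set.mem_iUnion]
  exact ⟨σ, ⟨hσ, (ha.smul_mem_iff g).1 hτ⟩, w, hw, rfl⟩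

theorem finite_neighbors (ha : X.IsSimplicialAction G) (hs : X.HasFiniteStabilizers G)
    (hc : X.IsCocompactSAction G) (v : V) : {u | ({v, u} : Finset V) ∈ X.faces}.Finite := by
  refine ((finite_cofaces ha hs hc v).biUnion fun σ _ => σ.finite_toSet).subset fun u hu => ?_
  exact Set.mem_biUnion (x := {v, u}) ⟨hu, by simp⟩ (by simp)

theorem IsCocompactSAction.exists_card_le (hc : X.IsCocompactSAction G) :
    ∃ N, ∀ σ ∈ X.faces, σ.card ≤ N := by
  obtain ⟨S, hS, h⟩ := hc
  refine ⟨hS.toFinset.sup Finset.card, fun τ hτ => ?_⟩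
  obtain ⟨σ, hσ, g, rfl⟩ := h τ hτ
  exact Finset.card_image_le.trans (Finset.le_sup (f := Finset.card) (hS.mem_toFinset.2 hσ))

end

/-- A relation between simplices and vertices which is invariant and locally finite. -/
structure IsControl {V : Type u} [DecidableEq V] (X : SComplex V) (G : Type) [Group G]
    [MulAction G V] (r : Finset V → V → Prop) : Prop where
  smul : ∀ (g : G) σ u, r σ u → r (g • σ) (g • u)
  finite_right : ∀ σ ∈ X.faces, {u | r σ u}.Finite
  finite_left : ∀ u, {σ ∈ X.faces | r σ u}.Finite

section
variable {V : Type u} [DecidableEq V] {X : SComplex V} {G : Type} [Group G] [MulAction G V]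

theorem IsControl.or {r r' : Finset V → V → Prop} (h : X.IsControl G r) (h' : X.IsControl G r') :
    X.IsControl G fun σ u => r σ u ∨ r' σ u where
  smul g σ u := Or.imp (h.smul g σ u) (h'.smul g σ u)
  finite_right σ hσ := ((h.finite_right σ hσ).union (h'.finite_right σ hσ)).subset fun _ hu => hu
  finite_left u := ((h.finite_left u).union (h'.finite_left u)).subset fun _ hσ =>
    hσ.2.imp (fun h => ⟨hσ.1, h⟩) fun h => ⟨hσ.1, h⟩

theorem exists_control (ha : X.IsSimplicialAction G) (hs : X.HasFiniteStabilizers G)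
    (hc : X.IsCocompactSAction G)
    (hA : ∀ S : Finset V, ∃ T : Finset V, ∀ c : Finset V → ZMod 2,
      (∀ σ ∈ X.faces, coboundary c σ = 0) → (∀ σ ∈ X.faces, Disjoint σ S → c σ = 0) →
      ∃ b : Finset V → ZMod 2, b ∅ = 0 ∧ (∀ σ ∈ X.faces, coboundary b σ = c σ) ∧
        ∀ σ ∈ X.faces, Disjoint σ T → b σ = 0)
    (r : Finset V → V → Prop) (hr : ∀ (g : G) σ u, r σ u → r (g • σ) (g • u))
    (hrf : ∀ σ ∈ X.faces, {u | r σ u}.Finite) :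
    ∃ r', X.IsControl G r' ∧ ∀ σ ∈ X.faces, ∀ c : Finset V → ZMod 2,
      (∀ ρ ∈ X.faces, coboundary c ρ = 0) → (∀ ρ ∈ X.faces, (∀ u ∈ ρ, ¬ r σ u) → c ρ = 0) →
      ∃ b : Finset V → ZMod 2, b ∅ = 0 ∧ (∀ ρ ∈ X.faces, coboundary b ρ = c ρ) ∧
        ∀ ρ ∈ X.faces, (∀ u ∈ ρ, ¬ r' σ u) → b ρ = 0 := by
  classical
  have hA' : ∀ σ : Finset V, ∃ T : Finset V, σ ∈ X.faces → ∀ c : Finset V → ZMod 2,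
      (∀ ρ ∈ X.faces, coboundary c ρ = 0) → (∀ ρ ∈ X.faces, (∀ u ∈ ρ, ¬ r σ u) → c ρ = 0) →
      ∃ b : Finset V → ZMod 2, b ∅ = 0 ∧ (∀ ρ ∈ X.faces, coboundary b ρ = c ρ) ∧
        ∀ ρ ∈ X.faces, Disjoint ρ T → b ρ = 0 := by
    intro σ
    by_cases hσ : σ ∈ X.faces
    · obtain ⟨T, hT⟩ := hA (hrf σ hσ).toFinset
      refine ⟨T, fun _ c h1 h2 => hT c h1 fun ρ hρ hd => h2 ρ hρ fun u hu hru => ?_⟩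
      exact Finset.disjoint_left.1 hd hu ((hrf σ hσ).mem_toFinset.2 hru)
    · exact ⟨∅, fun h => (hσ h).elim⟩
  choose T hT using hA'
  obtain ⟨S, hS, hSX⟩ := hc
  refine ⟨fun σ u => ∃ g : G, ∃ τ ∈ S, τ ∈ X.faces ∧ g • τ = σ ∧
    ∃ t ∈ T τ, ({t} : Finset V) ∈ X.faces ∧ g • t = u, ⟨?_, ?_, ?_⟩, ?_⟩
  · rintro k _ _ ⟨g, τ, hτS, hτ, rfl, t, ht, htX, rfl⟩
    exact ⟨k * g, τ, hτS, hτ, mul_smul _ _ _, t, ht, htX, mul_smul _ _ _⟩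
  · intro σ hσ
    have : (⋃ τ ∈ {τ ∈ S | τ ∈ X.faces}, ⋃ g ∈ {g : G | g • τ = σ},
        (fun t => g • t) '' (T τ : Set V)).Finite :=
      (hS.subset fun τ hτ => hτ.1).biUnion fun τ hτ =>
        (hs.finite_transporter hτ.2 σ).biUnion fun g _ => (T τ).finite_toSet.image _
    refine this.subset ?_
    rintro _ ⟨g, τ, hτS, hτ, hg, t, ht, htX, rfl⟩
    simp only [Set.mem_iUnion]
    exact ⟨τ, ⟨hτS, hτ⟩, g, hg, t, ht, rfl⟩
  · intro u
    have : (⋃ τ ∈ S, ⋃ t ∈ ({t | t ∈ T τ ∧ ({t} : Finset V) ∈ X.faces} : Set V),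
        (fun g : G => g • τ) '' {g : G | g • t = u}).Finite :=
      hS.biUnion fun τ _ => ((T τ).finite_toSet.subset fun t ht => ht.1).biUnion fun t ht =>
        (hs.finite_smul_eq ht.2 u).image _
    refine this.subset ?_
    rintro _ ⟨-, g, τ, hτS, hτ, rfl, t, ht, htX, hg⟩
    simp only [Set.mem_iUnion]
    exact ⟨τ, hτS, t, ⟨ht, htX⟩, g, hg, rfl⟩
  · intro σ hσ c h1 h2
    obtain ⟨τ, hτS, g, rfl⟩ := hSX σ hσ
    change g • τ ∈ X.faces at hσ
    have hτ := (ha.smul_mem_iff g).1 hσ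
    obtain ⟨b, hb0, hb1, hb2⟩ := hT τ hτ (fun ρ => c (g • ρ)) (fun ρ hρ => by
      rw [← coboundary_smul]
      exact h1 _ (ha.smul_mem g hρ)) fun ρ hρ hd => h2 _ (ha.smul_mem g hρ) fun u hu hru => by
        obtain ⟨w, hw, rfl⟩ := Finset.mem_image.1 hu
        refine hd w hw ?_
        have := hr g⁻¹ _ _ hru
        rwa [inv_smul_smul, ← Finset.smul_finset_def, inv_smul_smul] at this
    refine ⟨fun ρ => b (g⁻¹ • ρ), by simpa using hb0, fun ρ hρ => ?_, fun ρ hρ hd => ?_⟩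
    · rw [← coboundary_smul, hb1 _ (ha.smul_mem g⁻¹ hρ), smul_inv_smul]
    · refine hb2 _ (ha.smul_mem g⁻¹ hρ) (Finset.disjoint_left.2 fun t ht htT => ?_)
      obtain ⟨u, hu, rfl⟩ := Finset.mem_image.1 ht
      exact hd u hu ⟨g, τ, hτS, hτ, rfl, _, htT,
        vertex_mem (ha.smul_mem g⁻¹ hρ) ht, smul_inv_smul g u⟩

end

end SComplex

namespace SComplex

open Pointwise

section
variable {V : Type u} {X : SComplex V}

theorem exists_cofaces (hf : ∀ v, {σ ∈ X.faces | v ∈ σ}.Finite) :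
    ∃ cof : Finset V → Finset (Finset V),
      ∀ σ ∈ X.faces, ∀ τ, τ ∈ cof σ ↔ τ ∈ X.faces ∧ σ ⊆ τ ∧ τ.card = σ.card + 1 := by
  have : ∀ σ : Finset V, ∃ C : Finset (Finset V), σ ∈ X.faces →
      ∀ τ, τ ∈ C ↔ τ ∈ X.faces ∧ σ ⊆ τ ∧ τ.card = σ.card + 1 := by
    intro σ
    by_cases hσ : σ ∈ X.faces
    · obtain ⟨v, hv⟩ := X.nonempty_of_mem σ hσ
      have hfin : {τ | τ ∈ X.faces ∧ σ ⊆ τ ∧ τ.card = σ.card + 1}.Finite :=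
        (hf v).subset fun τ hτ => ⟨hτ.1, hτ.2.1 hv⟩
      exact ⟨hfin.toFinset, fun _ τ => hfin.mem_toFinset⟩
    · exact ⟨∅, fun h => (hσ h).elim⟩
  choose C hC using this
  exact ⟨C, hC⟩

end

section
variable {V : Type u} [DecidableEq V] {X : SComplex V}

theorem sum_pairs_eq_zero {cof : Finset V → Finset (Finset V)}
    (hcof : ∀ σ ∈ X.faces, ∀ τ, τ ∈ cof σ ↔ τ ∈ X.faces ∧ σ ⊆ τ ∧ τ.card = σ.card + 1)
    {σ : Finset V} (hσ : σ ∈ X.faces) (f : Finset V → ZMod 2) :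
    ∑ τ ∈ cof σ, ∑ κ ∈ cof τ, f κ = 0 := by
  rw [Finset.sum_sigma']
  have key : ∀ a : Σ _ : Finset V, Finset V, a ∈ (cof σ).sigma cof →
      a.1 ∈ X.faces ∧ σ ⊆ a.1 ∧ a.1.card = σ.card + 1 ∧
      a.2 ∈ X.faces ∧ a.1 ⊆ a.2 ∧ a.2.card = a.1.card + 1 := by
    rintro ⟨τ, κ⟩ h
    obtain ⟨h1, h2⟩ := Finset.mem_sigma.1 h
    obtain ⟨hτ, h3, h4⟩ := (hcof σ hσ τ).1 h1
    obtain ⟨hκ, h5, h6⟩ := (hcof τ hτ κ).1 h2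
    exact ⟨hτ, h3, h4, hκ, h5, h6⟩
  refine Finset.sum_involution (fun a _ => ⟨σ ∪ (a.2 \ a.1), a.2⟩)
    (fun a _ => CharTwo.add_self_eq_zero _) ?_ ?_ ?_
  · rintro ⟨τ, κ⟩ h - e
    obtain ⟨hτ, h1, h2, hκ, h3, h4⟩ := key _ h
    have e1 : σ ∪ (κ \ τ) = τ := congrArg Sigma.fst e
    have : κ ⊆ τ := fun x hx => by
      by_contra hn
      exact hn (e1 ▸ Finset.mem_union_right _ (Finset.mem_sdiff.2 ⟨hx, hn⟩))
    have := Finset.card_le_card this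
    simp only at h4
    lia
  · rintro ⟨τ, κ⟩ h
    obtain ⟨hτ, h1, h2, hκ, h3, h4⟩ := key _ h
    simp only at hτ h1 h2 hκ h3 h4 ⊢
    have hsub : σ ∪ (κ \ τ) ⊆ κ := Finset.union_subset (h1.trans h3) Finset.sdiff_subset
    have hcard : (σ ∪ (κ \ τ)).card = σ.card + 1 := by
      rw [Finset.card_union_of_disjoint, Finset.card_sdiff_of_subset h3]
      · lia
      · exact Finset.disjoint_left.2 fun x hx hx' => (Finset.mem_sdiff.1 hx').2 (h1 hx)
    have hf : σ ∪ (κ \ τ) ∈ X.faces :=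
      X.down_closed κ hκ _ hsub ((X.nonempty_of_mem σ hσ).mono Finset.subset_union_left)
    exact Finset.mem_sigma.2 ⟨(hcof σ hσ _).2 ⟨hf, Finset.subset_union_left, hcard⟩,
      (hcof _ hf _).2 ⟨hκ, hsub, by simp only; lia⟩⟩
  · rintro ⟨τ, κ⟩ h
    obtain ⟨hτ, h1, h2, hκ, h3, h4⟩ := key _ h
    simp only at h1 h3 ⊢
    congr 1
    ext x
    have := @h1 x
    have := @h3 x
    simp only [Finset.mem_union, Finset.mem_sdiff]
    tauto

theorem coboundary_indicator {cof : Finset V → Finset (Finset V)}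
    (hcof : ∀ σ ∈ X.faces, ∀ τ, τ ∈ cof σ ↔ τ ∈ X.faces ∧ σ ⊆ τ ∧ τ.card = σ.card + 1)
    {σ : Finset V} (hσ : σ ∈ X.faces) {ρ : Finset V} (hρ : ρ ∈ X.faces) :
    coboundary (fun τ => if τ = σ then (1 : ZMod 2) else 0) ρ =
      if ρ ∈ cof σ then 1 else 0 := by
  simp only [coboundary]
  split_ifs with h
  · obtain ⟨-, h1, h2⟩ := (hcof σ hσ ρ).1 h
    obtain ⟨x, hx⟩ := Finset.card_eq_one.1
      (show (ρ \ σ).card = 1 by rw [Finset.card_sdiff_of_subset h1]; lia)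
    have hxm : x ∈ ρ \ σ := by simp [hx]
    have hxm' := Finset.mem_sdiff.1 hxm
    rw [Finset.sum_eq_single_of_mem x hxm'.1, if_pos]
    · exact (Finset.eq_of_subset_of_card_le
        (fun y hy => Finset.mem_erase.2 ⟨ne_of_mem_of_not_mem hy hxm'.2, h1 hy⟩)
        (by rw [Finset.card_erase_of_mem hxm'.1]; lia)).symm
    · intro y hy hne
      refine if_neg fun e => hxm'.2 ?_
      rw [← e]
      exact Finset.mem_erase.2 ⟨hne.symm, hxm'.1⟩
  · refine Finset.sum_eq_zero fun x hx => if_neg fun e => h ?_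
    refine (hcof σ hσ ρ).2 ⟨hρ, e ▸ Finset.erase_subset _ _, ?_⟩
    rw [← e, Finset.card_erase_of_mem hx]
    have := Finset.card_pos.2 ⟨x, hx⟩
    lia

theorem coboundary_sum {ι : Type*} (s : Finset ι) (f : ι → Finset V → ZMod 2) (ρ : Finset V) :
    coboundary (fun τ => ∑ i ∈ s, f i τ) ρ = ∑ i ∈ s, coboundary (f i) ρ :=
  Finset.sum_comm

end

section
variable {V : Type u} [DecidableEq V] {X : SComplex V} {G : Type} [Group G] [MulAction G V]

theorem exists_homotopy (ha : X.IsSimplicialAction G) (hs : X.HasFiniteStabilizers G)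
    (hc : X.IsCocompactSAction G)
    (hA : ∀ S : Finset V, ∃ T : Finset V, ∀ c : Finset V → ZMod 2,
      (∀ σ ∈ X.faces, coboundary c σ = 0) → (∀ σ ∈ X.faces, Disjoint σ S → c σ = 0) →
      ∃ b : Finset V → ZMod 2, b ∅ = 0 ∧ (∀ σ ∈ X.faces, coboundary b σ = c σ) ∧
        ∀ σ ∈ X.faces, Disjoint σ T → b σ = 0)
    {cof : Finset V → Finset (Finset V)}
    (hcof : ∀ σ ∈ X.faces, ∀ τ, τ ∈ cof σ ↔ τ ∈ X.faces ∧ σ ⊆ τ ∧ τ.card = σ.card + 1)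
    {N : ℕ} (hN : ∀ σ ∈ X.faces, σ.card ≤ N) (m : ℕ) :
    ∃ (h : Finset V → Finset V → ZMod 2) (r : Finset V → V → Prop), X.IsControl G r ∧
      ∀ σ ∈ X.faces, N < σ.card + m → h σ ∅ = 0 ∧
        (∀ ρ ∈ X.faces, coboundary (h σ) ρ =
          (if ρ = σ then 1 else 0) + ∑ τ ∈ cof σ, h τ ρ) ∧
        ∀ ρ ∈ X.faces, (∀ u ∈ ρ, ¬ r σ u) → h σ ρ = 0 := by
  induction m with
  | zero =>
    refine ⟨0, fun _ _ => False, ⟨fun _ _ _ h => h, fun _ _ => by simp, fun _ => by simp⟩, ?_⟩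
    intro σ hσ hlt
    exact absurd (hN σ hσ) (by simpa using hlt)
  | succ m ih =>
    obtain ⟨h, r, hr, H⟩ := ih
    obtain ⟨r', hr', H'⟩ := exists_control ha hs hc hA
      (fun σ u => u ∈ σ ∨ ∃ τ ∈ X.faces, σ ⊆ τ ∧ r τ u)
      (by
        rintro g σ u (hu | ⟨τ, hτ, hστ, hu⟩)
        · exact .inl (Finset.smul_mem_smul_finset hu)
        · exact .inr ⟨g • τ, ha.smul_mem g hτ, Finset.smul_finset_subset_smul_finset hστ,
            hr.smul g τ u hu⟩)
      (by
        intro σ hσ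
        obtain ⟨v, hv⟩ := X.nonempty_of_mem σ hσ
        refine (σ.finite_toSet.union ((finite_cofaces ha hs hc v).biUnion fun τ hτ =>
          hr.finite_right τ hτ.1)).subset ?_
        rintro u (hu | ⟨τ, hτ, hστ, hu⟩)
        · exact .inl hu
        · exact .inr (Set.mem_biUnion (x := τ) ⟨hτ, hστ hv⟩ hu))
    have hex : ∀ σ : Finset V, ∃ b : Finset V → ZMod 2, σ ∈ X.faces → σ.card + m = N →
        b ∅ = 0 ∧ (∀ ρ ∈ X.faces, coboundary b ρ =
          (if ρ = σ then 1 else 0) + ∑ τ ∈ cof σ, h τ ρ) ∧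
        ∀ ρ ∈ X.faces, (∀ u ∈ ρ, ¬ r' σ u) → b ρ = 0 := by
      intro σ
      by_cases hσ : σ ∈ X.faces ∧ σ.card + m = N
      · have hτ : ∀ τ ∈ cof σ, τ ∈ X.faces ∧ σ ⊆ τ ∧ N < τ.card + m := fun τ hτ => by
          obtain ⟨h1, h2, h3⟩ := (hcof σ hσ.1 τ).1 hτ
          exact ⟨h1, h2, by lia⟩
        obtain ⟨b, hb⟩ := H' σ hσ.1
          (fun ρ => (if ρ = σ then 1 else 0) + ∑ τ ∈ cof σ, h τ ρ)
          (by
            intro ρ hρ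
            rw [coboundary_add, coboundary_indicator hcof hσ.1 hρ, coboundary_sum,
              Finset.sum_congr rfl fun τ hτ' =>
                (H τ (hτ τ hτ').1 (hτ τ hτ').2.2).2.1 ρ hρ,
              Finset.sum_add_distrib, sum_pairs_eq_zero hcof hσ.1 fun κ => h κ ρ,
              Finset.sum_ite_eq, add_zero]
            exact CharTwo.add_self_eq_zero _)
          (by
            intro ρ hρ hn
            rw [if_neg, zero_add]
            · refine Finset.sum_eq_zero fun τ hτ' => ?_
              obtain ⟨h1, h2, h3⟩ := hτ τ hτ'
              exact (H τ h1 h3).2.2 ρ hρ fun u hu hru => hn u hu (.inr ⟨τ, h1, h2, hru⟩)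
            · rintro rfl
              obtain ⟨v, hv⟩ := X.nonempty_of_mem ρ hρ
              exact hn v hv (.inl hv))
        exact ⟨b, fun _ _ => hb⟩
      · exact ⟨0, fun h1 h2 => (hσ ⟨h1, h2⟩).elim⟩
    choose b hb using hex
    refine ⟨fun σ => if N < σ.card + m then h σ else b σ, _, hr.or hr', fun σ hσ hlt => ?_⟩
    have hsum : ∀ ρ, ∑ τ ∈ cof σ, (if N < τ.card + m then h τ else b τ) ρ =
        ∑ τ ∈ cof σ, h τ ρ := fun ρ => Finset.sum_congr rfl fun τ hτ => by
      obtain ⟨-, -, h3⟩ := (hcof σ hσ τ).1 hτ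
      rw [if_pos (by lia)]
    simp only [hsum]
    by_cases hlt' : N < σ.card + m
    · simp only [if_pos hlt']
      obtain ⟨h1, h2, h3⟩ := H σ hσ hlt'
      exact ⟨h1, h2, fun ρ hρ hn => h3 ρ hρ fun u hu hru => hn u hu (.inl hru)⟩
    · simp only [if_neg hlt']
      obtain ⟨h1, h2, h3⟩ := hb σ hσ (by lia)
      exact ⟨h1, h2, fun ρ hρ hn => h3 ρ hρ fun u hu hru => hn u hu (.inr hru)⟩

theorem not_primitive_supported (ha : X.IsSimplicialAction G) (hs : X.HasFiniteStabilizers G)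
    (hc : X.IsCocompactSAction G) {u : V} (hu : ({u} : Finset V) ∈ X.faces) :
    ¬ ∀ S : Finset V, ∃ T : Finset V, ∀ c : Finset V → ZMod 2,
      (∀ σ ∈ X.faces, coboundary c σ = 0) → (∀ σ ∈ X.faces, Disjoint σ S → c σ = 0) →
      ∃ b : Finset V → ZMod 2, b ∅ = 0 ∧ (∀ σ ∈ X.faces, coboundary b σ = c σ) ∧
        ∀ σ ∈ X.faces, Disjoint σ T → b σ = 0 := by
  intro hA
  obtain ⟨N, hN⟩ := hc.exists_card_le
  obtain ⟨cof, hcof⟩ := X.exists_cofaces (finite_cofaces ha hs hc)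
  obtain ⟨h, r, hr, H⟩ := exists_homotopy ha hs hc hA hcof hN N
  have hpt : ∀ v, ({v} : Finset V) ∈ X.faces →
      (if u = v then (1 : ZMod 2) else 0) = ∑ e ∈ cof {v}, h e {u} := by
    intro v hv
    obtain ⟨h1, h2, -⟩ := H {v} hv (by simp)
    have := h2 {u} hu
    simp only [coboundary, Finset.sum_singleton, Finset.erase_singleton, h1,
      Finset.singleton_inj] at this
    exact CharTwo.add_eq_zero.1 this.symm
  set E := (hr.finite_left u).toFinset.filter fun e => e.card = 2 with hE
  have hEm : ∀ e, e ∈ E ↔ (e ∈ X.faces ∧ r e u) ∧ e.card = 2 := fun e => by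
    rw [hE, Finset.mem_filter, Set.Finite.mem_toFinset]
    rfl
  set T := insert u (E.biUnion id) with hT
  have hTv : ∀ v ∈ T, ({v} : Finset V) ∈ X.faces := by
    intro v hv
    rcases Finset.mem_insert.1 hv with rfl | hv
    · exact hu
    · obtain ⟨e, he, hve⟩ := Finset.mem_biUnion.1 hv
      exact vertex_mem ((hEm e).1 he).1.1 hve
  have h1 : ∑ v ∈ T, (if u = v then (1 : ZMod 2) else 0) = 1 := by
    rw [Finset.sum_ite_eq, if_pos (Finset.mem_insert_self _ _)]
  have h2 : ∀ v ∈ T, (if u = v then (1 : ZMod 2) else 0) =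
      ∑ e ∈ E, if v ∈ e then h e {u} else 0 := by
    intro v hv
    rw [hpt v (hTv v hv), ← Finset.sum_filter]
    refine (Finset.sum_subset ?_ ?_).symm
    · intro e he
      obtain ⟨he, hve⟩ := Finset.mem_filter.1 he
      obtain ⟨⟨h3, -⟩, h4⟩ := (hEm e).1 he
      exact (hcof _ (hTv v hv) e).2 ⟨h3, by simpa using hve, by simpa using h4⟩
    · intro e he hn
      obtain ⟨h3, h4, h5⟩ := (hcof _ (hTv v hv) e).1 he
      rw [Finset.card_singleton] at h5
      refine (H e h3 (by lia)).2.2 {u} hu fun w hw hrw => hn ?_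
      rw [Finset.mem_singleton.1 hw] at hrw
      exact Finset.mem_filter.2 ⟨(hEm e).2 ⟨⟨h3, hrw⟩, h5⟩, by simpa using h4⟩
  rw [Finset.sum_congr rfl h2, Finset.sum_comm, Finset.sum_eq_zero] at h1
  · exact zero_ne_one h1
  · intro e he
    have : T.filter (· ∈ e) = e := by
      ext v
      simp only [Finset.mem_filter, and_iff_right_iff_imp]
      exact fun hv => Finset.mem_insert_of_mem (Finset.mem_biUnion.2 ⟨e, he, hv⟩)
    rw [← Finset.sum_filter, this, Finset.sum_const, ((hEm e).1 he).2, two_nsmul]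
    exact CharTwo.add_self_eq_zero _

end

end SComplex

theorem closure_open_corner (n : ℕ) :
    closure {y : EuclideanSpace ℝ (Fin n) | (∀ i, 0 < y i) ∧ ∑ i, y i < 1} =
      {y | (∀ i, 0 ≤ y i) ∧ ∑ i, y i ≤ 1} := by
  apply subset_antisymm
  · refine closure_minimal (fun y hy => ⟨fun i => (hy.1 i).le, hy.2.le⟩) ?_
    have hs : Continuous fun y : EuclideanSpace ℝ (Fin n) => ∑ i, y i := by fun_prop
    have h0 : IsClosed {y : EuclideanSpace ℝ (Fin n) | ∀ i, 0 ≤ y i} := by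
      simp only [Set.ofPred_forall]
      exact isClosed_iInter fun i => isClosed_le continuous_const
        (EuclideanSpace.proj (𝕜 := ℝ) i).continuous
    exact h0.inter (isClosed_le hs continuous_const)
  · rintro y ⟨hy0, hy1⟩
    set p : EuclideanSpace ℝ (Fin n) := WithLp.toLp 2 fun _ => 1 / (n + 1 : ℝ) with hp
    have hn : (0 : ℝ) < n + 1 := by positivity
    have ht : Filter.Tendsto (fun t : ℝ => (1 - t) • y + t • p) (nhdsWithin 0 (Set.Ioo 0 1))
        (nhds y) := by
      have : Continuous fun t : ℝ => (1 - t) • y + t • p := by fun_prop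
      have h := (this.tendsto 0).mono_left (nhdsWithin_le_nhds (s := Set.Ioo (0 : ℝ) 1))
      simpa using h
    have hne : (nhdsWithin (0 : ℝ) (Set.Ioo 0 1)).NeBot := by
      rw [← mem_closure_iff_nhdsWithin_neBot, closure_Ioo zero_ne_one]
      simp
    refine mem_closure_of_tendsto ht (Filter.eventually_of_mem self_mem_nhdsWithin ?_)
    rintro t ⟨ht0, ht1⟩
    refine ⟨fun i => ?_, ?_⟩
    · simp only [PiLp.add_apply, PiLp.smul_apply, smul_eq_mul, hp]
      have := hy0 i
      have h2 : (0 : ℝ) < 1 / (n + 1) := by positivity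
      have := mul_nonneg (sub_nonneg.2 ht1.le) this
      have := mul_pos ht0 h2
      linarith
    · simp only [PiLp.add_apply, PiLp.smul_apply, smul_eq_mul, hp, Finset.sum_add_distrib,
        ← Finset.mul_sum, Finset.sum_const, Finset.card_univ, Fintype.card_fin, nsmul_eq_mul]
      have h2 : (n : ℝ) * (1 / (n + 1)) < 1 := by
        rw [mul_one_div, div_lt_one hn]
        linarith
      have := mul_le_mul_of_nonneg_left hy1 (sub_nonneg.2 ht1.le)
      have := mul_lt_mul_of_pos_left h2 ht0
      linarith

theorem exists_ball_stdSimplex (n : ℕ) :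
    ∃ β : EuclideanSpace ℝ (Fin n) → Fin (n + 1) → ℝ, Continuous β ∧ Function.Injective β ∧
      β '' Metric.closedBall 0 1 = stdSimplex ℝ (Fin (n + 1)) ∧
      β '' Metric.ball 0 1 = {a | (∀ i, 0 < a i) ∧ ∑ i, a i = 1} := by
  set O := {y : EuclideanSpace ℝ (Fin n) | (∀ i, 0 < y i) ∧ ∑ i, y i < 1} with hO
  have hopen : IsOpen O := by
    have hs : Continuous fun y : EuclideanSpace ℝ (Fin n) => ∑ i, y i := by fun_prop
    have h0 : IsOpen {y : EuclideanSpace ℝ (Fin n) | ∀ i, 0 < y i} := by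
      simp only [Set.ofPred_forall]
      exact isOpen_iInter_of_finite fun i => isOpen_lt continuous_const
        (EuclideanSpace.proj (𝕜 := ℝ) i).continuous
    exact h0.inter (isOpen_lt hs continuous_const)
  have hconv : Convex ℝ O := by
    rintro x ⟨hx, hx'⟩ y ⟨hy, hy'⟩ a b ha hb hab
    refine ⟨fun i => ?_, ?_⟩
    · exact convex_Ioi (0 : ℝ) (hx i) (hy i) ha hb hab
    · have := convex_Iio (1 : ℝ) hx' hy' ha hb hab
      simpa [Finset.sum_add_distrib, ← Finset.mul_sum] using this
  have hne : O.Nonempty := by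
    rw [← closure_nonempty_iff, closure_open_corner]
    exact ⟨0, by simp⟩
  have hbd : Bornology.IsBounded O := by
    refine (((isCompact_stdSimplex ℝ (Fin (n + 1))).image (f := fun a =>
      (WithLp.toLp 2 fun i => a i.succ : EuclideanSpace ℝ (Fin n))) (by fun_prop)).isBounded).subset
          ?_
    rintro y ⟨hy0, hy1⟩
    refine ⟨Fin.cons (1 - ∑ i, y i) y, ⟨fun i => ?_, ?_⟩, ?_⟩
    · refine Fin.cases ?_ (fun i => ?_) i
      · simpa using hy1.le
      · simpa using (hy0 i).le
    · rw [Fin.sum_univ_succ]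
      simp
    · ext i
      simp
  obtain ⟨h, h1, h2, -⟩ := exists_homeomorph_image_interior_closure_frontier_eq_unitBall hconv
    (by rwa [hopen.interior_eq]) hbd
  rw [hopen.interior_eq] at h1
  rw [hO, closure_open_corner] at h2
  have hcons : ∀ a : Fin (n + 1) → ℝ, ∑ i, a i = 1 → (Fin.cons (1 - ∑ i : Fin n, a i.succ)
      (fun i : Fin n => a i.succ) : Fin (n + 1) → ℝ) = a := by
    intro a ha
    rw [Fin.sum_univ_succ] at ha
    ext i
    refine Fin.cases ?_ (fun i => ?_) i
    · simp only [Fin.cons_zero]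
      linarith
    · simp
  refine ⟨fun x => Fin.cons (1 - ∑ i, h.symm x i) (fun i => h.symm x i), ?_, ?_, ?_, ?_⟩
  · refine continuous_pi fun i => Fin.cases ?_ (fun i => ?_) i
    · simp only [Fin.cons_zero]
      fun_prop
    · simp only [Fin.cons_succ]
      fun_prop
  · intro x y hxy
    refine h.symm.injective (PiLp.ext fun i => ?_)
    simpa using congrFun hxy i.succ
  · rw [← h2, Set.image_image]
    simp only [Homeomorph.symm_apply_apply]
    ext a
    constructor
    · rintro ⟨y, ⟨hy0, hy1⟩, rfl⟩
      refine ⟨fun i => ?_, ?_⟩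
      · refine Fin.cases ?_ (fun i => ?_) i
        · simpa using hy1
        · simpa using hy0 i
      · rw [Fin.sum_univ_succ]
        simp
    · rintro ⟨ha0, ha1⟩
      refine ⟨WithLp.toLp 2 fun i => a i.succ, ⟨fun i => ha0 _, ?_⟩, hcons a ha1⟩
      rw [Fin.sum_univ_succ] at ha1
      have := ha0 0
      simp only
      linarith
  · rw [← h1, Set.image_image]
    simp only [Homeomorph.symm_apply_apply]
    ext a
    constructor
    · rintro ⟨y, ⟨hy0, hy1⟩, rfl⟩
      refine ⟨fun i => ?_, ?_⟩
      · refine Fin.cases ?_ (fun i => ?_) i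
        · simpa using hy1
        · simpa using hy0 i
      · rw [Fin.sum_univ_succ]
        simp
    · rintro ⟨ha0, ha1⟩
      refine ⟨WithLp.toLp 2 fun i => a i.succ, ⟨fun i => ha0 _, ?_⟩, hcons a ha1⟩
      rw [Fin.sum_univ_succ] at ha1
      have := ha0 0
      simp only
      linarith

namespace SComplex

section
variable {V : Type u}

/-- A family of nonempty sets totally ordered by inclusion. -/
structure IsNest (C : Finset (Finset V)) : Prop where
  total : ∀ s ∈ C, ∀ t ∈ C, s ⊆ t ∨ t ⊆ s
  nonempty : ∀ s ∈ C, s.Nonempty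

theorem IsNest.subset {C D : Finset (Finset V)} (h : IsNest C) (hD : D ⊆ C) : IsNest D :=
  ⟨fun s hs t ht => h.total s (hD hs) t (hD ht), fun s hs => h.nonempty s (hD hs)⟩

theorem IsNest.eq_of_card_eq {C : Finset (Finset V)} (h : IsNest C) {s t : Finset V} (hs : s ∈ C)
    (ht : t ∈ C) (hst : s.card = t.card) : s = t := by
  rcases h.total s hs t ht with h' | h'
  · exact Finset.eq_of_subset_of_card_le h' hst.ge
  · exact (Finset.eq_of_subset_of_card_le h' hst.le).symm

theorem IsNest.exists_top {C : Finset (Finset V)} (h : IsNest C) (hne : C.Nonempty) :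
    ∃ σ ∈ C, ∀ s ∈ C, s ⊆ σ := by
  obtain ⟨σ, hσ, hmax⟩ := C.exists_max_image Finset.card hne
  refine ⟨σ, hσ, fun s hs => ?_⟩
  rcases h.total s hs σ hσ with h' | h'
  · exact h'
  · exact (Finset.eq_of_subset_of_card_le h' (hmax s hs)).ge

end

section
variable {V : Type u} [DecidableEq V]

/-- The step function with increment `u s` on each set `s` of the family `C`. -/
def stepSum (C : Finset (Finset V)) (u : Finset V → ℝ) (v : V) : ℝ :=
  ∑ s ∈ C, if v ∈ s then u s else 0

theorem stepSum_congr {C : Finset (Finset V)} {u u' : Finset V → ℝ} (h : ∀ s ∈ C, u s = u' s)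
    (v : V) : stepSum C u v = stepSum C u' v :=
  Finset.sum_congr rfl fun s hs => by rw [h s hs]

theorem stepSum_eq_zero {C : Finset (Finset V)} {u : Finset V → ℝ} {v : V}
    (h : ∀ s ∈ C, v ∉ s) : stepSum C u v = 0 :=
  Finset.sum_eq_zero fun s hs => if_neg (h s hs)

theorem stepSum_nonneg {C : Finset (Finset V)} {u : Finset V → ℝ} (h : ∀ s ∈ C, 0 ≤ u s) (v : V) :
    0 ≤ stepSum C u v :=
  Finset.sum_nonneg fun s hs => by
    split_ifs
    exacts [h s hs, le_rfl]

theorem le_stepSum {C : Finset (Finset V)} {u : Finset V → ℝ} (h : ∀ s ∈ C, 0 ≤ u s) {v : V}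
    {s : Finset V} (hs : s ∈ C) (hv : v ∈ s) : u s ≤ stepSum C u v := by
  have := Finset.single_le_sum (f := fun s => if v ∈ s then u s else 0)
    (fun t ht => by
      split_ifs
      exacts [h t ht, le_rfl]) hs
  rw [if_pos hv] at this
  exact this

theorem sum_stepSum {C : Finset (Finset V)} (u : Finset V → ℝ) {σ : Finset V}
    (h : ∀ s ∈ C, s ⊆ σ) : ∑ v ∈ σ, stepSum C u v = ∑ s ∈ C, s.card * u s := by
  unfold stepSum
  rw [Finset.sum_comm]
  refine Finset.sum_congr rfl fun s hs => ?_
  rw [← Finset.sum_filter, Finset.sum_const, nsmul_eq_mul]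
  congr 3
  ext v
  simp only [Finset.mem_filter, and_iff_right_iff_imp]
  exact fun hv => h s hs hv

theorem stepSum_filter (C : Finset (Finset V)) {u : Finset V → ℝ} (h : ∀ s ∈ C, 0 ≤ u s) (v : V) :
    stepSum (C.filter fun s => 0 < u s) u v = stepSum C u v := by
  unfold stepSum
  refine Finset.sum_subset (Finset.filter_subset _ _) fun s hs hn => ?_
  have : u s = 0 := by
    by_contra h'
    exact hn (Finset.mem_filter.2 ⟨hs, lt_of_le_of_ne (h s hs) (Ne.symm h')⟩)
  rw [this, ite_self]

theorem IsNest.exists_mem_top {C : Finset (Finset V)} (h : IsNest C) {σ : Finset V} (hσ : σ ∈ C)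
    (htop : ∀ s ∈ C, s ⊆ σ) : ∃ v ∈ σ, ∀ s ∈ C, v ∈ s → s = σ := by
  rcases (C.erase σ).eq_empty_or_nonempty with he | hne
  · obtain ⟨v, hv⟩ := h.nonempty σ hσ
    refine ⟨v, hv, fun s hs _ => ?_⟩
    by_contra hne
    exact Finset.eq_empty_iff_forall_notMem.1 he s (Finset.mem_erase.2 ⟨hne, hs⟩)
  · have h' := h.subset (Finset.erase_subset σ C)
    obtain ⟨τ, hτ, hmax⟩ := h'.exists_top hne
    have hτ' := Finset.mem_erase.1 hτ
    obtain ⟨v, hv, hvτ⟩ := Finset.exists_of_ssubset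
      (Finset.ssubset_iff_subset_ne.2 ⟨htop τ hτ'.2, hτ'.1⟩)
    refine ⟨v, hv, fun s hs hvs => ?_⟩
    by_contra hne
    exact hvτ (hmax s (Finset.mem_erase.2 ⟨hne, hs⟩) hvs)

theorem stepSum_eq_top {C : Finset (Finset V)} {u : Finset V → ℝ} {σ : Finset V} (hσ : σ ∈ C)
    {v : V} (hv : v ∈ σ) (h : ∀ s ∈ C, v ∈ s → s = σ) : stepSum C u v = u σ := by
  unfold stepSum
  rw [Finset.sum_eq_single_of_mem σ hσ, if_pos hv]
  exact fun s hs hne => if_neg fun hv => hne (h s hs hv)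

theorem stepSum_erase {C : Finset (Finset V)} (u : Finset V → ℝ) {σ : Finset V} (hσ : σ ∈ C)
    (v : V) : stepSum (C.erase σ) u v = stepSum C u v - if v ∈ σ then u σ else 0 := by
  unfold stepSum
  rw [← Finset.add_sum_erase C _ hσ]
  ring

theorem IsNest.ext {C D : Finset (Finset V)} (hC : IsNest C) (hD : IsNest D)
    {u u' : Finset V → ℝ} (hu : ∀ s ∈ C, 0 < u s) (hu' : ∀ s ∈ D, 0 < u' s)
    (h : ∀ v, stepSum C u v = stepSum D u' v) : C = D ∧ ∀ s ∈ C, u s = u' s := by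
  induction hn : C.card generalizing C D with
  | zero =>
    rw [Finset.card_eq_zero] at hn
    subst hn
    rcases D.eq_empty_or_nonempty with rfl | ⟨s, hs⟩
    · simp
    · obtain ⟨v, hv⟩ := hD.nonempty s hs
      have h1 := le_stepSum (fun t ht => (hu' t ht).le) hs hv
      rw [← h v, stepSum_eq_zero (by simp)] at h1
      exact absurd (hu' s hs) h1.not_gt
  | succ n ih =>
    have hCne : C.Nonempty := Finset.card_pos.1 (by lia)
    obtain ⟨σ, hσ, htop⟩ := hC.exists_top hCne
    obtain ⟨x, hx, hxC⟩ := hC.exists_mem_top hσ htop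
    have hDne : D.Nonempty := by
      by_contra hne
      rw [Finset.not_nonempty_iff_eq_empty] at hne
      subst hne
      have h1 := le_stepSum (fun t ht => (hu t ht).le) hσ hx
      rw [h x, stepSum_eq_zero (by simp)] at h1
      exact absurd (hu σ hσ) h1.not_gt
    obtain ⟨τ, hτ, htop'⟩ := hD.exists_top hDne
    have hsupp : ∀ v, v ∈ σ ↔ v ∈ τ := by
      intro v
      constructor
      · intro hv
        by_contra hn
        have h1 := le_stepSum (fun t ht => (hu t ht).le) hσ hv
        rw [h v, stepSum_eq_zero fun s hs hv => hn (htop' s hs hv)] at h1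
        exact absurd (hu σ hσ) h1.not_gt
      · intro hv
        by_contra hn
        have h1 := le_stepSum (fun t ht => (hu' t ht).le) hτ hv
        rw [← h v, stepSum_eq_zero fun s hs hv => hn (htop s hs hv)] at h1
        exact absurd (hu' τ hτ) h1.not_gt
    obtain rfl : σ = τ := Finset.ext hsupp
    obtain ⟨y, hy, hyD⟩ := hD.exists_mem_top hτ htop'
    have heq : u σ = u' σ := by
      apply le_antisymm
      · rw [← stepSum_eq_top (u := u') hτ hy hyD, ← h y]
        exact le_stepSum (fun t ht => (hu t ht).le) hσ hy
      · rw [← stepSum_eq_top (u := u) hσ hx hxC, h x]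
        exact le_stepSum (fun t ht => (hu' t ht).le) hτ hx
    obtain ⟨h1, h2⟩ := ih (hC.subset (Finset.erase_subset σ C))
      (hD.subset (Finset.erase_subset σ D)) (fun s hs => hu s (Finset.mem_of_mem_erase hs))
      (fun s hs => hu' s (Finset.mem_of_mem_erase hs))
      (fun v => by rw [stepSum_erase u hσ, stepSum_erase u' hτ, h v, heq])
      (by rw [Finset.card_erase_of_mem hσ, hn]; rfl)
    refine ⟨?_, fun s hs => ?_⟩
    · rw [← Finset.insert_erase hσ, h1, Finset.insert_erase hτ]
    · by_cases hsσ : s = σ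
      · rw [hsσ, heq]
      · exact h2 s (Finset.mem_erase.2 ⟨hsσ, hs⟩)

theorem exists_nest (σ : Finset V) (f : V → ℝ) (h0 : ∀ v, 0 ≤ f v) (hs : ∀ v, v ∈ σ ↔ f v ≠ 0) :
    ∃ (C : Finset (Finset V)) (u : Finset V → ℝ), IsNest C ∧ (∀ s ∈ C, s ⊆ σ) ∧
      (∀ s ∈ C, 0 < u s) ∧ ∀ v, f v = stepSum C u v := by
  induction σ using Finset.strongInduction generalizing f with
  | H σ ih =>
    have hz : ∀ v, v ∉ σ → f v = 0 := fun v hv => by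
      by_contra h
      exact hv ((hs v).2 h)
    rcases σ.eq_empty_or_nonempty with rfl | hne
    · exact ⟨∅, 0, ⟨by simp, by simp⟩, by simp, by simp, fun v => by
        rw [stepSum_eq_zero (by simp), hz v (by simp)]⟩
    · obtain ⟨x, hx, hmin⟩ := σ.exists_min_image f hne
      have hxpos : 0 < f x := lt_of_le_of_ne (h0 x) ((hs x).1 hx).symm
      set g : V → ℝ := fun v => f v - if v ∈ σ then f x else 0 with hg
      have hgz : ∀ v, v ∉ σ → g v = 0 := fun v hv => by simp [hg, hv, hz v hv]
      have hτ : (σ.filter fun v => g v ≠ 0) ⊂ σ := by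
        refine Finset.filter_ssubset.2 ⟨x, hx, ?_⟩
        simp [hg, hx]
      obtain ⟨C, u, hC, hsub, hu, hfu⟩ := ih _ hτ g
        (fun v => by
          by_cases hv : v ∈ σ
          · simpa [hg, hv] using hmin v hv
          · exact (hgz v hv).ge)
        (fun v => by
          rw [Finset.mem_filter, and_iff_right_iff_imp]
          intro h
          by_contra hv
          exact h (hgz v hv))
      have hσC : σ ∉ C := fun h => hτ.2 (hsub σ h)
      have hsub' : ∀ s ∈ C, s ⊆ σ := fun s hs => (hsub s hs).trans hτ.1
      have hne' : ∀ s ∈ C, s ≠ σ := fun s hs e => hσC (e ▸ hs)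
      refine ⟨insert σ C, Function.update u σ (f x), ⟨?_, ?_⟩, ?_, ?_, fun v => ?_⟩
      · intro s hs t ht
        rcases Finset.mem_insert.1 hs with hs | hs
        · rcases Finset.mem_insert.1 ht with ht | ht
          · exact .inl (hs.trans ht.symm).subset
          · exact .inr (hs ▸ hsub' t ht)
        · rcases Finset.mem_insert.1 ht with ht | ht
          · exact .inl (ht ▸ hsub' s hs)
          · exact hC.total s hs t ht
      · exact Finset.forall_mem_insert _ _ _ |>.2 ⟨hne, hC.nonempty⟩
      · exact Finset.forall_mem_insert _ _ _ |>.2 ⟨subset_rfl, hsub'⟩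
      · refine Finset.forall_mem_insert _ _ _ |>.2 ⟨by simpa using hxpos, fun s hs => ?_⟩
        rw [Function.update_of_ne (hne' s hs)]
        exact hu s hs
      · have h1 := stepSum_erase (C := insert σ C) (Function.update u σ (f x))
          (Finset.mem_insert_self σ C) v
        rw [Finset.erase_insert hσC, stepSum_congr (u' := u) (fun s hs => by
          rw [Function.update_of_ne (hne' s hs)]), ← hfu v, Function.update_self] at h1
        simp only [hg] at h1
        linarith

end

end SComplex

/-- A parametrization of the standard simplex by the closed unit ball. -/
noncomputable def ballParam (n : ℕ) : EuclideanSpace ℝ (Fin n) → Fin (n + 1) → ℝ :=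
  (exists_ball_stdSimplex n).choose

theorem continuous_ballParam (n : ℕ) : Continuous (ballParam n) :=
  (exists_ball_stdSimplex n).choose_spec.1

theorem ballParam_injective (n : ℕ) : Function.Injective (ballParam n) :=
  (exists_ball_stdSimplex n).choose_spec.2.1

theorem ballParam_image_closedBall (n : ℕ) :
    ballParam n '' Metric.closedBall 0 1 = stdSimplex ℝ (Fin (n + 1)) :=
  (exists_ball_stdSimplex n).choose_spec.2.2.1

theorem ballParam_image_ball (n : ℕ) :
    ballParam n '' Metric.ball 0 1 = {a | (∀ i, 0 < a i) ∧ ∑ i, a i = 1} :=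
  (exists_ball_stdSimplex n).choose_spec.2.2.2

theorem ballParam_mem {n : ℕ} {x : EuclideanSpace ℝ (Fin n)} (hx : x ∈ Metric.closedBall 0 1) :
    ballParam n x ∈ stdSimplex ℝ (Fin (n + 1)) :=
  ballParam_image_closedBall n ▸ Set.mem_image_of_mem _ hx

theorem ballParam_pos_iff {n : ℕ} {x : EuclideanSpace ℝ (Fin n)} (hx : x ∈ Metric.closedBall 0 1) :
    (∀ i, 0 < ballParam n x i) ↔ x ∈ Metric.ball 0 1 := by
  rw [← (ballParam_injective n).mem_set_image, ballParam_image_ball]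
  exact ⟨fun h => ⟨h, (ballParam_mem hx).2⟩, fun h => h.1⟩

namespace SComplex

section
variable {V : Type}

/-- A simplex of the barycentric subdivision of `X`. -/
structure Cell (X : SComplex V) (n : ℕ) : Type where
  carrier : Finset (Finset V)
  card_eq : carrier.card = n + 1
  isNest : IsNest carrier
  mem_faces : ∀ s ∈ carrier, s ∈ X.faces

variable {X : SComplex V}

theorem sum_eq_one_of_supported {f : V → ℝ} (hf : f ∈ X.realization) {σ : Finset V}
    (h : ∀ v, f v ≠ 0 → v ∈ σ) : ∑ v ∈ σ, f v = 1 := by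
  obtain ⟨τ, -, hτ, h1⟩ := exists_support hf
  rw [← h1]
  refine (Finset.sum_subset (fun v hv => h v ((hτ v).1 hv)) fun v _ hv => ?_).symm
  by_contra h'
  exact hv ((hτ v).2 h')

theorem Cell.exists_top {n : ℕ} (c : X.Cell n) : ∃ σ ∈ c.carrier, ∀ s ∈ c.carrier, s ⊆ σ :=
  c.isNest.exists_top (Finset.card_pos.1 (by rw [c.card_eq]; lia))

theorem Cell.card_ne_zero {n : ℕ} (c : X.Cell n) {s : Finset V} (hs : s ∈ c.carrier) :
    (s.card : ℝ) ≠ 0 :=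
  Nat.cast_ne_zero.2 (Finset.card_ne_zero.2 (c.isNest.nonempty s hs))

theorem finite_cells {Q : Set (Finset V)} (hQ : Q.Finite) :
    {p : Σ m, X.Cell m | ∀ s ∈ p.2.carrier, s ∈ Q}.Finite := by
  refine Set.Finite.of_finite_image (f := fun p : Σ m, X.Cell m => p.2.carrier) ?_ ?_
  · refine (hQ.toFinset.powerset.finite_toSet).subset ?_
    rintro _ ⟨p, hp, rfl⟩
    exact Finset.mem_powerset.2 fun s hs => hQ.mem_toFinset.2 (hp s hs)
  · rintro ⟨m, c, hc, h1, h2⟩ - ⟨m', c', hc', h1', h2'⟩ - h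
    simp only at h
    subst h
    obtain rfl : m = m' := by lia
    rfl

end

section
variable {V : Type} [DecidableEq V]

/-- The points of `X` in the relative interior of the simplex of the barycentric subdivision
with vertices the barycenters of the elements of `C`. -/
def openFace (X : SComplex V) (C : Finset (Finset V)) : Set X.realization :=
  {f | ∃ u : Finset V → ℝ, (∀ s ∈ C, 0 < u s) ∧ ∀ v, f.1 v = stepSum C u v}

variable {X : SComplex V}

theorem eq_of_mem_openFace {C D : Finset (Finset V)} (hC : IsNest C) (hD : IsNest D)
    {f : X.realization} (hf : f ∈ X.openFace C) (hf' : f ∈ X.openFace D) : C = D := by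
  obtain ⟨u, hu, h⟩ := hf
  obtain ⟨u', hu', h'⟩ := hf'
  exact (hC.ext hD hu hu' fun v => by rw [← h, ← h']).1

namespace Cell

variable {n : ℕ} (c : X.Cell n)

/-- The increments of the step function with barycentric coordinates `a` in a cell. -/
noncomputable def weight (a : Fin (n + 1) → ℝ) (s : Finset V) : ℝ :=
  if h : s ∈ c.carrier then a (c.carrier.equivFinOfCardEq c.card_eq ⟨s, h⟩) / s.card else 0

theorem weight_nonneg {a : Fin (n + 1) → ℝ} (ha : ∀ i, 0 ≤ a i) (s : Finset V) :
    0 ≤ c.weight a s := by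
  unfold weight
  split_ifs with h
  · exact div_nonneg (ha _) (Nat.cast_nonneg _)
  · exact le_rfl

theorem weight_pos {a : Fin (n + 1) → ℝ} (ha : ∀ i, 0 < a i) {s : Finset V}
    (hs : s ∈ c.carrier) : 0 < c.weight a s := by
  rw [weight, dif_pos hs]
  exact div_pos (ha _) (lt_of_le_of_ne (Nat.cast_nonneg _) (c.card_ne_zero hs).symm)

theorem sum_weight (a : Fin (n + 1) → ℝ) :
    ∑ s ∈ c.carrier, s.card * c.weight a s = ∑ i, a i := by
  rw [← Equiv.sum_comp (c.carrier.equivFinOfCardEq c.card_eq), ← Finset.sum_coe_sort]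
  refine Finset.sum_congr rfl fun s _ => ?_
  rw [weight, dif_pos s.2, mul_div_cancel₀ _ (c.card_ne_zero s.2)]

theorem stepSum_weight_mem {a : Fin (n + 1) → ℝ} (ha : a ∈ stdSimplex ℝ (Fin (n + 1))) :
    stepSum c.carrier (c.weight a) ∈ X.realization := by
  obtain ⟨σ, hσ, htop⟩ := c.exists_top
  refine ⟨stepSum_nonneg fun s _ => c.weight_nonneg ha.1 s, σ, c.mem_faces σ hσ,
    fun v hv => stepSum_eq_zero fun s hs hvs => hv (htop s hs hvs), ?_⟩
  rw [sum_stepSum _ htop, c.sum_weight, ha.2]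

theorem exists_weight {f : X.realization} {u : Finset V → ℝ}
    (hf : ∀ v, f.1 v = stepSum c.carrier u v) :
    ∃ a : Fin (n + 1) → ℝ, ∑ i, a i = 1 ∧ (∀ s ∈ c.carrier, c.weight a s = u s) ∧
      ∀ i, ∃ s ∈ c.carrier, a i = s.card * u s := by
  set e := c.carrier.equivFinOfCardEq c.card_eq with he
  have hw : ∀ s ∈ c.carrier, c.weight (fun i => (e.symm i).1.card * u (e.symm i)) s = u s := by
    intro s hs
    rw [weight, dif_pos hs, ← he, Equiv.symm_apply_apply]
    exact mul_div_cancel_left₀ _ (c.card_ne_zero hs)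
  refine ⟨fun i => (e.symm i).1.card * u (e.symm i), ?_, hw, fun i => ⟨_, (e.symm i).2, rfl⟩⟩
  obtain ⟨σ, hσ, htop⟩ := c.exists_top
  rw [← c.sum_weight, Finset.sum_congr rfl fun s hs => by rw [hw s hs], ← sum_stepSum u htop,
    ← Finset.sum_congr rfl fun v _ => hf v]
  refine sum_eq_one_of_supported f.2 fun v hv => ?_
  by_contra hn
  exact hv ((hf v).trans (stepSum_eq_zero fun s hs hvs => hn (htop s hs hvs)))

open Classical in
/-- The characteristic map of a cell of the barycentric subdivision. -/
noncomputable def attach [Nonempty X.realization] (x : EuclideanSpace ℝ (Fin n)) : X.realization :=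
  if h : stepSum c.carrier (c.weight (ballParam n x)) ∈ X.realization then ⟨_, h⟩
  else Classical.arbitrary _

variable [Nonempty X.realization]

theorem attach_val {x : EuclideanSpace ℝ (Fin n)} (hx : x ∈ Metric.closedBall 0 1) :
    (c.attach x).1 = stepSum c.carrier (c.weight (ballParam n x)) := by
  rw [attach, dif_pos (c.stepSum_weight_mem (ballParam_mem hx))]

theorem continuousOn_attach : ContinuousOn c.attach (Metric.closedBall 0 1) := by
  rw [Topology.IsInducing.subtypeVal.continuousOn_iff]
  refine ContinuousOn.congr (f := fun x => stepSum c.carrier (c.weight (ballParam n x))) ?_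
    fun x hx => c.attach_val hx
  refine Continuous.continuousOn (continuous_pi fun v => continuous_finsetSum _ fun s hs => ?_)
  split_ifs
  · simp only [weight, dif_pos hs]
    exact ((continuous_apply _).comp (continuous_ballParam n)).div_const _
  · exact continuous_const

theorem image_ball : c.attach '' Metric.ball 0 1 = X.openFace c.carrier := by
  ext f
  constructor
  · rintro ⟨x, hx, rfl⟩
    have hx' := Metric.ball_subset_closedBall hx
    exact ⟨_, fun s hs => c.weight_pos ((ballParam_pos_iff hx').2 hx) hs,
      congrFun (c.attach_val hx')⟩
  · rintro ⟨u, hu, hf⟩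
    obtain ⟨a, h1, ha, ha'⟩ := c.exists_weight hf
    have : a ∈ ballParam n '' Metric.ball 0 1 := by
      rw [ballParam_image_ball]
      refine ⟨fun i => ?_, h1⟩
      obtain ⟨s, hs, h⟩ := ha' i
      rw [h]
      exact mul_pos (lt_of_le_of_ne (Nat.cast_nonneg _) (c.card_ne_zero hs).symm) (hu s hs)
    obtain ⟨x, hx, rfl⟩ := this
    refine ⟨x, hx, Subtype.ext (funext fun v => ?_)⟩
    rw [c.attach_val (Metric.ball_subset_closedBall hx), hf v]
    exact stepSum_congr ha v

theorem injOn_attach : Set.InjOn c.attach (Metric.ball 0 1) := by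
  intro x hx y hy hxy
  have hx' := Metric.ball_subset_closedBall hx
  have hy' := Metric.ball_subset_closedBall hy
  refine ballParam_injective n (funext fun i => ?_)
  have h := (c.isNest.ext c.isNest
    (fun s hs => c.weight_pos ((ballParam_pos_iff hx').2 hx) hs)
    (fun s hs => c.weight_pos ((ballParam_pos_iff hy').2 hy) hs) fun v => by
      rw [← c.attach_val hx', ← c.attach_val hy', hxy]).2
  obtain ⟨s, rfl⟩ := (c.carrier.equivFinOfCardEq c.card_eq).surjective i
  have h1 := h s s.2
  rw [weight, weight, dif_pos s.2, dif_pos s.2] at h1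
  exact (div_left_inj' (c.card_ne_zero s.2)).1 h1

theorem support_subset {σ : Finset V} (h : ∀ s ∈ c.carrier, s ⊆ σ)
    {x : EuclideanSpace ℝ (Fin n)} (hx : x ∈ Metric.closedBall 0 1) {v : V}
    (hv : (c.attach x).1 v ≠ 0) :
    v ∈ σ := by
  by_contra hn
  rw [c.attach_val hx] at hv
  exact hv (stepSum_eq_zero fun s hs hvs => hn (h s hs hvs))

theorem attach_sphere {x : EuclideanSpace ℝ (Fin n)} (hx : x ∈ Metric.sphere 0 1) :
    ∃ m < n, ∃ d : X.Cell m, c.attach x ∈ X.openFace d.carrier := by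
  have hx' := Metric.sphere_subset_closedBall hx
  set u := c.weight (ballParam n x) with hu
  have hu0 : ∀ s ∈ c.carrier, 0 ≤ u s := fun s _ => c.weight_nonneg (ballParam_mem hx').1 s
  set D := c.carrier.filter fun s => 0 < u s with hD
  have hval : ∀ v, (c.attach x).1 v = stepSum D u v := fun v => by
    rw [c.attach_val hx', stepSum_filter _ hu0]
  have hDne : D.Nonempty := by
    by_contra hne
    rw [Finset.not_nonempty_iff_eq_empty] at hne
    obtain ⟨v, hv⟩ := exists_pos (c.attach x).2
    rw [hval v, hne, stepSum_eq_zero (by simp)] at hv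
    exact lt_irrefl _ hv
  have hlt : D.card < n + 1 := by
    rw [← c.card_eq]
    refine Finset.card_lt_card (Finset.filter_ssubset.2 ?_)
    by_contra! h
    have : x ∈ Metric.ball 0 1 := by
      rw [← ballParam_pos_iff hx']
      intro i
      obtain ⟨s, rfl⟩ := (c.carrier.equivFinOfCardEq c.card_eq).surjective i
      have h1 := h s s.2
      rw [hu, weight, dif_pos s.2] at h1
      by_contra h2
      exact h1.not_ge (div_nonpos_of_nonpos_of_nonneg (not_lt.1 h2) (Nat.cast_nonneg _))
    rw [Metric.mem_ball] at this
    rw [Metric.mem_sphere] at hx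
    exact this.ne hx
  have hpos := Finset.card_pos.2 hDne
  refine ⟨D.card - 1, by lia, ⟨D, by lia, c.isNest.subset (Finset.filter_subset _ _),
    fun s hs => c.mem_faces s (Finset.mem_of_mem_filter s hs)⟩, u,
    fun s hs => (Finset.mem_filter.1 hs).2, hval⟩

end Cell

theorem exists_mem_openFace (f : X.realization) :
    ∃ (n : ℕ) (c : X.Cell n), f ∈ X.openFace c.carrier := by
  obtain ⟨σ, hσ, hs, -⟩ := exists_support f.2
  obtain ⟨C, u, hC, hsub, hu, h⟩ := exists_nest σ f.1 f.2.1 hs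
  have hne : C.Nonempty := by
    by_contra hne
    rw [Finset.not_nonempty_iff_eq_empty] at hne
    obtain ⟨v, hv⟩ := exists_pos f.2
    rw [h v, hne, stepSum_eq_zero (by simp)] at hv
    exact lt_irrefl _ hv
  have hpos := Finset.card_pos.2 hne
  exact ⟨C.card - 1, ⟨C, by lia, hC, fun s hs =>
    X.down_closed σ hσ s (hsub s hs) (hC.nonempty s hs)⟩, u, hu, h⟩

theorem subset_of_mem_openFace {C : Finset (Finset V)} {f : X.realization}
    (hf : f ∈ X.openFace C) {σ : Finset V} (h : ∀ v, f.1 v ≠ 0 → v ∈ σ) : ∀ s ∈ C, s ⊆ σ := by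
  obtain ⟨u, hu, hfu⟩ := hf
  intro s hs v hv
  refine h v (ne_of_gt ((hu s hs).trans_le ?_))
  rw [hfu v]
  exact le_stepSum (fun t ht => (hu t ht).le) hs hv

/-- The barycentric subdivision of a locally finite simplicial complex. -/
noncomputable def cwStructure [Nonempty X.realization]
    (hfin : ∀ v, {σ ∈ X.faces | v ∈ σ}.Finite) : CWStructure X.realization where
  cell := X.Cell
  attach _ c := c.attach
  continuousOn_attach _ c := c.continuousOn_attach
  injOn_attach _ c := c.injOn_attach
  pairwiseDisjoint := by
    rintro ⟨n, c⟩ - ⟨m, d⟩ - hne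
    change Disjoint (c.attach '' Metric.ball 0 1) (d.attach '' Metric.ball 0 1)
    rw [Cell.image_ball, Cell.image_ball]
    refine Set.disjoint_left.2 fun f hf hf' => hne ?_
    obtain ⟨c, hc, h1, h2⟩ := c
    obtain ⟨d, hd, h1', h2'⟩ := d
    have h := eq_of_mem_openFace h1 h1' hf hf'
    subst h
    obtain rfl : n = m := by lia
    rfl
  cover := by
    refine Set.eq_univ_of_forall fun f => ?_
    obtain ⟨n, c, h⟩ := exists_mem_openFace f
    refine Set.mem_iUnion.2 ⟨⟨n, c⟩, ?_⟩
    rwa [Cell.image_ball]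
  attach_sphere n c := by
    rintro _ ⟨x, hx, rfl⟩
    obtain ⟨m, hm, d, h⟩ := c.attach_sphere hx
    refine Set.mem_iUnion₂.2 ⟨⟨m, d⟩, hm, ?_⟩
    rwa [Cell.image_ball]
  closure_finiteness n c := by
    obtain ⟨σ, -, htop⟩ := c.exists_top
    refine (finite_cells σ.powerset.finite_toSet).subset ?_
    rintro ⟨m, d⟩ hd
    obtain ⟨_, hf, x, hx, rfl⟩ := Set.nonempty_iff_ne_empty.2 hd
    rw [Cell.image_ball] at hf
    exact fun s hs => Finset.mem_coe.2 (Finset.mem_powerset.2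
      (subset_of_mem_openFace hf (fun v hv => c.support_subset htop hx hv) s hs))
  weak_topology A hA := by
    rw [← isOpen_compl_iff, isOpen_iff_mem_nhds]
    intro f hf
    obtain ⟨v, hv⟩ := exists_pos f.2
    set Q : Set (Finset V) := ⋃ σ ∈ {σ ∈ X.faces | v ∈ σ}, (σ.powerset : Set (Finset V)) with hQ
    have hQfin : Q.Finite := (hfin v).biUnion fun σ _ => σ.powerset.finite_toSet
    set P := {p : Σ m, X.Cell m | ∀ s ∈ p.2.carrier, s ∈ Q}
    set F := ⋃ p ∈ P, p.2.attach '' {x | x ∈ Metric.closedBall 0 1 ∧ p.2.attach x ∈ A} with hF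
    have hFc : IsClosed F := by
      refine (finite_cells hQfin).isClosed_biUnion fun p _ => IsCompact.isClosed ?_
      refine IsCompact.image_of_continuousOn ?_ (p.2.continuousOn_attach.mono fun x hx => hx.1)
      exact (isCompact_closedBall _ _).of_isClosed_subset (hA p.1 p.2) fun x hx => hx.1
    refine Filter.mem_of_superset (((isOpen_pos v).inter hFc.isOpen_compl).mem_nhds ⟨hv, ?_⟩) ?_
    · intro h
      obtain ⟨p, -, x, hx, rfl⟩ := Set.mem_iUnion₂.1 h
      exact hf hx.2
    · rintro g ⟨hg, hgF⟩ hgA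
      obtain ⟨n, c, hc⟩ := exists_mem_openFace g
      obtain ⟨σ, hσ, hs, -⟩ := exists_support g.2
      have hcP : (⟨n, c⟩ : Σ m, X.Cell m) ∈ P := fun s hs' =>
        Set.mem_biUnion (x := σ) ⟨hσ, (hs v).2 (ne_of_gt hg)⟩ (Finset.mem_coe.2
          (Finset.mem_powerset.2 (subset_of_mem_openFace hc (fun v hv => (hs v).2 hv) s hs')))
      rw [← Cell.image_ball] at hc
      obtain ⟨x, hx, rfl⟩ := hc
      exact hgF (Set.mem_iUnion₂.2 ⟨⟨n, c⟩, hcP, x, ⟨Metric.ball_subset_closedBall hx, hgA⟩, rfl⟩)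

theorem cwStructure_openCell [Nonempty X.realization]
    (hfin : ∀ v, {σ ∈ X.faces | v ∈ σ}.Finite) {n : ℕ} (c : X.Cell n) :
    (cwStructure hfin).openCell n c = X.openFace c.carrier := c.image_ball

end

end SComplex

namespace SComplex

open Pointwise

section
variable {V : Type} [DecidableEq V] {X : SComplex V} {G : Type} [Group G] [MulAction G V]

theorem IsSimplicialAction.comp_mem (ha : X.IsSimplicialAction G) (g : G) {f : V → ℝ}
    (hf : f ∈ X.realization) : (fun v => f (g⁻¹ • v)) ∈ X.realization := by
  obtain ⟨h0, σ, hσ, hz, h1⟩ := hf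
  refine ⟨fun v => h0 _, g • σ, ha.smul_mem g hσ, fun v hv => hz _ fun h => hv ?_, ?_⟩
  · exact Finset.mem_image.2 ⟨_, h, smul_inv_smul g v⟩
  · rw [Finset.smul_finset_def, Finset.sum_image fun x _ y _ e => MulAction.injective g e, ← h1]
    simp only [inv_smul_smul]

/-- The action on the realization induced by a simplicial action. -/
@[reducible] def realizationAction (ha : X.IsSimplicialAction G) :
    MulAction G X.realization where
  smul g f := ⟨fun v => f.1 (g⁻¹ • v), ha.comp_mem g f.2⟩
  one_smul f := Subtype.ext (funext fun v => by
    change f.1 ((1 : G)⁻¹ • v) = f.1 v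
    rw [inv_one, one_smul])
  mul_smul g k f := Subtype.ext (funext fun v => by
    change f.1 ((g * k)⁻¹ • v) = f.1 (k⁻¹ • g⁻¹ • v)
    rw [mul_inv_rev, mul_smul])

theorem stepSum_smul (g : G) (C : Finset (Finset V)) (u : Finset V → ℝ) (v : V) :
    stepSum C u (g⁻¹ • v) = stepSum (g • C) (fun s => u (g⁻¹ • s)) v := by
  unfold stepSum
  rw [Finset.smul_finset_def, Finset.sum_image fun x _ y _ e => MulAction.injective g e]
  refine Finset.sum_congr rfl fun s _ => ?_
  simp only [inv_smul_smul, Finset.inv_smul_mem_iff]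

/-- The image of a simplex of the barycentric subdivision. -/
def Cell.smul (ha : X.IsSimplicialAction G) (g : G) {n : ℕ} (c : X.Cell n) : X.Cell n where
  carrier := g • c.carrier
  card_eq := by rw [Finset.card_smul_finset, c.card_eq]
  isNest := by
    refine ⟨fun _ hs _ ht => ?_, fun _ hs => ?_⟩
    · obtain ⟨s, hs', rfl⟩ := Finset.mem_image.1 hs
      obtain ⟨t, ht', rfl⟩ := Finset.mem_image.1 ht
      exact (c.isNest.total s hs' t ht').imp Finset.smul_finset_subset_smul_finset
        Finset.smul_finset_subset_smul_finset
    · obtain ⟨s, hs', rfl⟩ := Finset.mem_image.1 hs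
      exact (c.isNest.nonempty s hs').smul_finset
  mem_faces _ hs := by
    obtain ⟨s, hs', rfl⟩ := Finset.mem_image.1 hs
    exact ha.smul_mem g (c.mem_faces s hs')

theorem smul_mem_openFace (ha : X.IsSimplicialAction G) (g : G) {C : Finset (Finset V)}
    {f : X.realization} (hf : f ∈ X.openFace C) :
    (realizationAction ha).smul g f ∈ X.openFace (g • C) := by
  obtain ⟨u, hu, h⟩ := hf
  refine ⟨fun s => u (g⁻¹ • s), fun _ hs => ?_, fun v => ?_⟩
  · obtain ⟨s, hs', rfl⟩ := Finset.mem_image.1 hs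
    simpa using hu s hs'
  · rw [← stepSum_smul]
    exact h _

theorem image_openFace (ha : X.IsSimplicialAction G) (g : G) (C : Finset (Finset V)) :
    letI := realizationAction ha
    (fun f : X.realization => g • f) '' X.openFace C = X.openFace (g • C) := by
  let _ := realizationAction ha
  apply subset_antisymm
  · rintro _ ⟨f, hf, rfl⟩
    exact smul_mem_openFace ha g hf
  · intro f hf
    refine ⟨g⁻¹ • f, ?_, smul_inv_smul g f⟩
    have := smul_mem_openFace ha g⁻¹ hf
    rwa [inv_smul_smul] at this

theorem continuous_realizationAction (ha : X.IsSimplicialAction G) (g : G) :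
    letI := realizationAction ha
    Continuous fun f : X.realization => g • f := by
  change Continuous fun f : X.realization =>
    (⟨fun v => f.1 (g⁻¹ • v), ha.comp_mem g f.2⟩ : X.realization)
  refine Continuous.subtype_mk (continuous_pi fun v => ?_) _
  exact (continuous_apply (g⁻¹ • v)).comp continuous_subtype_val

theorem isRigidCellularAction [Nonempty X.realization] (ha : X.IsSimplicialAction G)
    (hfin : ∀ v, {σ ∈ X.faces | v ∈ σ}.Finite) :
    letI := realizationAction ha
    IsRigidCellularAction G (cwStructure hfin) := by
  let _ := realizationAction ha
  refine ⟨continuous_realizationAction ha, fun g n c => ⟨Cell.smul ha g c, ?_⟩,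
    fun g n c h => ?_⟩
  · rw [cwStructure_openCell hfin (c : X.Cell n), cwStructure_openCell hfin (Cell.smul ha g c)]
    exact image_openFace ha g _
  · rw [cwStructure_openCell hfin (c : X.Cell n)] at h ⊢
    rintro f hf
    have hC : g • (c : X.Cell n).carrier = (c : X.Cell n).carrier := by
      refine eq_of_mem_openFace (Cell.smul ha g c).isNest (c : X.Cell n).isNest
        (f := g • f) (smul_mem_openFace ha g hf) ?_
      rw [← h]
      exact ⟨f, hf, rfl⟩
    have hs : ∀ s ∈ (c : X.Cell n).carrier, g • s = s := fun s hs =>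
      (c : X.Cell n).isNest.eq_of_card_eq (by
        rw [← hC]
        exact Finset.smul_mem_smul_finset hs) hs (Finset.card_smul_finset g s)
    obtain ⟨u, hu, hfu⟩ := hf
    refine Subtype.ext (funext fun v => ?_)
    change f.1 (g⁻¹ • v) = f.1 v
    rw [hfu, hfu]
    refine Finset.sum_congr rfl fun s hs' => ?_
    have : g⁻¹ • v ∈ s ↔ v ∈ s := by
      rw [Finset.inv_smul_mem_iff, hs s hs']
    simp only [this]

theorem properlyDiscontinuousSMul (ha : X.IsSimplicialAction G) (hs : X.HasFiniteStabilizers G)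
    (hc : X.IsCocompactSAction G) :
    letI := realizationAction ha
    ProperlyDiscontinuousSMul G X.realization := by
  let _ := realizationAction ha
  refine ⟨fun {K L} hK hL => ?_⟩
  obtain ⟨S, hS⟩ := exists_finite_support (finite_neighbors ha hs hc) hK
  obtain ⟨T, hT⟩ := exists_finite_support (finite_neighbors ha hs hc) hL
  have : (⋃ v ∈ {v | v ∈ S ∧ ({v} : Finset V) ∈ X.faces}, ⋃ w ∈ T,
      {g : G | g • v = w}).Finite :=
    (S.finite_toSet.subset fun v hv => hv.1).biUnion fun v hv =>
      T.finite_toSet.biUnion fun w _ => hs.finite_smul_eq hv.2 w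
  refine this.subset ?_
  rintro g ⟨_, ⟨f, hf, rfl⟩, hfL⟩
  obtain ⟨v, hv⟩ := exists_pos f.2
  obtain ⟨σ, hσ, h, -⟩ := exists_support f.2
  simp only [Set.mem_iUnion]
  refine ⟨v, ⟨hS f hf v hv.ne', vertex_mem hσ ((h v).2 hv.ne')⟩, g • v, hT _ hfL _ ?_, rfl⟩
  change f.1 (g⁻¹ • g • v) ≠ 0
  rw [inv_smul_smul]
  exact hv.ne'

theorem isCocompactAction (ha : X.IsSimplicialAction G) (hc : X.IsCocompactSAction G) :
    letI := realizationAction ha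
    IsCocompactAction G X.realization := by
  let _ := realizationAction ha
  obtain ⟨S, hS, h⟩ := hc
  refine ⟨⋃ σ ∈ S, {f : X.realization | ∀ v, f.1 v ≠ 0 → v ∈ σ},
    hS.isCompact_biUnion fun σ _ => isCompact_supported σ, Set.eq_univ_of_forall fun f => ?_⟩
  obtain ⟨τ, hτ, hs, -⟩ := exists_support f.2
  obtain ⟨σ, hσ, g, rfl⟩ := h τ hτ
  refine Set.mem_iUnion.2 ⟨g, g⁻¹ • f, Set.mem_biUnion hσ fun v hv => ?_, smul_inv_smul g f⟩
  change f.1 (g⁻¹⁻¹ • v) ≠ 0 at hv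
  rw [inv_inv] at hv
  obtain ⟨w, hw, e⟩ := Finset.mem_image.1 ((hs _).2 hv)
  exact MulAction.injective g e ▸ hw

end

theorem infinite_vertices {V : Type u} {X : SComplex V} [Nonempty X.realization]
    (h : ConnInfty X.realization (-1)) :
    {v | ({v} : Finset V) ∈ X.faces}.Infinite := by
  intro hfin
  have hK : IsCompact (Set.univ : Set X.realization) := by
    convert isCompact_supported (X := X) hfin.toFinset
    refine (Set.eq_univ_of_forall fun f v hv => ?_).symm
    obtain ⟨σ, hσ, hs, -⟩ := exists_support f.2
    exact hfin.mem_toFinset.2 (vertex_mem hσ ((hs v).2 hv))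
  obtain ⟨L, -, -, hL⟩ := h _ hK
  have hs : (Metric.sphere (0 : EuclideanSpace ℝ (Fin (-1 + 1 : ℤ).toNat)) 1) = ∅ :=
    Set.eq_empty_of_forall_notMem fun x hx => by
      have : Subsingleton (EuclideanSpace ℝ (Fin (-1 + 1 : ℤ).toNat)) :=
        inferInstanceAs (Subsingleton (EuclideanSpace ℝ (Fin 0)))
      rw [Subsingleton.elim x 0, mem_sphere_zero_iff_norm, norm_zero] at hx
      exact zero_ne_one hx
  obtain ⟨g, -, hg, -⟩ := hL (fun _ => Classical.arbitrary _) continuousOn_const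
    (by simp [hs])
  exact hg 0 (by simp) trivial

end SComplex

/-- **Theorem (Osajda, Theorem 3.2).** Systolic groups are not simply connected at
infinity: if `G` is a systolic group then it is not the case that `Conn_k^∞(G)` holds
for every `k = -1, 0, 1`. -/
theorem isSystolicGroup_not_simplyConnectedAtInfinity (G : Type) [Group G]
    (hG : IsSystolicGroup G) :
    ¬ (∀ k : ℤ, -1 ≤ k → k ≤ 1 → ConnInftyGroup G k) := by
  obtain ⟨V, _, X, _, ⟨hX, hconn, hsc⟩, ha, hs, hc⟩ := hG
  intro h
  have hfin := SComplex.finite_neighbors ha hs hc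
  have hne : Nonempty X.realization := hconn.toNonempty
  obtain ⟨f⟩ := id hne
  obtain ⟨σ, hσ, -⟩ := SComplex.exists_support f.2
  obtain ⟨u, hu⟩ := X.nonempty_of_mem σ hσ
  have huX := SComplex.vertex_mem hσ hu
  obtain ⟨W, A, l, o, p, hA, hp, -⟩ := SComplex.exists_isCover hX huX
  have hcontr := (hp.contractibleSpace_and_bijective hA hfin).1
  let _ := SComplex.realizationAction ha
  have hk : ∀ k : ℤ, -1 ≤ k → k ≤ 1 → ConnInfty X.realization k := fun k h1 h2 =>
    h k h1 h2 X.realization hcontr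
      ⟨_, SComplex.isRigidCellularAction ha (SComplex.finite_cofaces ha hs hc)⟩
      (SComplex.properlyDiscontinuousSMul ha hs hc) (SComplex.isCocompactAction ha hc)
  exact SComplex.not_primitive_supported ha hs hc huX (SComplex.exists_primitive_supported hX hfin
    (SComplex.infinite_vertices (hk _ le_rfl (by lia))) (hk 0 (by lia) (by lia))
    (hk 1 (by lia) le_rfl))
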